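/- Let 0 < p, q < ∞ and β ∈ {1,2}, and for each n let Z_n be a random matrix uniformly distributed on B^n_{p,β}. Then, as n → ∞, n^{1/p − 1/q} (Σ_{i=1}^n |λ_i(Z_n)|^q)^{1/q} converges in probability to the constant C_{p,q} = ( (p/(p+q)) · Γ((q+1)/2)/(√π Γ((q+2)/2)) )^{1/q} / ( (1/2) · Γ((p+1)/2)/(√π Γ((p+2)/2)) )^{1/p}, i.e., for every ε > 0, P(| n^{1/p−1/q} (Σ_{i=1}^n |λ_i(Z_n)|^q)^{1/q} − C_{p,q} | > ε) → 0. (Here C_{p,q} = (E|U|^q)^{1/q}/(E|U|^p)^{1/p} for an Ullman random variable U with parameter p.) -/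

import Mathlib

open MeasureTheory Filter ENNReal Matrix
open scoped RealInnerProductSpace

set_option maxHeartbeats 1000000
set_option autoImplicit false
set_option synthInstance.maxHeartbeats 1000000

noncomputable section

instance rclikeStarModule (𝕜 : Type) [RCLike 𝕜] : StarModule ℝ 𝕜 :=
  ⟨fun r a => by
    simp [Algebra.smul_def, StarMul.star_mul, RCLike.star_def, RCLike.conj_ofReal, mul_comm]⟩

instance matrixMeasurableSpace {𝕜 : Type} [MeasurableSpace 𝕜] (n : ℕ) :
    MeasurableSpace (Matrix (Fin n) (Fin n) 𝕜) :=
  inferInstanceAs (MeasurableSpace (Fin n → Fin n → 𝕜))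

/-- The space `H_n(F_β)` of self-adjoint `n × n` matrices over `𝕜 = F_β`. -/
abbrev HMat (𝕜 : Type) [RCLike 𝕜] (n : ℕ) := selfAdjoint (Matrix (Fin n) (Fin n) 𝕜)

/-- The real eigenvalues (with multiplicity, in some order) of a self-adjoint matrix. -/
def eigs {𝕜 : Type} [RCLike 𝕜] {n : ℕ} (A : HMat 𝕜 n) : Fin n → ℝ :=
  Matrix.IsHermitian.eigenvalues A.prop

/-- The matrix unit ball `B^n_{p,β} = {A : Σ_j |λ_j(A)|^p ≤ 1}`. -/
def matBall (𝕜 : Type) [RCLike 𝕜] (n : ℕ) (p : ℝ) : Set (HMat 𝕜 n) :=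
  {A | ∑ j, |eigs A j| ^ p ≤ 1}

/-- The constant `C_{p,q} = (E|U|^q)^{1/q} / (E|U|^p)^{1/p}` for an Ullman random
variable `U` with parameter `p`. -/
def Cpq (p q : ℝ) : ℝ :=
  ((p / (p + q)) * Real.Gamma ((q + 1) / 2) / (Real.sqrt Real.pi * Real.Gamma ((q + 2) / 2))) ^ (1 / q) /
    (((1 : ℝ) / 2) * Real.Gamma ((p + 1) / 2) / (Real.sqrt Real.pi * Real.Gamma ((p + 2) / 2))) ^ (1 / p)

/-- The regularized logarithmic kernel `½ log (r² + η²)`. -/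
def logReg (η r : ℝ) : ℝ := Real.log (r ^ 2 + η ^ 2) / 2

/-- The potential of the arcsine law on `[-1, 1]`, up to an additive constant. -/
def arcPot (x : ℝ) : ℝ := Real.arcosh (max |x| 1)

lemma exists_joukowski (z : ℂ) : ∃ w : ℂ, 1 ≤ ‖w‖ ∧ w + w⁻¹ = 2 * z := by
  obtain ⟨r, hr⟩ := IsAlgClosed.exists_pow_nat_eq (z ^ 2 - 1) (n := 2) (by norm_num)
  have hprod : (z + r) * (z - r) = 1 := by linear_combination -hr
  have h1 : z + r ≠ 0 := left_ne_zero_of_mul_eq_one hprod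
  have h2 : z - r ≠ 0 := right_ne_zero_of_mul_eq_one hprod
  by_cases h : 1 ≤ ‖z + r‖
  · refine ⟨z + r, h, ?_⟩
    have : (z + r)⁻¹ = z - r := by
      field_simp
      linear_combination -hprod
    rw [this]; ring
  · refine ⟨z - r, ?_, ?_⟩
    · have := congrArg norm hprod
      rw [norm_mul, norm_one] at this
      push Not at h
      by_contra h3
      push Not at h3
      have := mul_lt_one_of_nonneg_of_lt_one_left (norm_nonneg (z + r)) h h3.le
      linarith
    · have : (z - r)⁻¹ = z + r := by
        field_simp
        linear_combination -hprod
      rw [this]; ring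

lemma joukowski_norm (z w : ℂ) (hw : 1 ≤ ‖w‖) (h : w + w⁻¹ = 2 * z) :
    ‖w‖ + ‖w‖⁻¹ = ‖z - 1‖ + ‖z + 1‖ := by
  have hw0 : w ≠ 0 := by
    rintro rfl; simp at hw; linarith
  have hn : 0 < ‖w‖ := norm_pos_iff.2 hw0
  have e1 : z - 1 = (w - 1) * (w - 1) * (2 * w)⁻¹ := by
    have : z = (w + w⁻¹) / 2 := by rw [h]; ring
    rw [this]; field_simp; ring
  have e2 : z + 1 = (w + 1) * (w + 1) * (2 * w)⁻¹ := by
    have : z = (w + w⁻¹) / 2 := by rw [h]; ring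
    rw [this]; field_simp; ring
  have hp := parallelogram_law_with_norm ℝ w 1
  rw [e1, e2]
  simp only [norm_mul, norm_inv, Complex.norm_ofNat]
  rw [norm_one] at hp
  field_simp
  linarith

lemma circleAverage_joukowski (z w : ℂ) (hz : z.im ≠ 0) (hw : 1 ≤ ‖w‖) (h : w + w⁻¹ = 2 * z) :
    (2 * Real.pi)⁻¹ * ∫ θ in (0)..(2 * Real.pi), Real.log ‖z - (Real.cos θ : ℂ)‖
      = Real.log ‖w‖ - Real.log 2 := by
  have hw0 : w ≠ 0 := by
    rintro rfl; simp at hw; linarith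
  have key : ∀ θ : ℝ, Real.log ‖z - (Real.cos θ : ℂ)‖ =
      Real.log ‖circleMap 0 1 θ - w‖ + Real.log ‖circleMap 0 1 θ - (starRingEnd ℂ) w‖
        - Real.log ‖w‖ - Real.log 2 := by
    intro θ
    set ζ := circleMap 0 1 θ with hζ
    have hζe : ζ = Complex.exp (θ * Complex.I) := by simp [hζ, circleMap]
    have hζ1 : ‖ζ‖ = 1 := by rw [hζe]; exact Complex.norm_exp_ofReal_mul_I θ
    have hζ0 : ζ ≠ 0 := by rw [← norm_pos_iff, hζ1]; norm_num
    have hcos : (Real.cos θ : ℂ) = (ζ + ζ⁻¹) / 2 := by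
      rw [hζe, ← Complex.exp_neg, Complex.ofReal_cos, Complex.cos]; ring_nf
    have hconj : (starRingEnd ℂ) ζ = ζ⁻¹ := by
      rw [Complex.inv_def, Complex.normSq_eq_norm_sq, hζ1]; simp
    have hfac : z - (Real.cos θ : ℂ) = (ζ - w) * (ζ⁻¹ - w) * (2 * w)⁻¹ := by
      have : z = (w + w⁻¹) / 2 := by rw [h]; ring
      rw [hcos, this]; field_simp; ring
    have hne : z - (Real.cos θ : ℂ) ≠ 0 := by
      intro h0
      apply hz
      have := congrArg Complex.im h0
      simpa [← Complex.ofReal_cos] using this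
    have hne1 : ζ - w ≠ 0 := by
      intro h0; rw [hfac, h0] at hne; simp at hne
    have hne2 : ζ⁻¹ - w ≠ 0 := by
      intro h0; rw [hfac, h0] at hne; simp at hne
    have hn2 : ‖ζ⁻¹ - w‖ = ‖ζ - (starRingEnd ℂ) w‖ := by
      rw [← Complex.norm_conj (ζ - _), map_sub, hconj, Complex.conj_conj]
    rw [hfac, norm_mul, norm_mul, norm_inv, norm_mul, ← hn2,
      Real.log_mul (mul_ne_zero (norm_ne_zero_iff.2 hne1) (norm_ne_zero_iff.2 hne2))
        (inv_ne_zero (mul_ne_zero (by simp) (norm_ne_zero_iff.2 hw0))),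
      Real.log_mul (norm_ne_zero_iff.2 hne1) (norm_ne_zero_iff.2 hne2), Real.log_inv,
      Real.log_mul (by simp) (norm_ne_zero_iff.2 hw0)]
    simp
    ring
  have i1 := circleIntegrable_log_norm_sub_const (c := 0) (a := w) 1
  have i2 := circleIntegrable_log_norm_sub_const (c := 0) (a := (starRingEnd ℂ) w) 1
  have a1 := circleAverage_log_norm_sub_const_eq_posLog (a := w)
  have a2 := circleAverage_log_norm_sub_const_eq_posLog (a := (starRingEnd ℂ) w)
  rw [Complex.norm_conj] at a2
  rw [Real.posLog_eq_log (by rwa [abs_norm]), Real.circleAverage_def, smul_eq_mul] at a1 a2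
  simp_rw [key]
  unfold CircleIntegrable at i1 i2
  rw [intervalIntegral.integral_sub ((i1.add i2).sub (by simp)) (by simp),
    intervalIntegral.integral_sub (i1.add i2) (by simp),
    intervalIntegral.integral_add i1 i2]
  simp only [intervalIntegral.integral_const, smul_eq_mul, sub_zero]
  simp only [mul_sub, mul_add, a1, a2]
  have := Real.pi_pos
  field_simp
  ring

lemma Real.log_one_add_le_rpow_div {y t : ℝ} (hy : 0 ≤ y) (ht : 0 < t) (ht1 : t ≤ 1) :
    Real.log (1 + y) ≤ y ^ t / t := by
  rw [le_div_iff₀ ht, mul_comm, ← Real.log_rpow (by positivity)]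
  have h1 : (1 + y) ^ t ≤ 1 + y ^ t := by
    simpa using Real.rpow_add_le_add_rpow zero_le_one hy ht.le ht1
  calc Real.log ((1 + y) ^ t) ≤ Real.log (1 + y ^ t) :=
        Real.log_le_log (by positivity) h1
    _ ≤ 1 + y ^ t - 1 := Real.log_le_sub_one_of_pos (by positivity)
    _ = y ^ t := by ring

lemma arcosh_one_add_le {η t : ℝ} (hη : 0 ≤ η) (ht : 0 < t) (ht1 : t ≤ 1) :
    Real.arcosh (1 + η) ≤ 2 / t * (2 * η) ^ (t / 2) := by
  set d := Real.arcosh (1 + η) with hd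
  have hd0 : 0 ≤ d := Real.arcosh_nonneg (by linarith)
  have hc : Real.cosh d = 1 + η := Real.cosh_arcosh (by linarith)
  have hs : 0 ≤ Real.sinh (d / 2) := Real.sinh_nonneg_iff.2 (by linarith)
  have h2 : Real.sinh (d / 2) ^ 2 * 4 = 2 * η := by
    have h := Real.cosh_two_mul (d / 2)
    have h' := Real.cosh_sq (d / 2)
    rw [show 2 * (d / 2) = d by ring, hc] at h
    nlinarith
  have h3 : 2 * Real.sinh (d / 2) = Real.sqrt (2 * η) := by
    rw [← h2, show Real.sinh (d / 2) ^ 2 * 4 = (2 * Real.sinh (d / 2)) ^ 2 by ring,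
      Real.sqrt_sq (by linarith)]
  have h4 : Real.exp (d / 2) ≤ 1 + Real.sqrt (2 * η) := by
    rw [← h3, ← Real.cosh_add_sinh]
    have := Real.cosh_sq (d / 2)
    have := Real.one_le_cosh (d / 2)
    nlinarith
  have h5 : d / 2 ≤ Real.log (1 + Real.sqrt (2 * η)) := by
    rw [Real.le_log_iff_exp_le (by positivity)]; exact h4
  have h6 := Real.log_one_add_le_rpow_div (Real.sqrt_nonneg (2 * η)) ht ht1
  rw [Real.sqrt_eq_rpow, ← Real.rpow_mul (by linarith)] at h6
  rw [Real.sqrt_eq_rpow] at h5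
  rw [show (1 : ℝ) / 2 * t = t / 2 by ring] at h6
  calc d = 2 * (d / 2) := by ring
    _ ≤ 2 * ((2 * η) ^ (t / 2) / t) := by linarith
    _ = _ := by ring

lemma arcosh_add_le {c η : ℝ} (hc : 1 ≤ c) (hη : 0 ≤ η) :
    Real.arcosh (c + η) ≤ Real.arcosh c + Real.arcosh (1 + η) := by
  have ha := Real.arcosh_nonneg hc
  have hb := Real.arcosh_nonneg (show 1 ≤ 1 + η by linarith)
  rw [← Real.arcosh_cosh (add_nonneg ha hb)]
  rw [Real.arcosh_le_arcosh (by linarith) (Real.cosh_pos _), Real.cosh_add,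
    Real.cosh_arcosh hc, Real.cosh_arcosh (by linarith)]
  have h1 := Real.sinh_nonneg_iff.2 ha
  have h2 := Real.sinh_nonneg_iff.2 hb
  nlinarith [mul_nonneg h1 h2]

lemma arcPot_nonneg (x : ℝ) : 0 ≤ arcPot x := Real.arcosh_nonneg (le_max_right _ _)

lemma arcPot_of_abs_le {x : ℝ} (hx : |x| ≤ 1) : arcPot x = 0 := by
  simp [arcPot, max_eq_right hx]

lemma arcPot_mono {x y : ℝ} (h : |x| ≤ |y|) : arcPot x ≤ arcPot y := by
  unfold arcPot
  rw [Real.arcosh_le_arcosh (by positivity) (by positivity)]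
  exact max_le_max_right 1 h

lemma arcPot_abs (x : ℝ) : arcPot |x| = arcPot x := by simp [arcPot]

lemma arcPot_pos {x : ℝ} (h : 1 < |x|) : 0 < arcPot x := by
  unfold arcPot
  rw [max_eq_left h.le]
  exact Real.arcosh_pos h

lemma continuous_arcPot : Continuous arcPot :=
  Real.continuousOn_arcosh.comp_continuous (by fun_prop) (fun x => Set.mem_Ici.2 (le_max_right _ _))

lemma arcPot_le {x t : ℝ} (ht : 0 < t) (ht1 : t ≤ 1) :
    arcPot x ≤ 2 / t * (2 * |x|) ^ (t / 2) := by
  refine le_trans ?_ (arcosh_one_add_le (abs_nonneg x) ht ht1)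
  unfold arcPot
  rw [Real.arcosh_le_arcosh (by positivity) (by positivity)]
  exact max_le (by linarith) (by linarith [abs_nonneg x])

lemma logReg_eq_log_norm (η r : ℝ) : logReg η r = Real.log ‖(⟨r, η⟩ : ℂ)‖ := by
  unfold logReg
  rw [Complex.norm_def, Real.log_sqrt (Complex.normSq_nonneg _), Complex.normSq_mk]
  ring_nf

/-- The average of the regularized kernel against the arcsine law. -/
lemma arc_average (x η : ℝ) (hη : 0 < η) :
    arcPot x - Real.log 2 ≤
      (2 * Real.pi)⁻¹ * ∫ θ in (0)..(2 * Real.pi), logReg η (x - Real.cos θ) ∧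
    (2 * Real.pi)⁻¹ * ∫ θ in (0)..(2 * Real.pi), logReg η (x - Real.cos θ) ≤
      arcPot x + Real.arcosh (1 + η) - Real.log 2 := by
  obtain ⟨w, hw, h⟩ := exists_joukowski ⟨x, η⟩
  have hn := joukowski_norm _ w hw h
  have ha := circleAverage_joukowski _ w hη.ne' hw h
  have hlog : Real.log ‖w‖ =
      Real.arcosh ((‖(⟨x, η⟩ : ℂ) - 1‖ + ‖(⟨x, η⟩ : ℂ) + 1‖) / 2) := by
    rw [← hn, ← Real.cosh_log (by linarith), Real.arcosh_cosh (Real.log_nonneg hw)]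
  have hint : ∀ θ : ℝ, logReg η (x - Real.cos θ) =
      Real.log ‖(⟨x, η⟩ : ℂ) - (Real.cos θ : ℂ)‖ := by
    intro θ
    rw [logReg_eq_log_norm]
    congr 2
    apply Complex.ext <;> simp [-Complex.ofReal_cos, Complex.ofReal_re, Complex.ofReal_im]
  simp_rw [hint]
  rw [ha, hlog]
  have re1 : |x - 1| ≤ ‖(⟨x, η⟩ : ℂ) - 1‖ := by
    simpa using Complex.abs_re_le_norm ((⟨x, η⟩ : ℂ) - 1)
  have re2 : |x + 1| ≤ ‖(⟨x, η⟩ : ℂ) + 1‖ := by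
    simpa using Complex.abs_re_le_norm ((⟨x, η⟩ : ℂ) + 1)
  have up1 : ‖(⟨x, η⟩ : ℂ) - 1‖ ≤ |x - 1| + η := by
    have := Complex.norm_le_abs_re_add_abs_im ((⟨x, η⟩ : ℂ) - 1)
    simpa [abs_of_pos hη] using this
  have up2 : ‖(⟨x, η⟩ : ℂ) + 1‖ ≤ |x + 1| + η := by
    have := Complex.norm_le_abs_re_add_abs_im ((⟨x, η⟩ : ℂ) + 1)
    simpa [abs_of_pos hη] using this
  have hmax : max |x| 1 = (|x - 1| + |x + 1|) / 2 := by
    rcases le_total (|x|) 1 with h1 | h1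
    · rw [max_eq_right h1]
      rw [abs_le] at h1
      rw [abs_of_nonpos (by linarith), abs_of_nonneg (by linarith)]; ring
    · rw [max_eq_left h1]
      rcases le_abs.1 h1 with h2 | h2
      · rw [abs_of_nonneg (by linarith), abs_of_nonneg (by linarith),
          abs_of_nonneg (by linarith)]; ring
      · rw [abs_of_nonpos (by linarith), abs_of_nonpos (by linarith),
          abs_of_nonpos (by linarith)]; ring
  have hm1 : 1 ≤ max |x| 1 := le_max_right _ _
  constructor
  · gcongr
    unfold arcPot
    rw [Real.arcosh_le_arcosh (by linarith) (by linarith)]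
    linarith
  · gcongr
    refine le_trans ?_ (arcosh_add_le hm1 hη.le)
    rw [Real.arcosh_le_arcosh (by linarith) (by linarith)]
    linarith

lemma logReg_scale {η s : ℝ} (hη : 0 < η) (hs : 0 < s) (r : ℝ) :
    logReg η (s * r) = Real.log s + logReg (η / s) r := by
  unfold logReg
  have : (s * r) ^ 2 + η ^ 2 = s ^ 2 * (r ^ 2 + (η / s) ^ 2) := by field_simp
  rw [this, Real.log_mul (by positivity) (by positivity), Real.log_pow]
  push_cast; ring

lemma continuous_logReg {η : ℝ} (hη : 0 < η) : Continuous (logReg η) := by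
  unfold logReg
  refine Continuous.div_const (Continuous.log (by fun_prop) (fun r => ?_)) 2
  positivity

lemma log_abs_le_logReg (η r : ℝ) (hr : r ≠ 0) : Real.log |r| ≤ logReg η r := by
  unfold logReg
  rw [le_div_iff₀ (by norm_num), mul_comm, ← Nat.cast_ofNat, ← Real.log_pow, sq_abs]
  exact Real.log_le_log (by positivity) (by nlinarith [sq_nonneg η])

/-- The arcsine law on `[-1, 1]`. -/
def arcLaw : Measure ℝ :=
  Measure.map Real.cos ((ENNReal.ofReal (2 * Real.pi)⁻¹) • volume.restrict (Set.Ioc 0 (2 * Real.pi)))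

instance : IsProbabilityMeasure arcLaw := by
  have : IsProbabilityMeasure
      ((ENNReal.ofReal (2 * Real.pi)⁻¹) • volume.restrict (Set.Ioc 0 (2 * Real.pi))) := by
    constructor
    simp only [Measure.smul_apply, Measure.restrict_apply MeasurableSet.univ, Set.univ_inter,
      Real.volume_Ioc, sub_zero, smul_eq_mul]
    rw [← ENNReal.ofReal_mul (by positivity), inv_mul_cancel₀ (by positivity), ENNReal.ofReal_one]
  exact Measure.isProbabilityMeasure_map (by fun_prop)

lemma integral_arcLaw {f : ℝ → ℝ} (hf : Continuous f) :
    ∫ c, f c ∂arcLaw = (2 * Real.pi)⁻¹ * ∫ θ in (0)..(2 * Real.pi), f (Real.cos θ) := by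
  unfold arcLaw
  rw [integral_map (by fun_prop) hf.aestronglyMeasurable, integral_smul_measure,
    intervalIntegral.integral_of_le (by positivity), ENNReal.toReal_ofReal (by positivity),
    smul_eq_mul]

lemma arcLaw_abs_le : ∀ᵐ c ∂arcLaw, |c| ≤ 1 := by
  unfold arcLaw
  rw [ae_map_iff (by fun_prop) (measurableSet_le (by fun_prop) (by fun_prop))]
  exact ae_of_all _ Real.abs_cos_le_one

lemma arcLaw_logReg {x η s t : ℝ} (hη : 0 < η) (hs : 0 < s) (ht : 0 < t) (ht1 : t ≤ 1) :
    Real.log s - Real.log 2 + arcPot (x / s) ≤ ∫ c, logReg η (x - s * c) ∂arcLaw ∧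
    ∫ c, logReg η (x - s * c) ∂arcLaw ≤
      Real.log s - Real.log 2 + arcPot (x / s) + 2 / t * (2 * η / s) ^ (t / 2) := by
  have h1 : ∀ c, logReg η (x - s * c) = Real.log s + logReg (η / s) (x / s - c) := by
    intro c
    rw [← logReg_scale hη hs]
    congr 1; field_simp
  have hη' : 0 < η / s := by positivity
  have hcont : Continuous fun c => logReg (η / s) (x / s - c) :=
    (continuous_logReg hη').comp (by fun_prop)
  have h2 : ∫ c, logReg η (x - s * c) ∂arcLaw =
      Real.log s + ∫ c, logReg (η / s) (x / s - c) ∂arcLaw := by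
    simp_rw [h1]
    have hi : Integrable (fun c => logReg (η / s) (x / s - c)) arcLaw := by
      unfold arcLaw
      rw [integrable_map_measure hcont.aestronglyMeasurable (by fun_prop)]
      refine Integrable.smul_measure ?_ ENNReal.ofReal_ne_top
      exact (hcont.comp Real.continuous_cos).integrableOn_Ioc
    rw [integral_add (integrable_const _) hi]
    simp
  have h3 := arc_average (x / s) (η / s) hη'
  have h4 := arcosh_one_add_le hη'.le ht ht1
  rw [h2, integral_arcLaw hcont, mul_div_assoc]
  constructor <;> linarith [h3.1, h3.2]

lemma integrable_of_ae_abs_le {ρ : Measure ℝ} [IsFiniteMeasure ρ] {R : ℝ}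
    (hρ : ∀ᵐ x ∂ρ, |x| ≤ R) {f : ℝ → ℝ} (hf : Continuous f) : Integrable f ρ := by
  obtain ⟨C, hC⟩ := (isCompact_Icc (a := -R) (b := R)).exists_bound_of_continuousOn hf.continuousOn
  refine Integrable.of_bound hf.aestronglyMeasurable C ?_
  filter_upwards [hρ] with x hx
  exact hC x (abs_le.1 hx)

/-- The law of `R u ^ e cos θ` with `u` uniform on `(0, 1]` and `θ` uniform on a period; for
`R = 1` and `e = 1 / p` this is the Ullman law with parameter `p`. -/
def ull (R e : ℝ) : Measure ℝ :=
  Measure.map (fun z : ℝ × ℝ => R * z.1 ^ e * z.2) ((volume.restrict (Set.Ioc 0 1)).prod arcLaw)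

instance : IsProbabilityMeasure ((volume : Measure ℝ).restrict (Set.Ioc 0 1)) :=
  ⟨by simp⟩

instance (R e : ℝ) : IsProbabilityMeasure (ull R e) :=
  Measure.isProbabilityMeasure_map (by fun_prop)

lemma ull_abs_le {R e : ℝ} (hR : 0 < R) (he : 0 ≤ e) : ∀ᵐ x ∂(ull R e), |x| ≤ R := by
  unfold ull
  rw [ae_map_iff (by fun_prop) (measurableSet_le (by fun_prop) (by fun_prop))]
  have h1 : ∀ᵐ u ∂((volume : Measure ℝ).restrict (Set.Ioc 0 1)), u ∈ Set.Ioc (0 : ℝ) 1 :=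
    ae_restrict_mem measurableSet_Ioc
  filter_upwards [Measure.quasiMeasurePreserving_fst.ae h1,
    Measure.quasiMeasurePreserving_snd.ae arcLaw_abs_le] with z hz hz2
  have hu0 : 0 ≤ z.1 ^ e := Real.rpow_nonneg hz.1.le e
  have hu1 : z.1 ^ e ≤ 1 := Real.rpow_le_one hz.1.le hz.2 he
  rw [abs_mul, abs_mul, abs_of_pos hR, abs_of_nonneg hu0]
  have := mul_le_one₀ hu1 (abs_nonneg z.2) hz2
  nlinarith

lemma integral_ull {R e : ℝ} (hR : 0 < R) (he : 0 ≤ e) {f : ℝ → ℝ} (hf : Continuous f) :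
    ∫ x, f x ∂(ull R e) = ∫ u in Set.Ioc 0 1, ∫ c, f (R * u ^ e * c) ∂arcLaw := by
  have h := integrable_of_ae_abs_le (ull_abs_le hR he) hf
  unfold ull at h ⊢
  rw [integrable_map_measure hf.aestronglyMeasurable (by fun_prop)] at h
  rw [integral_map (by fun_prop) hf.aestronglyMeasurable]
  exact integral_prod _ h

lemma integrable_ull_inner {R e : ℝ} (hR : 0 < R) (he : 0 ≤ e) {f : ℝ → ℝ} (hf : Continuous f) :
    IntegrableOn (fun u => ∫ c, f (R * u ^ e * c) ∂arcLaw) (Set.Ioc 0 1) := by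
  have h := integrable_of_ae_abs_le (ull_abs_le hR he) hf
  unfold ull at h
  rw [integrable_map_measure hf.aestronglyMeasurable (by fun_prop)] at h
  exact h.integral_prod_left

/-- The logarithmic potential of `ull R e`. -/
def ullPot (R e x : ℝ) : ℝ :=
  Real.log R - Real.log 2 - e + ∫ u in Set.Ioc 0 1, arcPot (x / (R * u ^ e))

lemma integrableOn_rpow_Ioc {s : ℝ} (hs : -1 < s) :
    IntegrableOn (fun u : ℝ => u ^ s) (Set.Ioc 0 1) := by
  have := intervalIntegral.intervalIntegrable_rpow' (a := 0) (b := 1) hs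
  rwa [intervalIntegrable_iff_integrableOn_Ioc_of_le zero_le_one] at this

lemma integrable_arcPot {R e : ℝ} (hR : 0 < R) (he : 0 ≤ e) (x : ℝ) :
    IntegrableOn (fun u => arcPot (x / (R * u ^ e))) (Set.Ioc 0 1) := by
  have ht : 0 < 1 / (1 + e) := by positivity
  have ht1 : 1 / (1 + e) ≤ 1 := by rw [div_le_one (by positivity)]; linarith
  set γ := 1 / (1 + e) / 2 with hγ
  have hγe : -1 < -(e * γ) := by
    rw [hγ]; rw [neg_lt_neg_iff]; field_simp; linarith
  refine Integrable.mono' ((integrableOn_rpow_Ioc hγe).const_mul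
    (2 / (1 / (1 + e)) * (2 * |x| / R) ^ γ)) ?_ ?_
  · exact (continuous_arcPot.measurable.comp (by fun_prop)).aestronglyMeasurable
  · filter_upwards [ae_restrict_mem measurableSet_Ioc] with u hu
    have hu0 : 0 < u ^ e := Real.rpow_pos_of_pos hu.1 e
    rw [Real.norm_of_nonneg (arcPot_nonneg _)]
    refine (arcPot_le ht ht1).trans (le_of_eq ?_)
    rw [abs_div, abs_of_pos (by positivity : 0 < R * u ^ e), ← hγ, mul_assoc]
    congr 1
    rw [Real.rpow_neg hu.1.le, Real.rpow_mul hu.1.le, ← Real.inv_rpow hu0.le,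
      ← Real.mul_rpow (by positivity) (by positivity)]
    congr 1; field_simp

lemma integral_log_Ioc : ∫ u in Set.Ioc (0 : ℝ) 1, Real.log u = -1 := by
  rw [← intervalIntegral.integral_of_le zero_le_one, integral_log]; simp

lemma integrable_log_Ioc : IntegrableOn Real.log (Set.Ioc (0 : ℝ) 1) := by
  have := intervalIntegral.intervalIntegrable_log' (a := 0) (b := 1)
  rwa [intervalIntegrable_iff_integrableOn_Ioc_of_le zero_le_one] at this

lemma integrable_ullPot_density {R e : ℝ} (hR : 0 < R) (he : 0 ≤ e) (x : ℝ) :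
    IntegrableOn (fun u => Real.log R - Real.log 2 + e * Real.log u +
      arcPot (x / (R * u ^ e))) (Set.Ioc 0 1) :=
  ((integrable_const _).add (integrable_log_Ioc.const_mul e)).add (integrable_arcPot hR he x)

lemma ullPot_eq {R e : ℝ} (hR : 0 < R) (he : 0 ≤ e) (x : ℝ) :
    ullPot R e x = ∫ u in Set.Ioc 0 1,
      (Real.log R - Real.log 2 + e * Real.log u + arcPot (x / (R * u ^ e))) := by
  have i0 : IntegrableOn (fun u => Real.log R - Real.log 2 + e * Real.log u) (Set.Ioc 0 1) :=
    (integrable_const _).add (integrable_log_Ioc.const_mul e)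
  rw [integral_add i0 (integrable_arcPot hR he x), integral_add (integrable_const _)
    (integrable_log_Ioc.const_mul e), integral_const_mul, integral_log_Ioc]
  simp [ullPot]; ring

lemma ullPot_le {R e : ℝ} (hR : 0 < R) (he : 0 ≤ e) {η : ℝ} (hη : 0 < η) (x : ℝ) :
    ullPot R e x ≤ ∫ y, logReg η (x - y) ∂(ull R e) := by
  have hcont : Continuous fun y => logReg η (x - y) := (continuous_logReg hη).comp (by fun_prop)
  rw [integral_ull hR he hcont]
  rw [ullPot_eq hR he]
  refine setIntegral_mono_on (integrable_ullPot_density hR he x) (integrable_ull_inner hR he hcont) measurableSet_Ioc ?_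
  intro u hu
  have hu0 : 0 < u ^ e := Real.rpow_pos_of_pos hu.1 e
  have := (arcLaw_logReg (x := x) hη (by positivity : 0 < R * u ^ e) one_pos le_rfl).1
  rw [Real.log_mul hR.ne' hu0.ne', Real.log_rpow hu.1] at this
  linarith

lemma exists_le_ullPot {R e : ℝ} (hR : 0 < R) (he : 0 ≤ e) :
    ∃ C γ : ℝ, 0 ≤ C ∧ 0 < γ ∧ ∀ η : ℝ, 0 < η → ∀ x,
      ∫ y, logReg η (x - y) ∂(ull R e) ≤ ullPot R e x + C * η ^ γ := by
  have ht : 0 < 1 / (1 + e) := by positivity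
  have ht1 : 1 / (1 + e) ≤ 1 := by rw [div_le_one (by positivity)]; linarith
  set γ := 1 / (1 + e) / 2 with hγ
  have hγe : -1 < -(e * γ) := by
    rw [hγ]; rw [neg_lt_neg_iff]; field_simp; linarith
  have hI := integrableOn_rpow_Ioc hγe
  refine ⟨2 / (1 / (1 + e)) * (2 / R) ^ γ * ∫ u in Set.Ioc (0 : ℝ) 1, u ^ (-(e * γ)), γ,
    ?_, by positivity, ?_⟩
  · refine mul_nonneg (by positivity) (setIntegral_nonneg measurableSet_Ioc fun u hu => ?_)
    exact Real.rpow_nonneg hu.1.le _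
  intro η hη x
  have hcont : Continuous fun y => logReg η (x - y) := (continuous_logReg hη).comp (by fun_prop)
  rw [integral_ull hR he hcont]
  have i1 := integrable_ullPot_density hR he x
  rw [ullPot_eq hR he, mul_right_comm, ← integral_const_mul, ← integral_add i1 (hI.const_mul _)]
  refine setIntegral_mono_on (integrable_ull_inner hR he hcont) (i1.add (hI.const_mul _))
    measurableSet_Ioc ?_
  intro u hu
  have hu0 : 0 < u ^ e := Real.rpow_pos_of_pos hu.1 e
  have := (arcLaw_logReg (x := x) hη (by positivity : 0 < R * u ^ e) ht ht1).2
  rw [Real.log_mul hR.ne' hu0.ne', Real.log_rpow hu.1, ← hγ] at this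
  have h2 : (2 * η / (R * u ^ e)) ^ γ = (2 / R) ^ γ * η ^ γ * u ^ (-(e * γ)) := by
    rw [Real.rpow_neg hu.1.le, Real.rpow_mul hu.1.le, ← Real.inv_rpow hu0.le,
      ← Real.mul_rpow (by positivity) (by positivity),
      ← Real.mul_rpow (by positivity) (by positivity)]
    congr 1; field_simp
  rw [h2] at this
  linarith

lemma integral_arcPot_scaled {p : ℝ} (hp : 0 < p) :
    ∃ K κ : ℝ, 0 < κ ∧ κ ≤ K ∧ ∀ y : ℝ,
      (∫ u in Set.Ioc 0 1, arcPot (y / u ^ (1 / p))) ≤ K * |y| ^ p ∧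
      (|y| ≤ 1 → (∫ u in Set.Ioc 0 1, arcPot (y / u ^ (1 / p))) = K * |y| ^ p) ∧
      (2 ≤ |y| → (∫ u in Set.Ioc 0 1, arcPot (y / u ^ (1 / p))) ≤ (K - κ) * |y| ^ p) := by
  set f : ℝ → ℝ := fun v => arcPot (1 / v ^ (1 / p)) with hf
  have hf0 : ∀ v, 0 ≤ f v := fun v => arcPot_nonneg _
  have hp' : (0 : ℝ) ≤ 1 / p := by positivity
  have hf1 : ∀ v, 1 ≤ v → f v = 0 := by
    intro v hv
    apply arcPot_of_abs_le
    have : 1 ≤ v ^ (1 / p) := Real.one_le_rpow hv hp'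
    rw [abs_of_nonneg (by positivity), div_le_one (by linarith)]
    exact this
  have i1 : IntegrableOn f (Set.Ioc 0 1) := by
    simpa [hf] using integrable_arcPot one_pos hp' 1
  have i2 : IntegrableOn f (Set.Ioi 1) :=
    (integrableOn_zero (μ := volume)).congr_fun (fun v hv => (hf1 v (le_of_lt hv)).symm)
      measurableSet_Ioi
  have i3 : IntegrableOn f (Set.Ioi 0) := by
    rw [← Set.Ioc_union_Ioi_eq_Ioi zero_le_one]; exact i1.union i2
  have ii : ∀ a b, 0 ≤ a → 0 ≤ b → IntervalIntegrable f volume a b := by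
    intro a b ha hb
    rw [intervalIntegrable_iff]
    exact i3.mono_set fun x hx => lt_of_le_of_lt (le_min ha hb) hx.1
  set K := ∫ v in (0)..1, f v with hK
  have h2p : (2 : ℝ) ^ (-p) < 1 := Real.rpow_lt_one_of_one_lt_of_neg one_lt_two (by linarith)
  have h2p0 : (0 : ℝ) < 2 ^ (-p) := by positivity
  set κ := ∫ v in ((2 : ℝ) ^ (-p))..1, f v with hκ
  have hfpos : ∀ v ∈ Set.Ioo ((2 : ℝ) ^ (-p)) 1, 0 < f v := by
    intro v hv
    have hv0 : 0 < v := h2p0.trans hv.1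
    apply arcPot_pos
    have : v ^ (1 / p) < 1 := Real.rpow_lt_one hv0.le hv.2 (by positivity)
    have h0 : 0 < v ^ (1 / p) := by positivity
    rw [abs_of_pos (by positivity), lt_div_iff₀ h0]; linarith
  have hκ0 : 0 < κ :=
    intervalIntegral.intervalIntegral_pos_of_pos_on (ii _ _ h2p0.le zero_le_one) hfpos h2p
  have hκK : κ ≤ K := by
    rw [hK, ← intervalIntegral.integral_add_adjacent_intervals (ii 0 _ le_rfl h2p0.le)
      (ii _ 1 h2p0.le zero_le_one), ← hκ]
    have := intervalIntegral.integral_nonneg (f := f) h2p0.le (fun v _ => hf0 v) (μ := volume)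
    linarith
  refine ⟨K, κ, hκ0, hκK, fun y => ?_⟩
  rcases eq_or_ne y 0 with rfl | hy
  · have h0 : arcPot 0 = 0 := arcPot_of_abs_le (by simp)
    simp only [zero_div, h0, abs_zero, Real.zero_rpow hp.ne']
    norm_num
  have hy0 : 0 < |y| := abs_pos.2 hy
  set c := |y| ^ (-p) with hc
  have hc0 : 0 < c := by positivity
  have hcinv : c⁻¹ = |y| ^ p := by rw [hc, Real.rpow_neg hy0.le, inv_inv]
  have hA : ∫ u in Set.Ioc 0 1, arcPot (y / u ^ (1 / p)) = |y| ^ p * ∫ v in (0)..c, f v := by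
    have h1 : ∫ u in Set.Ioc 0 1, arcPot (y / u ^ (1 / p)) = ∫ u in (0)..1, f (c * u) := by
      rw [intervalIntegral.integral_of_le zero_le_one]
      refine setIntegral_congr_fun measurableSet_Ioc fun u hu => ?_
      have hu0 : 0 < u ^ (1 / p) := Real.rpow_pos_of_pos hu.1 _
      simp only [hf]
      rw [← arcPot_abs (y / _), abs_div, abs_of_pos hu0]
      congr 1
      rw [Real.mul_rpow hc0.le hu.1.le, hc, ← Real.rpow_mul hy0.le,
        show -p * (1 / p) = -1 by field_simp, Real.rpow_neg_one]
      field_simp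
    rw [h1, intervalIntegral.integral_comp_mul_left _ hc0.ne', hcinv, smul_eq_mul]
    simp
  have hyp : 0 ≤ |y| ^ p := by positivity
  have hle : ∫ v in (0)..c, f v ≤ K ∧ (|y| ≤ 1 → ∫ v in (0)..c, f v = K) := by
    have hsplit : ∫ v in (0)..c, f v = K + ∫ v in (1)..c, f v := by
      rw [hK, intervalIntegral.integral_add_adjacent_intervals (ii _ _ le_rfl zero_le_one)
        (ii _ _ zero_le_one hc0.le)]
    have heq : 1 ≤ c → ∫ v in (0)..c, f v = K := by
      intro h
      rw [hsplit, intervalIntegral.integral_congr (g := fun _ => 0)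
        (fun v hv => hf1 v (by rw [Set.uIcc_of_le h] at hv; exact hv.1))]
      simp
    constructor
    · rcases le_total 1 c with h | h
      · exact (heq h).le
      · rw [hsplit, intervalIntegral.integral_symm]
        have := intervalIntegral.integral_nonneg (f := f) h (fun v _ => hf0 v) (μ := volume)
        linarith
    · intro h
      exact heq (Real.one_le_rpow_of_pos_of_le_one_of_nonpos hy0 h (by linarith))
  rw [hA, mul_comm (_ : ℝ) (∫ v in (0)..c, f v)]
  refine ⟨by gcongr; exact hle.1, fun h => by rw [hle.2 h], fun h => ?_⟩
  gcongr
  have hc2 : c ≤ 2 ^ (-p) := by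
    rw [hc]
    exact Real.rpow_le_rpow_of_nonpos two_pos h (by linarith)
  have e1 : K = (∫ v in (0)..c, f v) + (∫ v in c..((2 : ℝ) ^ (-p)), f v) + κ := by
    rw [hK, hκ, intervalIntegral.integral_add_adjacent_intervals (ii _ _ le_rfl hc0.le)
      (ii _ _ hc0.le h2p0.le), intervalIntegral.integral_add_adjacent_intervals
      (ii _ _ le_rfl h2p0.le) (ii _ _ h2p0.le zero_le_one)]
  have := intervalIntegral.integral_nonneg (f := f) hc2 (fun v _ => hf0 v) (μ := volume)
  linarith

/-- The deviation of the Ullman potential from a multiple of `|x| ^ p`. -/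
def ullRem (p K R x : ℝ) : ℝ :=
  Real.log R - Real.log 2 - 1 / p + K * (|x| / R) ^ p - ullPot R (1 / p) x

lemma exists_ullRem {p : ℝ} (hp : 0 < p) :
    ∃ K κ : ℝ, 0 < κ ∧ κ ≤ K ∧ ∀ R : ℝ, 0 < R → ∀ x : ℝ,
      0 ≤ ullRem p K R x ∧ (|x| ≤ R → ullRem p K R x = 0) ∧
      (2 * R ≤ |x| → κ * (|x| / R) ^ p ≤ ullRem p K R x) ∧
      ullRem p K R x ≤ K * (|x| / R) ^ p ∧ arcPot (x / R) ≤ K * (|x| / R) ^ p := by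
  obtain ⟨K, κ, hκ, hκK, h⟩ := integral_arcPot_scaled hp
  refine ⟨K, κ, hκ, hκK, fun R hR x => ?_⟩
  have hp' : (0 : ℝ) ≤ 1 / p := by positivity
  have h1 : ullRem p K R x = K * |x / R| ^ p - ∫ u in Set.Ioc 0 1, arcPot (x / R / u ^ (1 / p)) := by
    unfold ullRem ullPot
    rw [abs_div, abs_of_pos hR]
    simp_rw [div_div]
    ring
  have h2 : |x| / R = |x / R| := by rw [abs_div, abs_of_pos hR]
  have h3 : 0 ≤ ∫ u in Set.Ioc 0 1, arcPot (x / R / u ^ (1 / p)) :=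
    integral_nonneg fun u => arcPot_nonneg _
  have h4 : arcPot (x / R) ≤ ∫ u in Set.Ioc 0 1, arcPot (x / R / u ^ (1 / p)) := by
    have hi : IntegrableOn (fun u => arcPot (x / R / u ^ (1 / p))) (Set.Ioc 0 1) := by
      simpa using integrable_arcPot one_pos hp' (x / R)
    have : arcPot (x / R) = ∫ u in Set.Ioc (0 : ℝ) 1, arcPot (x / R) := by simp
    rw [this]
    refine setIntegral_mono_on (integrable_const _) hi measurableSet_Ioc fun u hu => ?_
    apply arcPot_mono
    have hu0 : 0 < u ^ (1 / p) := Real.rpow_pos_of_pos hu.1 _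
    rw [abs_div (x / R), abs_of_pos hu0, le_div_iff₀ hu0]
    exact mul_le_of_le_one_right (abs_nonneg _) (Real.rpow_le_one hu.1.le hu.2 hp')
  obtain ⟨ha, hb, hc⟩ := h (x / R)
  rw [h2, h1]
  refine ⟨by linarith, fun hx => ?_, fun hx => ?_, by linarith, by linarith⟩
  · rw [hb (by rwa [← h2, div_le_one hR])]; ring
  · have := hc (by rwa [← h2, le_div_iff₀ hR])
    linarith

lemma ullPot_zero (R x : ℝ) : ullPot R 0 x = Real.log R - Real.log 2 + arcPot (x / R) := by
  simp [ullPot]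

lemma integrableOn_exp_neg_mul {η : ℝ} (hη : 0 < η) :
    IntegrableOn (fun ξ : ℝ => Real.exp (-η * ξ)) (Set.Ioi 0) := by
  simpa using integrableOn_exp_mul_Ioi (neg_neg_of_pos hη) 0

lemma integral_exp_mul_sin {η : ℝ} (hη : 0 < η) (t : ℝ) :
    ∫ ξ in Set.Ioi (0 : ℝ), Real.exp (-η * ξ) * Real.sin (ξ * t) = t / (t ^ 2 + η ^ 2) := by
  have ha : (⟨-η, t⟩ : ℂ).re < 0 := by simpa using hη
  have h := integral_exp_mul_complex_Ioi ha 0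
  have hi := integrableOn_exp_mul_complex_Ioi ha 0
  have h2 := congrArg Complex.im h
  have h3 := integral_im hi
  simp only [RCLike.im_to_complex] at h3
  rw [← h3] at h2
  have e1 : ∀ ξ : ℝ, (Complex.exp ((⟨-η, t⟩ : ℂ) * ξ)).im =
      Real.exp (-η * ξ) * Real.sin (ξ * t) := by
    intro ξ
    rw [Complex.exp_im]
    simp [mul_comm]
  simp_rw [e1] at h2
  rw [h2]
  simp only [Complex.ofReal_zero, mul_zero, Complex.exp_zero, Complex.div_im, Complex.neg_im, Complex.neg_re,
    Complex.one_re, Complex.one_im, Complex.normSq_mk]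
  have : 0 < t ^ 2 + η ^ 2 := by positivity
  have h4 : -η * -η + t * t ≠ 0 := by nlinarith
  field_simp
  ring

lemma integral_id_div_sq_add_sq {η : ℝ} (hη : 0 < η) {r : ℝ} :
    ∫ t in (0)..r, t / (t ^ 2 + η ^ 2) = logReg η r - Real.log η := by
  have h0 : logReg η 0 = Real.log η := by
    simp [logReg, Real.log_pow]
  rw [← h0]
  apply intervalIntegral.integral_eq_sub_of_hasDerivAt
  · intro t _
    have hne : t ^ 2 + η ^ 2 ≠ 0 := by positivity
    have := (((hasDerivAt_pow 2 t).add_const (η ^ 2)).log hne).div_const 2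
    unfold logReg
    exact this.congr_deriv (by norm_num; ring)
  · apply Continuous.intervalIntegrable
    refine Continuous.div (by fun_prop) (by fun_prop) fun t => by positivity

lemma logReg_eq_integral {η : ℝ} (hη : 0 < η) (r : ℝ) :
    logReg η r = Real.log η +
      ∫ ξ in Set.Ioi (0 : ℝ), Real.exp (-η * ξ) / ξ * (1 - Real.cos (ξ * r)) := by
  wlog hr : 0 ≤ r generalizing r
  · have := this (-r) (by linarith)
    simp only [mul_neg, Real.cos_neg] at this
    rw [← this]; simp [logReg]
  have hI : Integrable (Function.uncurry fun ξ t : ℝ => Real.exp (-η * ξ) * Real.sin (ξ * t))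
      ((volume.restrict (Set.Ioi 0)).prod (volume.restrict (Set.Ioc 0 r))) := by
    have := (integrableOn_exp_neg_mul hη).mul_prod
      (integrable_const (1 : ℝ) (μ := volume.restrict (Set.Ioc 0 r)))
    refine this.mono' (by fun_prop) (ae_of_all _ fun z => ?_)
    simp only [Function.uncurry, norm_mul, Real.norm_eq_abs, Real.abs_exp]
    have := Real.abs_sin_le_one (z.1 * z.2)
    gcongr
  have h := integral_integral_swap hI
  have h1 : ∀ ξ ∈ Set.Ioi (0 : ℝ), (∫ t in Set.Ioc 0 r, Real.exp (-η * ξ) * Real.sin (ξ * t)) =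
      Real.exp (-η * ξ) / ξ * (1 - Real.cos (ξ * r)) := by
    intro ξ hξ
    have hξ0 : ξ ≠ 0 := (Set.mem_Ioi.1 hξ).ne'
    rw [integral_const_mul, ← intervalIntegral.integral_of_le hr,
      intervalIntegral.integral_comp_mul_left _ hξ0, integral_sin]
    simp [div_eq_mul_inv]
    ring
  rw [setIntegral_congr_fun measurableSet_Ioi h1] at h
  rw [h]
  simp_rw [integral_exp_mul_sin hη]
  rw [← intervalIntegral.integral_of_le hr, integral_id_div_sq_add_sq hη]
  ring

lemma integrable_logReg_kernel {η : ℝ} (hη : 0 < η) (R : ℝ) (ρ ρ' : Measure ℝ)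
    [IsProbabilityMeasure ρ] [IsProbabilityMeasure ρ']
    (hρ : ∀ᵐ x ∂ρ, |x| ≤ R) (hρ' : ∀ᵐ x ∂ρ', |x| ≤ R) :
    Integrable (fun z : (ℝ × ℝ) × ℝ =>
      Real.exp (-η * z.2) / z.2 * (1 - Real.cos (z.2 * (z.1.1 - z.1.2))))
      ((ρ.prod ρ').prod (volume.restrict (Set.Ioi 0))) := by
  have hb := (integrable_const (2 * R) (μ := ρ.prod ρ')).mul_prod (integrableOn_exp_neg_mul hη)
  refine hb.mono' (by fun_prop) ?_
  have hm : ∀ᵐ ξ ∂((volume : Measure ℝ).restrict (Set.Ioi 0)), ξ ∈ Set.Ioi (0 : ℝ) :=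
    ae_restrict_mem measurableSet_Ioi
  filter_upwards [Measure.quasiMeasurePreserving_snd.ae hm,
    Measure.quasiMeasurePreserving_fst.ae (Measure.quasiMeasurePreserving_fst.ae hρ),
    Measure.quasiMeasurePreserving_fst.ae (Measure.quasiMeasurePreserving_snd.ae hρ')]
    with z hz h1 h2
  have hz : 0 < z.2 := hz
  rw [norm_mul, Real.norm_of_nonneg (by positivity), Real.norm_eq_abs]
  have h3 : |1 - Real.cos (z.2 * (z.1.1 - z.1.2))| ≤ z.2 * (2 * R) := by
    have h4 : |z.2 * (z.1.1 - z.1.2)| ≤ z.2 * (2 * R) := by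
      rw [abs_mul, abs_of_pos hz]
      gcongr
      refine (abs_sub _ _).trans (by linarith)
    refine le_trans ?_ h4
    have h5 := Real.abs_cos_sub_cos_le 0 (z.2 * (z.1.1 - z.1.2))
    simpa using h5
  calc _ ≤ Real.exp (-η * z.2) / z.2 * (z.2 * (2 * R)) := by gcongr
    _ = 2 * R * Real.exp (-η * z.2) := by field_simp

/-- The mutual regularized logarithmic energy of two measures. -/
def mutE (η : ℝ) (ρ ρ' : Measure ℝ) : ℝ := ∫ x, ∫ y, logReg η (x - y) ∂ρ' ∂ρ

lemma integral_one_sub_cos (ρ ρ' : Measure ℝ) [IsProbabilityMeasure ρ] [IsProbabilityMeasure ρ']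
    (ξ : ℝ) :
    ∫ z, (1 - Real.cos (ξ * (z.1 - z.2))) ∂(ρ.prod ρ') =
      1 - (∫ x, Real.cos (ξ * x) ∂ρ) * (∫ x, Real.cos (ξ * x) ∂ρ') -
        (∫ x, Real.sin (ξ * x) ∂ρ) * (∫ x, Real.sin (ξ * x) ∂ρ') := by
  have ic : ∀ (κ : Measure ℝ) [IsProbabilityMeasure κ],
      Integrable (fun x => Real.cos (ξ * x)) κ := fun κ _ =>
    Integrable.of_bound (by fun_prop) 1 (ae_of_all _ fun x => Real.abs_cos_le_one _)
  have is : ∀ (κ : Measure ℝ) [IsProbabilityMeasure κ],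
      Integrable (fun x => Real.sin (ξ * x)) κ := fun κ _ =>
    Integrable.of_bound (by fun_prop) 1 (ae_of_all _ fun x => Real.abs_sin_le_one _)
  simp_rw [mul_sub, Real.cos_sub]
  have i1 := (ic ρ).mul_prod (ic ρ')
  have i2 := (is ρ).mul_prod (is ρ')
  have i3 : Integrable (fun z : ℝ × ℝ => Real.cos (ξ * z.1) * Real.cos (ξ * z.2) +
      Real.sin (ξ * z.1) * Real.sin (ξ * z.2)) (ρ.prod ρ') := i1.add i2
  rw [integral_sub (integrable_const _) i3, integral_add i1 i2,
    integral_prod_mul (fun x => Real.cos (ξ * x)) (fun x => Real.cos (ξ * x)),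
    integral_prod_mul (fun x => Real.sin (ξ * x)) (fun x => Real.sin (ξ * x))]
  simp
  ring

lemma integrable_logReg_sub {η : ℝ} (hη : 0 < η) (R : ℝ) (ρ ρ' : Measure ℝ)
    [IsProbabilityMeasure ρ] [IsProbabilityMeasure ρ']
    (hρ : ∀ᵐ x ∂ρ, |x| ≤ R) (hρ' : ∀ᵐ x ∂ρ', |x| ≤ R) :
    Integrable (fun z : ℝ × ℝ => logReg η (z.1 - z.2)) (ρ.prod ρ') := by
  simp_rw [logReg_eq_integral hη]
  refine (integrable_const _).add ?_
  exact (integrable_logReg_kernel hη R ρ ρ' hρ hρ').integral_prod_left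

lemma mutE_eq_prod {η : ℝ} (hη : 0 < η) (R : ℝ) (ρ ρ' : Measure ℝ)
    [IsProbabilityMeasure ρ] [IsProbabilityMeasure ρ']
    (hρ : ∀ᵐ x ∂ρ, |x| ≤ R) (hρ' : ∀ᵐ x ∂ρ', |x| ≤ R) :
    mutE η ρ ρ' = ∫ z, logReg η (z.1 - z.2) ∂(ρ.prod ρ') :=
  (integral_prod _ (integrable_logReg_sub hη R ρ ρ' hρ hρ')).symm

lemma mutE_eq {η : ℝ} (hη : 0 < η) (R : ℝ) (ρ ρ' : Measure ℝ)
    [IsProbabilityMeasure ρ] [IsProbabilityMeasure ρ']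
    (hρ : ∀ᵐ x ∂ρ, |x| ≤ R) (hρ' : ∀ᵐ x ∂ρ', |x| ≤ R) :
    IntegrableOn (fun ξ => Real.exp (-η * ξ) / ξ *
      (1 - (∫ x, Real.cos (ξ * x) ∂ρ) * (∫ x, Real.cos (ξ * x) ∂ρ') -
        (∫ x, Real.sin (ξ * x) ∂ρ) * (∫ x, Real.sin (ξ * x) ∂ρ'))) (Set.Ioi 0) ∧
    mutE η ρ ρ' = Real.log η + ∫ ξ in Set.Ioi (0 : ℝ), Real.exp (-η * ξ) / ξ *
      (1 - (∫ x, Real.cos (ξ * x) ∂ρ) * (∫ x, Real.cos (ξ * x) ∂ρ') -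
        (∫ x, Real.sin (ξ * x) ∂ρ) * (∫ x, Real.sin (ξ * x) ∂ρ')) := by
  have hk := integrable_logReg_kernel hη R ρ ρ' hρ hρ'
  have h1 := hk.integral_prod_right
  have h2 := integral_integral_swap (f := fun (z : ℝ × ℝ) (ξ : ℝ) =>
    Real.exp (-η * ξ) / ξ * (1 - Real.cos (ξ * (z.1 - z.2)))) hk
  simp only [integral_const_mul, integral_one_sub_cos] at h1 h2
  refine ⟨h1, ?_⟩
  rw [← h2, mutE_eq_prod hη R ρ ρ' hρ hρ']
  simp_rw [logReg_eq_integral hη]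
  have h3 := hk.integral_prod_left
  rw [integral_add (integrable_const _) h3]
  simp

lemma mutE_comm {η : ℝ} (hη : 0 < η) (R : ℝ) (ρ ρ' : Measure ℝ)
    [IsProbabilityMeasure ρ] [IsProbabilityMeasure ρ']
    (hρ : ∀ᵐ x ∂ρ, |x| ≤ R) (hρ' : ∀ᵐ x ∂ρ', |x| ≤ R) : mutE η ρ ρ' = mutE η ρ' ρ := by
  rw [(mutE_eq hη R ρ ρ' hρ hρ').2, (mutE_eq hη R ρ' ρ hρ' hρ).2]
  congr 2
  ext ξ
  ring

/-- The logarithmic kernel is conditionally negative definite. -/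
lemma sum_mutE_nonpos {η : ℝ} (hη : 0 < η) (R : ℝ) {m : ℕ} (ρ : Fin m → Measure ℝ)
    [∀ k, IsProbabilityMeasure (ρ k)] (hρ : ∀ k, ∀ᵐ x ∂(ρ k), |x| ≤ R)
    (a : Fin m → ℝ) (ha : ∑ k, a k = 0) :
    ∑ k, ∑ l, a k * a l * mutE η (ρ k) (ρ l) ≤ 0 := by
  have h := fun k l => mutE_eq hη R (ρ k) (ρ l) (hρ k) (hρ l)
  set φ : Fin m → Fin m → ℝ → ℝ := fun k l ξ => Real.exp (-η * ξ) / ξ *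
      (1 - (∫ x, Real.cos (ξ * x) ∂(ρ k)) * (∫ x, Real.cos (ξ * x) ∂(ρ l)) -
        (∫ x, Real.sin (ξ * x) ∂(ρ k)) * (∫ x, Real.sin (ξ * x) ∂(ρ l))) with hφ
  have h0 : ∑ k, ∑ l, a k * a l * Real.log η = 0 := by
    simp_rw [← Finset.sum_mul, ← Finset.mul_sum, ha]; simp
  have h1 : ∑ k, ∑ l, a k * a l * mutE η (ρ k) (ρ l) =
      ∫ ξ in Set.Ioi (0 : ℝ), ∑ k, ∑ l, a k * a l * φ k l ξ := by
    rw [integral_finsetSum _ fun k _ => integrable_finsetSum _ fun l _ =>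
      ((h k l).1.const_mul (a k * a l))]
    simp_rw [fun k => integral_finsetSum (Finset.univ) fun l _ =>
      ((h k l).1.const_mul (a k * a l)), integral_const_mul]
    have h2 : ∀ k l, a k * a l * mutE η (ρ k) (ρ l) = a k * a l * Real.log η +
        a k * a l * ∫ ξ in Set.Ioi (0 : ℝ), φ k l ξ := fun k l => by rw [(h k l).2, mul_add]
    simp_rw [h2, Finset.sum_add_distrib]
    rw [h0, zero_add]
  rw [h1]
  refine integral_nonpos_of_ae ?_
  filter_upwards [ae_restrict_mem measurableSet_Ioi] with ξ hξ
  have hξ : 0 < ξ := hξ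
  set c := fun k => ∫ x, Real.cos (ξ * x) ∂(ρ k)
  set s := fun k => ∫ x, Real.sin (ξ * x) ∂(ρ k)
  have e1 : ∀ k l, a k * a l * (Real.exp (-η * ξ) / ξ * (1 - c k * c l - s k * s l)) =
      Real.exp (-η * ξ) / ξ * (a k * a l) - Real.exp (-η * ξ) / ξ * ((a k * c k) * (a l * c l))
        - Real.exp (-η * ξ) / ξ * ((a k * s k) * (a l * s l)) := by
    intro k l; ring
  have e2 : ∀ b : Fin m → ℝ, ∑ k, ∑ l, Real.exp (-η * ξ) / ξ * (b k * b l) =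
      Real.exp (-η * ξ) / ξ * (∑ k, b k) ^ 2 := by
    intro b
    rw [sq, Finset.sum_mul_sum]
    simp_rw [Finset.mul_sum]
  show ∑ k, ∑ l, a k * a l * (Real.exp (-η * ξ) / ξ * (1 - c k * c l - s k * s l)) ≤ 0
  simp_rw [e1, Finset.sum_sub_distrib]
  rw [e2 a, e2 fun k => a k * c k, e2 fun k => a k * s k, ha]
  have : 0 < Real.exp (-η * ξ) / ξ := by positivity
  nlinarith [mul_nonneg this.le (sq_nonneg (∑ k, a k * c k)),
    mul_nonneg this.le (sq_nonneg (∑ k, a k * s k))]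

/-- The empirical measure of a finite family of reals. -/
def empirical {n : ℕ} (x : Fin n → ℝ) : Measure ℝ := (n : ℝ≥0∞)⁻¹ • ∑ i, Measure.dirac (x i)

lemma integral_empirical {n : ℕ} (x : Fin n → ℝ) (f : ℝ → ℝ) :
    ∫ y, f y ∂(empirical x) = (∑ i, f (x i)) / n := by
  unfold empirical
  rw [integral_smul_measure, integral_finsetSum_measure fun i _ => integrable_dirac (by simp)]
  simp [div_eq_inv_mul]

lemma isProbabilityMeasure_empirical {n : ℕ} (hn : n ≠ 0) (x : Fin n → ℝ) :
    IsProbabilityMeasure (empirical x) := by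
  constructor
  simp only [empirical, Measure.smul_apply, Measure.finsetSum_apply, measure_univ,
    Finset.sum_const, Finset.card_univ, Fintype.card_fin, nsmul_eq_mul, mul_one, smul_eq_mul]
  exact ENNReal.inv_mul_cancel (by simpa using hn) (by simp)

lemma empirical_abs_le {n : ℕ} (x : Fin n → ℝ) : ∀ᵐ y ∂(empirical x), |y| ≤ ∑ i, |x i| := by
  unfold empirical
  refine Measure.ae_smul_measure ?_ _
  rw [ae_iff, Measure.finsetSum_apply, Finset.sum_eq_zero]
  intro i _
  rw [show {a : ℝ | ¬|a| ≤ ∑ i, |x i|} = {a : ℝ | |a| ≤ ∑ i, |x i|}ᶜ from rfl,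
    Measure.dirac_apply' _ (measurableSet_le (by fun_prop) (by fun_prop)).compl]
  have := Finset.single_le_sum (f := fun i => |x i|) (fun i _ => abs_nonneg _) (Finset.mem_univ i)
  simp [this]

/-- The discrete logarithmic energy. -/
def logE {n : ℕ} (x : Fin n → ℝ) : ℝ := ∑ i, ∑ j ∈ Finset.univ.erase i, Real.log |x i - x j|

lemma logE_le_mutE {n : ℕ} (hn : n ≠ 0) {η : ℝ} {x : Fin n → ℝ}
    (hx : Function.Injective x) :
    (logE x + n * Real.log η) / (n : ℝ) ^ 2 ≤ mutE η (empirical x) (empirical x) := by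
  have hn0 : (0 : ℝ) < n := by exact_mod_cast Nat.pos_of_ne_zero hn
  unfold mutE
  simp_rw [integral_empirical]
  rw [← Finset.sum_div, div_div, ← sq]
  gcongr
  have h1 : ∀ i, (∑ j ∈ Finset.univ.erase i, Real.log |x i - x j|) + Real.log η ≤
      ∑ j, logReg η (x i - x j) := by
    intro i
    rw [← Finset.sum_erase_add _ _ (Finset.mem_univ i)]
    gcongr with j hj
    · exact log_abs_le_logReg _ _ (sub_ne_zero.2 fun h => (Finset.ne_of_mem_erase hj) (hx h).symm)
    · simp [logReg, Real.log_pow]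
  calc logE x + n * Real.log η =
      ∑ i, ((∑ j ∈ Finset.univ.erase i, Real.log |x i - x j|) + Real.log η) := by
        simp [logE, Finset.sum_add_distrib]
    _ ≤ _ := Finset.sum_le_sum fun i _ => h1 i

/-- Cauchy–Schwarz for the logarithmic energy form on differences of probability measures. -/
lemma mutE_cauchySchwarz {η : ℝ} (hη : 0 < η) (R : ℝ) (ν μ g ω : Measure ℝ)
    [IsProbabilityMeasure ν] [IsProbabilityMeasure μ] [IsProbabilityMeasure g]
    [IsProbabilityMeasure ω] (hν : ∀ᵐ x ∂ν, |x| ≤ R) (hμ : ∀ᵐ x ∂μ, |x| ≤ R)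
    (hg : ∀ᵐ x ∂g, |x| ≤ R) (hω : ∀ᵐ x ∂ω, |x| ≤ R) :
    0 ≤ 2 * mutE η ν μ - mutE η ν ν - mutE η μ μ ∧
    0 ≤ 2 * mutE η g ω - mutE η g g - mutE η ω ω ∧
    (mutE η ν g - mutE η ν ω - (mutE η μ g - mutE η μ ω)) ^ 2 ≤
      (2 * mutE η ν μ - mutE η ν ν - mutE η μ μ) * (2 * mutE η g ω - mutE η g g - mutE η ω ω) := by
  have key : ∀ s t : ℝ, 0 ≤ (2 * mutE η g ω - mutE η g g - mutE η ω ω) * (t * t) +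
      -2 * (mutE η ν g - mutE η ν ω - (mutE η μ g - mutE η μ ω)) * (s * t) +
      (2 * mutE η ν μ - mutE η ν ν - mutE η μ μ) * (s * s) := by
    intro s t
    have : ∀ k : Fin 4, IsProbabilityMeasure (![ν, μ, g, ω] k) := by
      intro k; fin_cases k <;> assumption
    have h := sum_mutE_nonpos hη R ![ν, μ, g, ω]
      (by intro k; fin_cases k <;> assumption) ![s, -s, t, -t] (by simp [Fin.sum_univ_four])
    simp only [Fin.sum_univ_four, Matrix.cons_val] at h
    rw [mutE_comm hη R μ ν hμ hν, mutE_comm hη R g ν hg hν, mutE_comm hη R ω ν hω hν,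
      mutE_comm hη R g μ hg hμ, mutE_comm hη R ω μ hω hμ, mutE_comm hη R ω g hω hg] at h
    linarith
  refine ⟨by simpa using key 1 0, by simpa using key 0 1, ?_⟩
  have := discrim_le_zero fun t => (by linarith [key 1 t] :
    0 ≤ (2 * mutE η g ω - mutE η g g - mutE η ω ω) * (t * t) +
      -2 * (mutE η ν g - mutE η ν ω - (mutE η μ g - mutE η μ ω)) * t +
      (2 * mutE η ν μ - mutE η ν ν - mutE η μ μ))
  unfold discrim at this
  linarith

/-- The moments of the Ullman law with parameter `p`. -/
def ullMom (p s : ℝ) : ℝ := ∫ x, |x| ^ s ∂(ull 1 (1 / p))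

lemma continuous_abs_rpow {s : ℝ} (hs : 0 < s) : Continuous fun x : ℝ => |x| ^ s :=
  continuous_abs.rpow_const fun _ => Or.inr hs.le

lemma ullMom_nonneg (p s : ℝ) : 0 ≤ ullMom p s :=
  integral_nonneg fun x => Real.rpow_nonneg (abs_nonneg x) s

lemma integrable_inner_logReg {η : ℝ} (hη : 0 < η) {R : ℝ} (ρ ρ' : Measure ℝ)
    [IsProbabilityMeasure ρ] [IsProbabilityMeasure ρ']
    (hρ : ∀ᵐ x ∂ρ, |x| ≤ R) (hρ' : ∀ᵐ x ∂ρ', |x| ≤ R) :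
    Integrable (fun x => ∫ y, logReg η (x - y) ∂ρ') ρ :=
  (integrable_logReg_sub hη R ρ ρ' hρ hρ').integral_prod_left

lemma integral_affine_abs_rpow {ρ : Measure ℝ} [IsProbabilityMeasure ρ] {R : ℝ}
    (hρ : ∀ᵐ x ∂ρ, |x| ≤ R) {s : ℝ} (hs : 0 < s) (a b : ℝ) :
    Integrable (fun x => a + b * |x| ^ s) ρ ∧
      ∫ x, (a + b * |x| ^ s) ∂ρ = a + b * ∫ x, |x| ^ s ∂ρ := by
  have hi := integrable_of_ae_abs_le hρ (continuous_abs_rpow hs)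
  refine ⟨(integrable_const _).add (hi.const_mul b), ?_⟩
  rw [integral_add (integrable_const _) (hi.const_mul b), integral_const_mul]
  simp

/-- The energy of the regularized difference between an empirical measure and the Ullman law. -/
lemma energy_bound {p : ℝ} (hp : 0 < p) {K κ : ℝ} (hκ : 0 < κ) (hκK : κ ≤ K)
    (hrem : ∀ R : ℝ, 0 < R → ∀ x : ℝ,
      0 ≤ ullRem p K R x ∧ (|x| ≤ R → ullRem p K R x = 0) ∧
      (2 * R ≤ |x| → κ * (|x| / R) ^ p ≤ ullRem p K R x) ∧
      ullRem p K R x ≤ K * (|x| / R) ^ p ∧ arcPot (x / R) ≤ K * (|x| / R) ^ p)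
    {C γ : ℝ} (hC : ∀ η : ℝ, 0 < η → ∀ x,
      ∫ y, logReg η (x - y) ∂(ull 1 (1 / p)) ≤ ullPot 1 (1 / p) x + C * η ^ γ)
    {η : ℝ} (hη : 0 < η) {I : ℝ} (hI : I = -Real.log 2 - 1 / p + K * ullMom p p) :
    I ≤ mutE η (ull 1 (1 / p)) (ull 1 (1 / p)) ∧
    ∀ {n : ℕ}, n ≠ 0 → ∀ x : Fin n → ℝ, Function.Injective x →
      ∑ i, |x i| ^ p ≤ n * ullMom p p →
      (2 * mutE η (empirical x) (ull 1 (1 / p)) - mutE η (empirical x) (empirical x) -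
        mutE η (ull 1 (1 / p)) (ull 1 (1 / p))) + 2 * ((∑ i, ullRem p K 1 (x i)) / n) ≤
      I - logE x / (n : ℝ) ^ 2 - Real.log η / n + 2 * (C * η ^ γ) := by
  have hp' : (0 : ℝ) ≤ 1 / p := by positivity
  have hsupp := ull_abs_le one_pos hp'
  have hI1 : I ≤ mutE η (ull 1 (1 / p)) (ull 1 (1 / p)) := by
    obtain ⟨hi, he⟩ := integral_affine_abs_rpow hsupp hp (-Real.log 2 - 1 / p) K
    rw [hI, ullMom, ← he]
    refine integral_mono_ae hi (integrable_inner_logReg hη _ _ hsupp hsupp) ?_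
    filter_upwards [hsupp] with x hx
    have h1 := (hrem 1 one_pos x).2.1 hx
    have h2 := ullPot_le one_pos hp' hη x
    simp only [ullRem, Real.log_one, div_one] at h1
    linarith
  refine ⟨hI1, fun {n} hn x hx hG => ?_⟩
  have hn0 : (0 : ℝ) < n := by exact_mod_cast Nat.pos_of_ne_zero hn
  have h2 := logE_le_mutE (η := η) hn hx
  have h3 : mutE η (empirical x) (ull 1 (1 / p)) ≤
      I - (∑ i, ullRem p K 1 (x i)) / n + C * η ^ γ := by
    unfold mutE
    rw [integral_empirical]
    have h4 : ∀ i, ∫ y, logReg η (x i - y) ∂(ull 1 (1 / p)) ≤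
        (-Real.log 2 - 1 / p + C * η ^ γ) + K * |x i| ^ p - ullRem p K 1 (x i) := by
      intro i
      have := hC η hη (x i)
      have h5 : ullRem p K 1 (x i) = 0 - Real.log 2 - 1 / p + K * |x i| ^ p -
        ullPot 1 (1 / p) (x i) := by simp [ullRem]
      linarith
    have h6 := Finset.sum_le_sum fun i (_ : i ∈ Finset.univ) => h4 i
    rw [Finset.sum_sub_distrib, Finset.sum_add_distrib, ← Finset.mul_sum] at h6
    simp only [Finset.sum_const, Finset.card_univ, Fintype.card_fin, nsmul_eq_mul] at h6
    have h7 : K * ∑ i, |x i| ^ p ≤ K * (n * ullMom p p) := by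
      gcongr; linarith
    rw [div_le_iff₀ hn0, hI]
    field_simp at h6 ⊢
    nlinarith
  have h8 : (logE x + n * Real.log η) / (n : ℝ) ^ 2 = logE x / (n : ℝ) ^ 2 + Real.log η / n := by
    field_simp
  linarith

/-- The part of `|x| ^ q` outside of `(-2, 2)`. -/
def outer (q x : ℝ) : ℝ := if |x| < 2 then 0 else |x| ^ q

lemma sigma_pointwise {q : ℝ} (hq : 0 < q) {K κ : ℝ}
    (hrem : ∀ R : ℝ, 0 < R → ∀ x : ℝ,
      0 ≤ ullRem q K R x ∧ (|x| ≤ R → ullRem q K R x = 0) ∧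
      (2 * R ≤ |x| → κ * (|x| / R) ^ q ≤ ullRem q K R x) ∧
      ullRem q K R x ≤ K * (|x| / R) ^ q ∧ arcPot (x / R) ≤ K * (|x| / R) ^ q)
    {Cg γg Co γo : ℝ} 
    (hg : ∀ η : ℝ, 0 < η → ∀ x,
      ∫ y, logReg η (x - y) ∂(ull 2 (1 / q)) ≤ ullPot 2 (1 / q) x + Cg * η ^ γg)
    (ho : ∀ η : ℝ, 0 < η → ∀ x,
      ∫ y, logReg η (x - y) ∂(ull 2 0) ≤ ullPot 2 0 x + Co * η ^ γo)
    (hCg : 0 ≤ Cg) (hCo : 0 ≤ Co)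
    {η : ℝ} (hη : 0 < η) (x : ℝ) :
    |((∫ y, logReg η (x - y) ∂(ull 2 (1 / q))) - ∫ y, logReg η (x - y) ∂(ull 2 0)) -
      (-1 / q + K / 2 ^ q * |x| ^ q)| ≤
      Cg * η ^ γg + Co * η ^ γo + 2 * (K / 2 ^ q) * outer q x := by
  have hq' : (0 : ℝ) ≤ 1 / q := by positivity
  have g1 := ullPot_le two_pos hq' hη x
  have g2 := hg η hη x
  have o1 := ullPot_le two_pos le_rfl hη x
  have o2 := ho η hη x
  obtain ⟨h1, h2, -, h4, h5⟩ := hrem 2 two_pos x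
  have e1 : ullPot 2 (1 / q) x = - 1 / q + K / 2 ^ q * |x| ^ q - ullRem q K 2 x := by
    unfold ullRem
    rw [Real.div_rpow (abs_nonneg x) two_pos.le]
    ring
  have e2 : ullPot 2 0 x = arcPot (x / 2) := by rw [ullPot_zero]; ring
  rw [e1] at g1 g2
  rw [e2] at o1 o2
  have e3 : K * (|x| / 2) ^ q = K / 2 ^ q * |x| ^ q := by
    rw [Real.div_rpow (abs_nonneg x) two_pos.le]; ring
  rw [e3] at h4 h5
  have p1 : 0 ≤ Cg * η ^ γg := by positivity
  have p2 : 0 ≤ Co * η ^ γo := by positivity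
  have h6 := arcPot_nonneg (x / 2)
  have h7 : ullRem q K 2 x + arcPot (x / 2) ≤ 2 * (K / 2 ^ q) * outer q x := by
    unfold outer
    split_ifs with h
    · rw [h2 h.le, arcPot_of_abs_le (by rw [abs_div]; norm_num; linarith)]; simp
    · linarith
  rw [abs_le]
  constructor <;> linarith

/-- Deviation of an empirical moment, in terms of the energy of an empirical measure. -/
lemma moment_deviation {p q : ℝ} (hp : 0 < p) (hq : 0 < q) {K κ : ℝ} (hK : 0 < K)
    (hrem : ∀ R : ℝ, 0 < R → ∀ x : ℝ,
      0 ≤ ullRem q K R x ∧ (|x| ≤ R → ullRem q K R x = 0) ∧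
      (2 * R ≤ |x| → κ * (|x| / R) ^ q ≤ ullRem q K R x) ∧
      ullRem q K R x ≤ K * (|x| / R) ^ q ∧ arcPot (x / R) ≤ K * (|x| / R) ^ q)
    {Cg γg Co γo : ℝ} 
    (hg : ∀ η : ℝ, 0 < η → ∀ x,
      ∫ y, logReg η (x - y) ∂(ull 2 (1 / q)) ≤ ullPot 2 (1 / q) x + Cg * η ^ γg)
    (ho : ∀ η : ℝ, 0 < η → ∀ x,
      ∫ y, logReg η (x - y) ∂(ull 2 0) ≤ ullPot 2 0 x + Co * η ^ γo)
    (hCg : 0 ≤ Cg) (hCo : 0 ≤ Co)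
    {η : ℝ} (hη : 0 < η) (hη1 : η ≤ 1) {n : ℕ} (hn : n ≠ 0) (x : Fin n → ℝ) :
    0 ≤ 2 * mutE η (empirical x) (ull 1 (1 / p)) - mutE η (empirical x) (empirical x) -
      mutE η (ull 1 (1 / p)) (ull 1 (1 / p)) ∧
    K / 2 ^ q * |(∑ i, |x i| ^ q) / n - ullMom p q| ≤
      Real.sqrt ((2 * mutE η (empirical x) (ull 1 (1 / p)) -
        mutE η (empirical x) (empirical x) -
        mutE η (ull 1 (1 / p)) (ull 1 (1 / p))) * (Real.log 17 + 2 / q)) +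
      2 * (Cg * η ^ γg + Co * η ^ γo) + 2 * (K / 2 ^ q) * ((∑ i, outer q (x i)) / n) := by
  have hn0 : (0 : ℝ) < n := by exact_mod_cast Nat.pos_of_ne_zero hn
  have hp' : (0 : ℝ) ≤ 1 / p := by positivity
  have hq' : (0 : ℝ) ≤ 1 / q := by positivity
  have := isProbabilityMeasure_empirical hn x
  set g := ull 2 (1 / q)
  set ω := ull 2 0
  set μ := ull 1 (1 / p)
  set ν := empirical x
  have sg2 : ∀ᵐ y ∂g, |y| ≤ 2 := ull_abs_le two_pos hq'
  have so2 : ∀ᵐ y ∂ω, |y| ≤ 2 := ull_abs_le two_pos le_rfl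
  have sm1 : ∀ᵐ y ∂μ, |y| ≤ 1 := ull_abs_le one_pos hp'
  have sn : ∀ᵐ y ∂ν, |y| ≤ ∑ i, |x i| := empirical_abs_le x
  set R := 2 + ∑ i, |x i|
  have hR : 0 ≤ ∑ i, |x i| := Finset.sum_nonneg fun i _ => abs_nonneg _
  have sgR : ∀ᵐ y ∂g, |y| ≤ R := sg2.mono fun y h => h.trans (by simp only [R]; linarith)
  have soR : ∀ᵐ y ∂ω, |y| ≤ R := so2.mono fun y h => h.trans (by simp only [R]; linarith)
  have smR : ∀ᵐ y ∂μ, |y| ≤ R := sm1.mono fun y h => h.trans (by simp only [R]; linarith)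
  have snR : ∀ᵐ y ∂ν, |y| ≤ R := sn.mono fun y h => h.trans (by simp only [R]; linarith)
  obtain ⟨hD, hJ, hcs⟩ := mutE_cauchySchwarz hη R ν μ g ω snR smR sgR soR
  set D := 2 * mutE η ν μ - mutE η ν ν - mutE η μ μ
  have hgω : mutE η g ω ≤ Real.log 17 / 2 := by
    rw [mutE_eq_prod hη R g ω sgR soR]
    have : Real.log 17 / 2 = ∫ z, Real.log 17 / 2 ∂(g.prod ω) := by simp
    rw [this]
    refine integral_mono_ae (integrable_logReg_sub hη R g ω sgR soR) (integrable_const _) ?_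
    filter_upwards [Measure.quasiMeasurePreserving_fst.ae sg2,
      Measure.quasiMeasurePreserving_snd.ae so2] with z h1 h2
    unfold logReg
    have h3 : |z.1 - z.2| ≤ 4 := (abs_sub _ _).trans (by linarith)
    have h4 : (z.1 - z.2) ^ 2 ≤ 4 ^ 2 := sq_le_sq' (abs_le.1 h3).1 (abs_le.1 h3).2
    gcongr
    nlinarith
  have hgg : -1 / q ≤ mutE η g g := by
    have : -1 / q = ∫ z, -1 / q ∂g := by simp
    rw [this]
    refine integral_mono_ae (integrable_const _) (integrable_inner_logReg hη g g sgR sgR) ?_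
    refine ae_of_all _ fun y => ?_
    have h1 := ullPot_le two_pos hq' hη y
    have h2 : -1 / q ≤ ullPot 2 (1 / q) y := by
      unfold ullPot
      have : 0 ≤ ∫ u in Set.Ioc (0 : ℝ) 1, arcPot (y / (2 * u ^ (1 / q))) :=
        integral_nonneg fun u => arcPot_nonneg _
      rw [neg_div]
      linarith
    exact h2.trans h1
  have hωω : 0 ≤ mutE η ω ω := by
    refine integral_nonneg fun y => ?_
    have h1 := ullPot_le two_pos le_rfl hη y
    rw [ullPot_zero] at h1
    have := arcPot_nonneg (y / 2)
    exact le_trans (show (0:ℝ) ≤ _ by linarith) h1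
  have hJ' : 2 * mutE η g ω - mutE η g g - mutE η ω ω ≤ Real.log 17 + 2 / q := by
    rw [neg_div] at hgg
    have : 0 ≤ 1 / q := hq'
    have : 2 / q = 1 / q + 1 / q := by ring
    linarith
  have hM : |mutE η ν g - mutE η ν ω - (mutE η μ g - mutE η μ ω)| ≤
      Real.sqrt (D * (Real.log 17 + 2 / q)) := by
    apply Real.abs_le_sqrt
    exact hcs.trans (by gcongr)
  have hpt := sigma_pointwise hq hrem hg ho hCg hCo hη
  set P : ℝ → ℝ := fun x => (∫ y, logReg η (x - y) ∂g) - ∫ y, logReg η (x - y) ∂ω with hP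
  replace hpt : ∀ x, |P x - (-1 / q + K / 2 ^ q * |x| ^ q)| ≤
      Cg * η ^ γg + Co * η ^ γo + 2 * (K / 2 ^ q) * outer q x := hpt
  have hνP : mutE η ν g - mutE η ν ω = (∑ i, P (x i)) / n := by
    unfold mutE
    rw [integral_empirical, integral_empirical, ← sub_div, ← Finset.sum_sub_distrib]
  have ig := integrable_inner_logReg hη μ g smR sgR
  have io := integrable_inner_logReg hη μ ω smR soR
  have hμP : mutE η μ g - mutE η μ ω = ∫ z, P z ∂μ := (integral_sub ig io).symm
  have iP : Integrable P μ := ig.sub io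
  clear_value P
  set err := Cg * η ^ γg + Co * η ^ γo with herr
  have hνb : |(∑ i, P (x i)) / n - (-1 / q + K / 2 ^ q * ((∑ i, |x i| ^ q) / n))| ≤
      err + 2 * (K / 2 ^ q) * ((∑ i, outer q (x i)) / n) := by
    have h1 : (∑ i, P (x i)) / n - (-1 / q + K / 2 ^ q * ((∑ i, |x i| ^ q) / n)) =
        (∑ i, (P (x i) - (-1 / q + K / 2 ^ q * |x i| ^ q))) / n := by
      rw [Finset.sum_sub_distrib, Finset.sum_add_distrib, ← Finset.mul_sum]
      simp only [Finset.sum_const, Finset.card_univ, Fintype.card_fin, nsmul_eq_mul]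
      field_simp
    have h2 : err + 2 * (K / 2 ^ q) * ((∑ i, outer q (x i)) / n) =
        (∑ i, (err + 2 * (K / 2 ^ q) * outer q (x i))) / n := by
      rw [Finset.sum_add_distrib, ← Finset.mul_sum]
      simp only [Finset.sum_const, Finset.card_univ, Fintype.card_fin, nsmul_eq_mul]
      field_simp
    rw [h1, h2, abs_div, abs_of_pos hn0]
    gcongr
    exact (Finset.abs_sum_le_sum_abs _ _).trans (Finset.sum_le_sum fun i _ => hpt (x i))
  have hμb : |(∫ z, P z ∂μ) - (-1 / q + K / 2 ^ q * ullMom p q)| ≤ err := by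
    obtain ⟨hi, he⟩ := integral_affine_abs_rpow sm1 hq (-1 / q) (K / 2 ^ q)
    rw [ullMom, ← he, ← integral_sub iP hi]
    have h1 := norm_integral_le_of_norm_le_const (μ := μ) (C := err)
      (f := fun z => P z - (-1 / q + K / 2 ^ q * |z| ^ q)) (by
        filter_upwards [sm1] with z hz
        have := hpt z
        rw [outer, if_pos (by linarith), mul_zero, add_zero] at this
        exact this)
    simpa using h1
  refine ⟨hD, ?_⟩
  rw [hνP, hμP] at hM
  have hK2 : 0 ≤ K / 2 ^ q := by positivity
  rw [← abs_of_nonneg hK2, ← abs_mul, abs_of_nonneg hK2]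
  rw [abs_le] at hM hνb hμb ⊢
  constructor <;> nlinarith [hM.1, hM.2, hνb.1, hνb.2, hμb.1, hμb.2]

lemma tendsto_log_rpow_div (a : ℝ) :
    Tendsto (fun n : ℕ => Real.log n ^ a / n) atTop (nhds 0) := by
  have h := (isLittleO_log_rpow_rpow_atTop a one_pos).tendsto_div_nhds_zero
  simp only [Real.rpow_one] at h
  exact h.comp tendsto_natCast_atTop_atTop

lemma tendsto_rpow_natCast_neg {a : ℝ} (ha : 0 < a) :
    Tendsto (fun n : ℕ => (n : ℝ) ^ (-a)) atTop (nhds 0) :=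
  (tendsto_rpow_neg_atTop ha).comp tendsto_natCast_atTop_atTop

/-- Points in general position with nearly maximal logarithmic energy, among those satisfying a
moment constraint, have empirical moments close to the moments of the Ullman law. -/
theorem exists_energy_const {p q : ℝ} (hp : 0 < p) (hq : 0 < q) :
    ∃ I : ℝ, (∀ η : ℝ, 0 < η → I ≤ mutE η (ull 1 (1 / p)) (ull 1 (1 / p))) ∧
      ∀ C₀ : ℝ, 0 ≤ C₀ → ∀ δ : ℝ, 0 < δ → ∃ n₀ : ℕ, ∀ n : ℕ, n₀ ≤ n → ∀ x : Fin n → ℝ,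
        Function.Injective x → ∑ i, |x i| ^ p ≤ n * ullMom p p →
        (n : ℝ) ^ 2 * I - C₀ * (n * Real.log n) ≤ logE x →
        |(∑ i, |x i| ^ q) / n - ullMom p q| ≤ δ := by
  obtain ⟨K, κ, hκ, hκK, hrem⟩ := exists_ullRem hp
  obtain ⟨K', κ', hκ', hκK', hrem'⟩ := exists_ullRem hq
  have hp' : (0 : ℝ) ≤ 1 / p := by positivity
  have hq' : (0 : ℝ) ≤ 1 / q := by positivity
  obtain ⟨C, γ, hC0, hγ, hC⟩ := exists_le_ullPot one_pos hp'
  obtain ⟨Cg, γg, hCg, hγg, hg⟩ := exists_le_ullPot two_pos hq'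
  obtain ⟨Co, γo, hCo, hγo, ho⟩ := exists_le_ullPot two_pos le_rfl
  have hK' : 0 < K' := hκ'.trans_le hκK'
  refine ⟨-Real.log 2 - 1 / p + K * ullMom p p, fun η hη =>
    (energy_bound hp hκ hκK hrem hC hη rfl).1, ?_⟩
  intro C₀ hC₀ δ hδ
  set C₁ := C₀ + 1 / γ + 2 * C with hC₁
  have hC₁0 : 0 ≤ C₁ := by positivity
  have hlim : Tendsto (fun n : ℕ => Real.sqrt (C₁ * (Real.log n ^ (1 : ℝ) / n) *
      (Real.log 17 + 2 / q)) + 2 * (Cg * (n : ℝ) ^ (-(γg / γ)) + Co * (n : ℝ) ^ (-(γo / γ))) +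
      2 * (K' / 2 ^ q) * ((C₁ / κ) ^ (q / p + 1) * (Real.log n ^ (q / p + 1) / n)))
      atTop (nhds 0) := by
    have h1 := (((tendsto_log_rpow_div 1).const_mul C₁).mul_const
      (Real.log 17 + 2 / q)).sqrt
    have h2 := (((tendsto_rpow_natCast_neg (div_pos hγg hγ)).const_mul Cg).add
      ((tendsto_rpow_natCast_neg (div_pos hγo hγ)).const_mul Co)).const_mul 2
    have h3 := ((tendsto_log_rpow_div (q / p + 1)).const_mul
      ((C₁ / κ) ^ (q / p + 1))).const_mul (2 * (K' / 2 ^ q))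
    simpa using (h1.add h2).add h3
  have hδ' : 0 < K' / 2 ^ q * δ := by positivity
  obtain ⟨n₁, hn₁⟩ := eventually_atTop.1 (hlim.eventually (gt_mem_nhds hδ'))
  refine ⟨max n₁ 3, fun n hn x hx hG hE => ?_⟩
  have hn3 : 3 ≤ n := (le_max_right _ _).trans hn
  have hlt := hn₁ n ((le_max_left _ _).trans hn)
  have hne : n ≠ 0 := by omega
  have hn0 : (0 : ℝ) < n := by exact_mod_cast Nat.pos_of_ne_zero hne
  have hn1 : (1 : ℝ) ≤ n := by exact_mod_cast Nat.one_le_iff_ne_zero.2 hne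
  have hlog1 : 1 ≤ Real.log n := by
    rw [Real.le_log_iff_exp_le hn0]
    have h3 : (3 : ℝ) ≤ n := by exact_mod_cast hn3
    exact Real.exp_one_lt_three.le.trans h3
  set η := (n : ℝ) ^ (-(1 / γ)) with hηd
  have hη : 0 < η := by positivity
  have hη1 : η ≤ 1 := Real.rpow_le_one_of_one_le_of_nonpos hn1 (by
    have : 0 < 1 / γ := by positivity
    linarith)
  have hηγ : ∀ a : ℝ, η ^ a = (n : ℝ) ^ (-(a / γ)) := fun a => by
    rw [hηd, ← Real.rpow_mul hn0.le]; congr 1; ring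
  have hlogη : Real.log η = -(1 / γ) * Real.log n := Real.log_rpow hn0 _
  have hηγ1 : η ^ γ = 1 / n := by
    rw [hηγ, div_self hγ.ne', Real.rpow_neg_one, one_div]
  have hen := (energy_bound hp hκ hκK hrem hC hη rfl).2 hne x hx hG
  obtain ⟨hD, hdev⟩ := moment_deviation hp hq hK' hrem' hg ho hCg hCo hη hη1 hne x
  set D := 2 * mutE η (empirical x) (ull 1 (1 / p)) - mutE η (empirical x) (empirical x) -
        mutE η (ull 1 (1 / p)) (ull 1 (1 / p))
  set I := -Real.log 2 - 1 / p + K * ullMom p p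
  have hR0 : ∀ i, 0 ≤ ullRem p K 1 (x i) := fun i => (hrem 1 one_pos (x i)).1
  have hT : D + 2 * ((∑ i, ullRem p K 1 (x i)) / n) ≤ C₁ * (Real.log n / n) := by
    refine hen.trans ?_
    rw [hηγ1, hlogη]
    have h1 : I - logE x / (n : ℝ) ^ 2 ≤ C₀ * (Real.log n / n) := by
      have : I - C₀ * (Real.log n / n) ≤ logE x / (n : ℝ) ^ 2 := by
        rw [le_div_iff₀ (by positivity)]
        refine le_trans (le_of_eq ?_) hE
        field_simp
      linarith
    have h2 : C * (1 / n) ≤ C * (Real.log n / n) := by gcongr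
    have h3 : -(1 / γ) * Real.log n / n = -(1 / γ * (Real.log n / n)) := by ring
    rw [h3, hC₁]
    linarith
  have hRs : 0 ≤ ∑ i, ullRem p K 1 (x i) := Finset.sum_nonneg fun i _ => hR0 i
  have hRn : 0 ≤ (∑ i, ullRem p K 1 (x i)) / n := by positivity
  have hDT : D ≤ C₁ * (Real.log n / n) := by linarith
  have hS : (∑ i, ullRem p K 1 (x i)) ≤ C₁ * Real.log n := by
    have h1 : (∑ i, ullRem p K 1 (x i)) / n ≤ C₁ * (Real.log n / n) := by linarith
    rw [← mul_div_assoc, div_le_div_iff_of_pos_right hn0] at h1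
    exact h1
  set S := C₁ / κ * Real.log n with hSd
  have hS0 : 0 ≤ S := by positivity
  have hout : ∀ i, outer q (x i) ≤ S ^ (q / p) * (ullRem p K 1 (x i) / κ) := by
    intro i
    unfold outer
    split_ifs with h
    · have := hR0 i
      positivity
    · push Not at h
      have h1 := (hrem 1 one_pos (x i)).2.2.1 (by linarith)
      rw [div_one] at h1
      have h2 : |x i| ^ p ≤ ullRem p K 1 (x i) / κ := by
        rw [le_div_iff₀ hκ]; linarith
      have h3 : |x i| ^ p ≤ S := by
        refine h2.trans ?_
        rw [div_le_iff₀ hκ, hSd]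
        have : ullRem p K 1 (x i) ≤ ∑ i, ullRem p K 1 (x i) :=
          Finset.single_le_sum (fun j _ => hR0 j) (Finset.mem_univ i)
        refine (this.trans hS).trans (le_of_eq ?_)
        field_simp
      have h4 : |x i| ^ q = (|x i| ^ p) ^ (q / p) := by
        rw [← Real.rpow_mul (abs_nonneg _)]; congr 1; field_simp
      have h5 : 1 ≤ |x i| ^ p := Real.one_le_rpow (by linarith) hp.le
      calc |x i| ^ q = (|x i| ^ p) ^ (q / p) * 1 := by rw [h4, mul_one]
        _ ≤ S ^ (q / p) * (ullRem p K 1 (x i) / κ) := by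
          gcongr
          exact h5.trans h2
  have houts : (∑ i, outer q (x i)) / n ≤
      (C₁ / κ) ^ (q / p + 1) * (Real.log n ^ (q / p + 1) / n) := by
    rw [← mul_div_assoc]
    gcongr
    calc (∑ i, outer q (x i)) ≤ ∑ i, S ^ (q / p) * (ullRem p K 1 (x i) / κ) :=
          Finset.sum_le_sum fun i _ => hout i
      _ = S ^ (q / p) * ((∑ i, ullRem p K 1 (x i)) / κ) := by
          rw [← Finset.mul_sum, Finset.sum_div]
      _ ≤ S ^ (q / p) * S := by
          gcongr
          rw [div_le_iff₀ hκ]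
          refine hS.trans (le_of_eq ?_)
          rw [hSd]
          field_simp
      _ = (C₁ / κ) ^ (q / p + 1) * Real.log n ^ (q / p + 1) := by
          rw [← Real.mul_rpow (by positivity) (by positivity), ← hSd]
          rw [Real.rpow_add_one' hS0 (by positivity)]
  have hsq : Real.sqrt (D * (Real.log 17 + 2 / q)) ≤
      Real.sqrt (C₁ * (Real.log n ^ (1 : ℝ) / n) * (Real.log 17 + 2 / q)) := by
    rw [Real.rpow_one]
    have : 0 ≤ Real.log 17 := Real.log_nonneg (by norm_num)
    gcongr
  rw [hηγ, hηγ] at hdev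
  have hK2 : 0 < K' / 2 ^ q := by positivity
  refine le_of_mul_le_mul_left ?_ hK2
  have : 2 * (K' / 2 ^ q) * ((∑ i, outer q (x i)) / n) ≤
    2 * (K' / 2 ^ q) * ((C₁ / κ) ^ (q / p + 1) * (Real.log n ^ (q / p + 1) / n)) := by gcongr
  linarith

/-- The absolute value of the Vandermonde determinant, to the power `b`. -/
def vdm (b : ℕ) {n : ℕ} (x : Fin n → ℝ) : ℝ := ∏ i, ∏ j ∈ Finset.Ioi i, |x i - x j| ^ b

lemma vdm_nonneg (b : ℕ) {n : ℕ} (x : Fin n → ℝ) : 0 ≤ vdm b x :=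
  Finset.prod_nonneg fun _ _ => Finset.prod_nonneg fun _ _ => by positivity

lemma continuous_vdm (b n : ℕ) : Continuous fun x : Fin n → ℝ => vdm b x := by
  unfold vdm
  fun_prop

lemma sum_off_diag {n : ℕ} (f : Fin n → Fin n → ℝ) (hf : ∀ i j, f i j = f j i) :
    ∑ i, ∑ j ∈ Finset.univ.erase i, f i j = 2 * ∑ i, ∑ j ∈ Finset.Ioi i, f i j := by
  have h := Finset.sum_sum_Ioi_add_eq_sum_sum_off_diag (fun i j => f i j)
  have e : ∀ i : Fin n, ({i}ᶜ : Finset (Fin n)) = Finset.univ.erase i := fun i => by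
    ext; simp
  simp only [e] at h
  rw [Finset.sum_congr rfl fun i _ => Finset.sum_congr rfl fun j _ => hf i j, ← h, Finset.mul_sum]
  refine Finset.sum_congr rfl fun i _ => ?_
  rw [Finset.mul_sum]
  refine Finset.sum_congr rfl fun j _ => ?_
  rw [hf j i]; ring

lemma sum_card_Ioi (n : ℕ) :
    2 * ((∑ i : Fin n, (Finset.Ioi i).card : ℕ) : ℝ) = n * ((n : ℝ) - 1) := by
  have h := sum_off_diag (n := n) (fun _ _ => (1 : ℝ)) fun _ _ => rfl
  simp only [Finset.sum_const, nsmul_eq_mul, mul_one, Finset.card_erase_of_mem (Finset.mem_univ _),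
    Finset.card_univ, Fintype.card_fin] at h
  push_cast
  rw [← h]
  rcases n with _ | n
  · simp
  · push_cast; simp

lemma vdm_eq_exp (b : ℕ) {n : ℕ} {x : Fin n → ℝ} (hx : Function.Injective x) :
    vdm b x = Real.exp (b / 2 * logE x) := by
  unfold logE
  rw [sum_off_diag (fun i j => Real.log |x i - x j|) fun i j => by rw [abs_sub_comm]]
  rw [show (b : ℝ) / 2 * (2 * ∑ i, ∑ j ∈ Finset.Ioi i, Real.log |x i - x j|) =
    ∑ i, ∑ j ∈ Finset.Ioi i, (b : ℝ) * Real.log |x i - x j| by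
      rw [← mul_assoc, div_mul_cancel₀ _ two_ne_zero, Finset.mul_sum]
      simp only [Finset.mul_sum]]
  rw [Real.exp_sum]
  refine Finset.prod_congr rfl fun i _ => ?_
  rw [Real.exp_sum]
  refine Finset.prod_congr rfl fun j hj => ?_
  have : 0 < |x i - x j| := abs_pos.2 (sub_ne_zero.2 (hx.ne (Finset.mem_Ioi.1 hj).ne))
  rw [← Real.log_pow, Real.exp_log (by positivity)]

lemma vdm_eq_zero {b : ℕ} (hb : b ≠ 0) {n : ℕ} {x : Fin n → ℝ} (hx : ¬ Function.Injective x) :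
    vdm b x = 0 := by
  unfold Function.Injective at hx
  push Not at hx
  obtain ⟨i, j, hij, hne⟩ := hx
  wlog h : i < j generalizing i j
  · exact this j i hij.symm hne.symm (lt_of_le_of_ne (not_lt.1 h) hne.symm)
  · refine Finset.prod_eq_zero (Finset.mem_univ i) (Finset.prod_eq_zero (Finset.mem_Ioi.2 h) ?_)
    rw [hij, sub_self, abs_zero, zero_pow hb]

lemma vdm_smul (b : ℕ) {n : ℕ} {r : ℝ} (hr : 0 ≤ r) (x : Fin n → ℝ) :
    vdm b (r • x) = r ^ (b * ∑ i : Fin n, (Finset.Ioi i).card) * vdm b x := by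
  unfold vdm
  have : ∀ i j, |(r • x) i - (r • x) j| ^ b = r ^ b * |x i - x j| ^ b := fun i j => by
    simp only [Pi.smul_apply, smul_eq_mul]
    rw [← mul_sub, abs_mul, abs_of_nonneg hr, mul_pow]
  simp only [this, Finset.prod_mul_distrib, Finset.prod_const]
  rw [Finset.prod_pow_eq_pow_sum, ← pow_mul]

lemma lintegral_smul_vdm (b : ℕ) {n : ℕ} {r : ℝ} (hr : 0 < r) {f : (Fin n → ℝ) → ℝ≥0∞}
    (hf : Measurable f) :
    ∫⁻ x, f x * ENNReal.ofReal (vdm b x) =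
      ENNReal.ofReal (r ^ (n + b * ∑ i : Fin n, (Finset.Ioi i).card)) *
        ∫⁻ x, f (r • x) * ENNReal.ofReal (vdm b x) := by
  have h := Measure.map_addHaar_smul (volume : Measure (Fin n → ℝ)) hr.ne'
  have hm : Measurable fun x : Fin n → ℝ => f x * ENNReal.ofReal (vdm b x) :=
    hf.mul (continuous_vdm b n).measurable.ennreal_ofReal
  have h2 : ∫⁻ x, f x * ENNReal.ofReal (vdm b x) ∂(Measure.map (r • ·) volume) =
      ∫⁻ x, f (r • x) * ENNReal.ofReal (vdm b (r • x)) :=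
    lintegral_map hm (measurable_const_smul r)
  rw [h, lintegral_smul_measure, Module.finrank_fin_fun, abs_of_pos (by positivity)] at h2
  simp only [vdm_smul b hr.le, ENNReal.ofReal_mul (pow_nonneg hr.le _)] at h2
  simp only [mul_left_comm (f _)] at h2
  rw [lintegral_const_mul _ (by
    exact (hf.comp (measurable_const_smul r)).mul (continuous_vdm b n).measurable.ennreal_ofReal)]
    at h2
  rw [pow_add, ENNReal.ofReal_mul (pow_nonneg hr.le _), mul_assoc, ← h2, smul_eq_mul, ← mul_assoc,
    ← ENNReal.ofReal_mul (pow_nonneg hr.le _), mul_inv_cancel₀ (by positivity)]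
  simp

lemma measurable_finCons (n : ℕ) :
    Measurable fun z : ℝ × (Fin n → ℝ) => (Fin.cons z.1 z.2 : Fin (n + 1) → ℝ) := by
  refine measurable_pi_iff.2 fun i => ?_
  refine Fin.cases ?_ (fun j => ?_) i
  · simpa using measurable_fst
  · simp only [Fin.cons_succ]
    fun_prop

lemma lintegral_pi_succ {n : ℕ} (ρ : Measure ℝ) [SigmaFinite ρ] {F : (Fin (n + 1) → ℝ) → ℝ≥0∞}
    (hF : Measurable F) :
    ∫⁻ x, F x ∂(Measure.pi fun _ => ρ) =
      ∫⁻ t, ∫⁻ y, F (Fin.cons t y) ∂(Measure.pi fun _ : Fin n => ρ) ∂ρ := by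
  have h := measurePreserving_piFinSuccAbove (fun _ : Fin (n + 1) => ρ) 0
  rw [← lintegral_prod (μ := ρ) (ν := Measure.pi fun _ : Fin n => ρ)
    (fun z : ℝ × (Fin n → ℝ) => F (Fin.cons z.1 z.2))]
  · rw [← h.map_eq, lintegral_map_equiv]
    refine lintegral_congr fun x => ?_
    congr 1
    exact (Fin.cons_self_tail x).symm
  · exact (hF.comp (measurable_finCons n)).aemeasurable

lemma lintegral_ull_mul_le {p : ℝ} (hp : 0 < p) {f : ℝ → ℝ≥0∞} (hf : Measurable f) :
    ∫⁻ x, f x * ENNReal.ofReal (|x| / p) ∂(ull 1 (1 / p)) ≤ ∫⁻ x, f x := by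
  have hm : Measurable fun x : ℝ => f x * ENNReal.ofReal (|x| / p) :=
    hf.mul (by fun_prop)
  have hm2 : Measurable fun z : ℝ × ℝ => 1 * z.1 ^ (1 / p) * z.2 := by fun_prop
  unfold ull
  have hm3 : Measurable fun z : ℝ × ℝ => f (1 * z.1 ^ (1 / p) * z.2) *
      ENNReal.ofReal (|1 * z.1 ^ (1 / p) * z.2| / p) := hm.comp hm2
  rw [lintegral_map hm hm2, lintegral_prod_symm _ hm3.aemeasurable]
  have key : ∀ c : ℝ, ∫⁻ u in Set.Ioc (0 : ℝ) 1, f (1 * u ^ (1 / p) * c) *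
      ENNReal.ofReal (|1 * u ^ (1 / p) * c| / p) ≤ ∫⁻ x, f x := by
    intro c
    by_cases hc : c = 0
    · simp [hc]
    have h := lintegral_image_eq_lintegral_abs_deriv_mul (s := Set.Ioc (0 : ℝ) 1)
      (f := fun u => 1 * u ^ (1 / p) * c) (f' := fun u => 1 * (1 / p * u ^ (1 / p - 1)) * c)
      measurableSet_Ioc (fun u hu => by
        exact (((Real.hasDerivAt_rpow_const (Or.inl hu.1.ne')).const_mul 1).mul_const
          c).hasDerivWithinAt)
      (by
        intro u hu v hv huv
        simp only [one_mul, mul_left_inj' hc] at huv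
        exact (Real.rpow_left_inj hu.1.le hv.1.le (by positivity)).1 huv) f
    refine le_trans ?_ (h.ge.trans (setLIntegral_le_lintegral _ _))
    refine setLIntegral_mono' measurableSet_Ioc fun u hu => ?_
    rw [mul_comm]
    gcongr
    simp only [one_mul, abs_mul]
    rw [abs_of_pos (Real.rpow_pos_of_pos hu.1 _), abs_of_pos (Real.rpow_pos_of_pos hu.1 _),
      abs_of_pos (by positivity : 0 < 1 / p)]
    have : u ^ (1 / p) ≤ u ^ (1 / p - 1) :=
      Real.rpow_le_rpow_of_exponent_ge hu.1 hu.2 (by linarith)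
    have h2 : u ^ (1 / p) * |c| / p = 1 / p * u ^ (1 / p) * |c| := by ring
    rw [h2]
    gcongr
  calc _ ≤ ∫⁻ c, (∫⁻ x, f x) ∂arcLaw := lintegral_mono key
    _ = _ := by simp

lemma lintegral_pi_ull_mul_le {p : ℝ} (hp : 0 < p) {n : ℕ} :
    ∀ {F : (Fin n → ℝ) → ℝ≥0∞}, Measurable F →
    ∫⁻ x, F x * ENNReal.ofReal (∏ i, |x i| / p) ∂(Measure.pi fun _ => ull 1 (1 / p)) ≤
      ∫⁻ x, F x := by
  induction n with
  | zero =>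
    intro F hF
    rw [volume_pi, Measure.pi_of_empty, Measure.pi_of_empty]
    simp
  | succ n ih =>
    intro F hF
    rw [volume_pi, lintegral_pi_succ _ hF, lintegral_pi_succ
      (F := fun x => F x * ENNReal.ofReal (∏ i, |x i| / p)) _ (hF.mul (by fun_prop))]
    have hF2 : Measurable fun z : ℝ × (Fin n → ℝ) => F (Fin.cons z.1 z.2) := hF.comp (measurable_finCons n)
    have hG : Measurable fun t : ℝ => ∫⁻ y : Fin n → ℝ, F (Fin.cons t y) :=
      hF2.lintegral_prod_right'
    refine le_trans (lintegral_mono fun t => ?_) (lintegral_ull_mul_le hp hG)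
    have hFt : Measurable fun y : Fin n → ℝ => F (Fin.cons t y) :=
      hF2.comp measurable_prodMk_left
    rw [← lintegral_mul_const _ hFt]
    refine le_trans (le_of_eq ?_) (ih (hFt.mul_const (ENNReal.ofReal (|t| / p))))
    refine lintegral_congr fun y => ?_
    rw [Fin.prod_univ_succ, ENNReal.ofReal_mul (by positivity)]
    simp only [Fin.cons_zero, Fin.cons_succ, mul_assoc]

/-- A continuous regularization of the density of the Gibbs measure with potential
`a * |x| ^ p / L`, relative to a power of the Ullman law. -/
def gibbsReg (b : ℕ) (p a L η : ℝ) {n : ℕ} (x : Fin n → ℝ) : ℝ :=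
  Real.exp (-a * (∑ i, |x i| ^ p) / L) *
    (∏ i, ∏ j ∈ Finset.Ioi i, Real.sqrt ((x i - x j) ^ 2 + η ^ 2) ^ b) *
    ∏ i, Real.sqrt (x i ^ 2 + η ^ 2) / p

lemma continuous_gibbsReg (b : ℕ) {p : ℝ} (hp : 0 < p) (a L : ℝ) (n : ℕ) :
    Continuous fun z : ℝ × (Fin n → ℝ) => gibbsReg b p a L z.1 z.2 := by
  have h : ∀ i : Fin n, Continuous fun z : ℝ × (Fin n → ℝ) => |z.2 i| ^ p := fun i =>
    (continuous_abs_rpow hp).comp (by fun_prop)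
  unfold gibbsReg
  fun_prop

lemma continuous_gibbsReg_right (b : ℕ) {p : ℝ} (hp : 0 < p) (a L η : ℝ) (n : ℕ) :
    Continuous fun x : Fin n → ℝ => gibbsReg b p a L η x := by
  have h : ∀ i : Fin n, Continuous fun x : Fin n → ℝ => |x i| ^ p := fun i =>
    (continuous_abs_rpow hp).comp (continuous_apply i)
  unfold gibbsReg
  fun_prop

lemma continuous_gibbsReg_left (b : ℕ) (p a L : ℝ) {n : ℕ} (x : Fin n → ℝ) :
    Continuous fun η : ℝ => gibbsReg b p a L η x := by
  unfold gibbsReg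
  fun_prop

lemma gibbsReg_zero (b : ℕ) (p a L : ℝ) {n : ℕ} (x : Fin n → ℝ) :
    gibbsReg b p a L 0 x =
      Real.exp (-a * (∑ i, |x i| ^ p) / L) * vdm b x * ∏ i, |x i| / p := by
  simp [gibbsReg, vdm, Real.sqrt_sq_eq_abs]

lemma exp_logReg {η : ℝ} (hη : 0 < η) (r : ℝ) :
    Real.exp (logReg η r) = Real.sqrt (r ^ 2 + η ^ 2) := by
  unfold logReg
  rw [Real.exp_half, Real.exp_log (by positivity)]

lemma gibbsReg_eq_exp (b : ℕ) {p : ℝ} (hp : 0 < p) (a L : ℝ) {η : ℝ} (hη : 0 < η) {n : ℕ}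
    (x : Fin n → ℝ) :
    gibbsReg b p a L η x = Real.exp (-a / L * (∑ i, |x i| ^ p) +
      (∑ i, ∑ j ∈ Finset.Ioi i, b * logReg η (x i - x j)) +
      ∑ i, (logReg η (x i) - Real.log p)) := by
  unfold gibbsReg
  rw [Real.exp_add, Real.exp_add, Real.exp_sum, Real.exp_sum]
  congr 1
  · congr 1
    · congr 1; ring
    · refine Finset.prod_congr rfl fun i _ => ?_
      rw [Real.exp_sum]
      refine Finset.prod_congr rfl fun j _ => ?_
      rw [Real.exp_nat_mul, exp_logReg hη]
  · refine Finset.prod_congr rfl fun i _ => ?_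
    rw [Real.exp_sub, exp_logReg hη, Real.exp_log hp]

lemma pi_ae_abs_le {ρ : Measure ℝ} [IsProbabilityMeasure ρ] {R : ℝ}
    (hρ : ∀ᵐ x ∂ρ, |x| ≤ R) (n : ℕ) :
    ∀ᵐ x ∂(Measure.pi fun _ : Fin n => ρ), ∀ i, |x i| ≤ R := by
  rw [ae_all_iff]
  intro i
  exact (Measure.quasiMeasurePreserving_eval (fun _ : Fin n => ρ) i).ae hρ

lemma exists_bound_pi_ball {n : ℕ} {E : Type*} [NormedAddCommGroup E]
    {f : ℝ × (Fin n → ℝ) → E} (hf : Continuous f) :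
    ∃ C : ℝ, ∀ η ∈ Set.Icc (0 : ℝ) 1, ∀ x : Fin n → ℝ, (∀ i, |x i| ≤ 1) → ‖f (η, x)‖ ≤ C := by
  have hK : IsCompact (Set.Icc (0 : ℝ) 1 ×ˢ Set.univ.pi fun _ : Fin n => Set.Icc (-1 : ℝ) 1) :=
    isCompact_Icc.prod (isCompact_univ_pi fun _ => isCompact_Icc)
  obtain ⟨C, hC⟩ := hK.exists_bound_of_continuousOn hf.continuousOn
  exact ⟨C, fun η hη x hx => hC (η, x) ⟨hη, fun i _ => abs_le.1 (hx i)⟩⟩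

lemma integrable_pi_of_continuous {ρ : Measure ℝ} [IsProbabilityMeasure ρ]
    (hρ : ∀ᵐ x ∂ρ, |x| ≤ 1) {n : ℕ} {f : (Fin n → ℝ) → ℝ} (hf : Continuous f) :
    Integrable f (Measure.pi fun _ : Fin n => ρ) := by
  obtain ⟨C, hC⟩ := exists_bound_pi_ball (f := fun z : ℝ × (Fin n → ℝ) => f z.2) (by fun_prop)
  refine Integrable.of_bound hf.aestronglyMeasurable C ?_
  filter_upwards [pi_ae_abs_le hρ n] with x hx
  exact hC 0 (by simp) x hx

lemma integral_pi_eval {ρ : Measure ℝ} [IsProbabilityMeasure ρ] {n : ℕ} {f : ℝ → ℝ}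
    (hf : Continuous f) (i : Fin n) :
    ∫ x, f (x i) ∂(Measure.pi fun _ : Fin n => ρ) = ∫ t, f t ∂ρ := by
  have h := measurePreserving_eval (fun _ : Fin n => ρ) i
  conv_rhs => rw [← h.map_eq]
  rw [integral_map h.measurable.aemeasurable hf.aestronglyMeasurable]

lemma integral_pi_pair {ρ : Measure ℝ} [IsProbabilityMeasure ρ] {n : ℕ} {f : ℝ × ℝ → ℝ}
    (hf : Continuous f) {i j : Fin n} (hij : i ≠ j) :
    ∫ x, f (x i, x j) ∂(Measure.pi fun _ : Fin n => ρ) = ∫ z, f z ∂(ρ.prod ρ) := by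
  have h := ProbabilityTheory.iIndepFun_pi (μ := fun _ : Fin n => ρ) (X := fun _ t => t)
    fun _ => aemeasurable_id'
  have h2 := (ProbabilityTheory.indepFun_iff_map_prod_eq_prod_map_map
    (measurable_pi_apply i).aemeasurable (measurable_pi_apply j).aemeasurable).1 (h.indepFun hij)
  have hi := (measurePreserving_eval (fun _ : Fin n => ρ) i).map_eq
  have hj := (measurePreserving_eval (fun _ : Fin n => ρ) j).map_eq
  have hi' : Measure.map (fun x : Fin n → ℝ => x i) (Measure.pi fun _ => ρ) = ρ := hi
  have hj' : Measure.map (fun x : Fin n → ℝ => x j) (Measure.pi fun _ => ρ) = ρ := hj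
  rw [hi', hj'] at h2
  conv_rhs => rw [← h2]
  rw [integral_map ((measurable_pi_apply i).prodMk (measurable_pi_apply j)).aemeasurable
    hf.aestronglyMeasurable]

lemma exp_add_add_le_integral {α : Type*} [MeasurableSpace α] {P : Measure α}
    [IsProbabilityMeasure P] {f g h : α → ℝ} (hf : Integrable f P) (hg : Integrable g P)
    (hh : Integrable h P) (he : Integrable (fun x => Real.exp (f x + g x + h x)) P) {A B C : ℝ}
    (h1 : A ≤ ∫ x, f x ∂P) (h2 : B ≤ ∫ x, g x ∂P) (h3 : C ≤ ∫ x, h x ∂P) :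
    Real.exp (A + B + C) ≤ ∫ x, Real.exp (f x + g x + h x) ∂P := by
  have hj := convexOn_exp.map_integral_le (μ := P) Real.continuous_exp.continuousOn isClosed_univ
    (f := fun x => f x + g x + h x) (by simp) ((hf.add hg).add hh) he
  refine le_trans (Real.exp_le_exp.2 ?_) hj
  have e1 : ∫ x, (f x + g x + h x) ∂P = ∫ x, (f x + g x) ∂P + ∫ x, h x ∂P :=
    integral_add (hf.add hg) hh
  rw [e1, integral_add hf hg]
  linarith

lemma integral_pi_pairs {ρ : Measure ℝ} [IsProbabilityMeasure ρ]
    (hρ : ∀ᵐ x ∂ρ, |x| ≤ 1) {n : ℕ} {η : ℝ} (hη : 0 < η) (b : ℝ) :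
    ∫ x, ∑ i, ∑ j ∈ Finset.Ioi i, b * logReg η (x i - x j) ∂(Measure.pi fun _ : Fin n => ρ) =
      b * (∑ i : Fin n, ((Finset.Ioi i).card : ℝ)) * mutE η ρ ρ := by
  have hc2 : ∀ i j : Fin n, Continuous fun x : Fin n → ℝ => b * logReg η (x i - x j) :=
    fun i j => ((continuous_logReg hη).comp (by fun_prop)).const_mul _
  rw [integral_finsetSum _ fun i _ => integrable_pi_of_continuous hρ (by fun_prop), Finset.mul_sum,
    Finset.sum_mul]
  refine Finset.sum_congr rfl fun i _ => ?_
  rw [integral_finsetSum _ fun j _ => integrable_pi_of_continuous hρ (hc2 i j)]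
  have : ∀ j ∈ Finset.Ioi i, ∫ x, b * logReg η (x i - x j) ∂(Measure.pi fun _ : Fin n => ρ) =
      b * mutE η ρ ρ := by
    intro j hj
    rw [integral_const_mul, mutE_eq_prod hη 1 ρ ρ hρ hρ]
    congr 1
    exact integral_pi_pair (f := fun z => logReg η (z.1 - z.2))
      ((continuous_logReg hη).comp (by fun_prop)) (Finset.mem_Ioi.1 hj).ne
  rw [Finset.sum_congr rfl this, Finset.sum_const, nsmul_eq_mul]
  ring

lemma integral_pi_sum {ρ : Measure ℝ} [IsProbabilityMeasure ρ]
    (hρ : ∀ᵐ x ∂ρ, |x| ≤ 1) {n : ℕ} {f : ℝ → ℝ} (hf : Continuous f) :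
    ∫ x, ∑ i, f (x i) ∂(Measure.pi fun _ : Fin n => ρ) = n * ∫ t, f t ∂ρ := by
  have h : ∀ i : Fin n, Continuous fun x : Fin n → ℝ => f (x i) := fun i =>
    hf.comp (continuous_apply i)
  rw [integral_finsetSum _ fun i _ => integrable_pi_of_continuous hρ (h i), Finset.sum_congr rfl fun i _ => integral_pi_eval hf i]
  simp

lemma exp_le_integral_gibbsReg (b : ℕ) {p a L I J m : ℝ} (hp : 0 < p) {n : ℕ}
    {ρ : Measure ℝ} [IsProbabilityMeasure ρ] (hρ : ∀ᵐ x ∂ρ, |x| ≤ 1)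
    (hm : ∫ t, |t| ^ p ∂ρ = m) (hL : L = n * m) (hL0 : 0 < L) {η : ℝ} (hη : 0 < η)
    (hI : I ≤ mutE η ρ ρ) (hJ : J ≤ ∫ t, logReg η t ∂ρ) :
    Real.exp (-a + b * (∑ i : Fin n, ((Finset.Ioi i).card : ℝ)) * I + n * (J - Real.log p)) ≤
      ∫ x, gibbsReg b p a L η x ∂(Measure.pi fun _ : Fin n => ρ) := by
  have hc1 : ∀ i : Fin n, Continuous fun x : Fin n → ℝ => |x i| ^ p := fun i =>
    (continuous_abs_rpow hp).comp (by fun_prop)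
  have hc2 : ∀ i j : Fin n, Continuous fun x : Fin n → ℝ => b * logReg η (x i - x j) :=
    fun i j => ((continuous_logReg hη).comp (by fun_prop)).const_mul _
  have hcl : Continuous fun t => logReg η t - Real.log p :=
    (continuous_logReg hη).sub continuous_const
  have hc3 : ∀ i : Fin n, Continuous fun x : Fin n → ℝ => logReg η (x i) - Real.log p :=
    fun i => hcl.comp (continuous_apply i)
  simp only [gibbsReg_eq_exp b hp a L hη]
  refine exp_add_add_le_integral (integrable_pi_of_continuous hρ (by fun_prop))
    (integrable_pi_of_continuous hρ (by fun_prop)) (integrable_pi_of_continuous hρ (by fun_prop))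
    (integrable_pi_of_continuous hρ (by fun_prop)) ?_ ?_ ?_
  · rw [integral_const_mul, integral_pi_sum hρ (continuous_abs_rpow hp), hm, ← hL]
    refine le_of_eq ?_
    field_simp
  · rw [integral_pi_pairs hρ hη]
    gcongr
  · rw [integral_pi_sum hρ hcl,
      integral_sub (integrable_of_ae_abs_le hρ (continuous_logReg hη)) (integrable_const _)]
    simp only [integral_const, probReal_univ, one_smul]
    gcongr

lemma exp_le_integral_gibbsReg_zero (b : ℕ) {p a L E : ℝ} (hp : 0 < p) {n : ℕ}
    {ρ : Measure ℝ} [IsProbabilityMeasure ρ] (hρ : ∀ᵐ x ∂ρ, |x| ≤ 1)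
    (step : ∀ η : ℝ, 0 < η → E ≤ ∫ x, gibbsReg b p a L η x ∂(Measure.pi fun _ : Fin n => ρ)) :
    E ≤ ∫ x, gibbsReg b p a L 0 x ∂(Measure.pi fun _ : Fin n => ρ) := by
  have hlim : Tendsto (fun k : ℕ => ∫ x, gibbsReg b p a L (1 / ((k : ℝ) + 1)) x ∂(Measure.pi fun _ : Fin n => ρ)) atTop
      (nhds (∫ x, gibbsReg b p a L 0 x ∂(Measure.pi fun _ : Fin n => ρ))) := by
    obtain ⟨C, hC⟩ := exists_bound_pi_ball (continuous_gibbsReg b hp a L n)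
    refine tendsto_integral_of_dominated_convergence (fun _ => C)
      (fun k => (continuous_gibbsReg_right b hp a L _ n).aestronglyMeasurable) (integrable_const _) (fun k => ?_) (ae_of_all _ ?_)
    · filter_upwards [pi_ae_abs_le hρ n] with x hx
      refine hC _ ⟨by positivity, ?_⟩ x hx
      rw [div_le_one (by positivity)]
      have : (0 : ℝ) ≤ k := by positivity
      linarith
    · intro x
      have : Continuous fun η : ℝ => gibbsReg b p a L η x :=
        continuous_gibbsReg_left b p a L x
      exact (this.tendsto 0).comp tendsto_one_div_add_atTop_nhds_zero_nat
  exact ge_of_tendsto' hlim fun k => step _ (by positivity)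

/-- Gibbs' variational bound for the partition function. -/
lemma exp_le_lintegral_gibbs (b : ℕ) {p a L I : ℝ} (hp : 0 < p) {n : ℕ}
    (hL : L = n * ullMom p p) (hL0 : 0 < L)
    (hI : ∀ η : ℝ, 0 < η → I ≤ mutE η (ull 1 (1 / p)) (ull 1 (1 / p))) :
    ENNReal.ofReal (Real.exp (-a + b * (∑ i : Fin n, ((Finset.Ioi i).card : ℝ)) * I +
        n * (-Real.log 2 - 1 / p - Real.log p))) ≤
      ∫⁻ x : Fin n → ℝ, ENNReal.ofReal (Real.exp (-a * (∑ i, |x i| ^ p) / L)) *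
        ENNReal.ofReal (vdm b x) := by
  have hp' : (0 : ℝ) ≤ 1 / p := by positivity
  set μ := ull 1 (1 / p)
  have hμ : ∀ᵐ x ∂μ, |x| ≤ 1 := ull_abs_le one_pos hp'
  have hle := exp_le_integral_gibbsReg_zero b (a := a) (L := L) hp (n := n) hμ fun η hη =>
    exp_le_integral_gibbsReg b (a := a) (J := -Real.log 2 - 1 / p) hp hμ rfl hL hL0 hη (hI η hη) (by
      have h1 := ullPot_le one_pos hp' hη 0
      have h2 : ∀ y, logReg η (0 - y) = logReg η y := fun y => by simp [logReg]
      simp only [h2] at h1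
      have h3 : -Real.log 2 - 1 / p ≤ ullPot 1 (1 / p) 0 := by
        unfold ullPot
        have : 0 ≤ ∫ u in Set.Ioc (0 : ℝ) 1, arcPot (0 / (1 * u ^ (1 / p))) :=
          integral_nonneg fun u => arcPot_nonneg _
        rw [Real.log_one]
        linarith
      exact h3.trans h1)
  have hm : Measurable fun x : Fin n → ℝ =>
      ENNReal.ofReal (Real.exp (-a * (∑ i, |x i| ^ p) / L)) * ENNReal.ofReal (vdm b x) :=
    (by fun_prop : Measurable fun x : Fin n → ℝ =>
      ENNReal.ofReal (Real.exp (-a * (∑ i, |x i| ^ p) / L))).mul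
      (continuous_vdm b n).measurable.ennreal_ofReal
  refine le_trans ?_ (lintegral_pi_ull_mul_le hp hm)
  refine (ENNReal.ofReal_le_ofReal hle).trans (le_of_eq ?_)
  rw [ofReal_integral_eq_lintegral_ofReal (integrable_pi_of_continuous hμ (continuous_gibbsReg_right b hp a L 0 n))]
  · refine lintegral_congr fun x => ?_
    rw [gibbsReg_zero, ENNReal.ofReal_mul (mul_nonneg (Real.exp_nonneg _) (vdm_nonneg _ _)),
      ENNReal.ofReal_mul (Real.exp_nonneg _)]
  · refine ae_of_all _ fun x => ?_
    simp only [Pi.zero_apply, gibbsReg_zero]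
    have := vdm_nonneg b x
    positivity

lemma lintegral_Ioi_exp (a v : ℝ) (ha : 0 < a) :
    ∫⁻ s in Set.Ioi v, ENNReal.ofReal (a * Real.exp (-a * s)) =
      ENNReal.ofReal (Real.exp (-a * v)) := by
  have h1 := integral_exp_mul_Ioi (neg_lt_zero.mpr ha) v
  have h2 : IntegrableOn (fun s => Real.exp (-a * s)) (Set.Ioi v) :=
    integrableOn_exp_mul_Ioi (neg_lt_zero.mpr ha) v
  rw [← ofReal_integral_eq_lintegral_ofReal (h2.const_mul a)
    (ae_of_all _ fun s => by positivity), integral_const_mul, h1]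
  congr 1
  field_simp

lemma lintegral_Ioi_mul_exp_neg :
    ∫⁻ s in Set.Ioi (0 : ℝ), ENNReal.ofReal (s * Real.exp (-s)) = 1 := by
  have h0 := Real.GammaIntegral_convergent (s := 2) (by norm_num)
  have h1 := Real.Gamma_eq_integral (s := 2) (by norm_num)
  have h2 : ∀ s : ℝ, Real.exp (-s) * s ^ ((2 : ℝ) - 1) = s * Real.exp (-s) := by
    intro s
    rw [show (2 : ℝ) - 1 = 1 by norm_num, Real.rpow_one, mul_comm]
  simp only [h2] at h0 h1
  rw [← ofReal_integral_eq_lintegral_ofReal h0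
    ((ae_restrict_iff' measurableSet_Ioi).mpr (ae_of_all _ fun s hs => by
      have : (0 : ℝ) < s := hs
      positivity)), ← h1, Real.Gamma_two, ENNReal.ofReal_one]

lemma mul_exp_mul_rpow_le {a s : ℝ} (ha : 1 ≤ a) (hs : 0 < s) :
    a * Real.exp (-a * s) * s ^ a ≤ a * Real.exp (1 - a) * (s * Real.exp (-s)) := by
  have h : Real.exp (-a * s) * s ^ a ≤ Real.exp (1 - a) * (s * Real.exp (-s)) := by
    rw [Real.rpow_def_of_pos hs, ← Real.exp_add]
    have h : s * Real.exp (-s) = Real.exp (Real.log s + -s) := by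
      rw [Real.exp_add, Real.exp_log hs]
    rw [h, ← Real.exp_add, Real.exp_le_exp]
    nlinarith [Real.log_le_sub_one_of_pos hs]
  nlinarith

lemma sum_abs_rpow_smul {p : ℝ} (hp : 0 < p) {n : ℕ} {s : ℝ} (hs : 0 < s) (x : Fin n → ℝ) :
    ∑ i, |(s ^ (1 / p) • x) i| ^ p = s * ∑ i, |x i| ^ p := by
  rw [Finset.mul_sum]
  refine Finset.sum_congr rfl fun i _ => ?_
  rw [Pi.smul_apply, smul_eq_mul, abs_mul, abs_of_pos (Real.rpow_pos_of_pos hs _),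
    Real.mul_rpow (Real.rpow_nonneg hs.le _) (abs_nonneg _), ← Real.rpow_mul hs.le,
    one_div_mul_cancel hp.ne', Real.rpow_one]

lemma continuous_sum_abs_rpow {p : ℝ} (hp : 0 < p) (n : ℕ) :
    Continuous fun x : Fin n → ℝ => ∑ i, |x i| ^ p :=
  continuous_finsetSum _ fun i _ =>
    (continuous_abs.comp (continuous_apply i)).rpow_const fun _ => Or.inr hp.le

lemma lintegral_gibbs_le (b : ℕ) {n : ℕ} {p L a : ℝ} (hp : 0 < p) (hL : 0 < L)
    (haN : a = ((n + b * ∑ i : Fin n, (Finset.Ioi i).card : ℕ) : ℝ) / p) (ha : 1 ≤ a) :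
    ∫⁻ x : Fin n → ℝ, ENNReal.ofReal (Real.exp (-a * (∑ i, |x i| ^ p) / L)) *
        ENNReal.ofReal (vdm b x) ≤
      ENNReal.ofReal (a * Real.exp (1 - a)) *
        ∫⁻ x in {x : Fin n → ℝ | ∑ i, |x i| ^ p ≤ L}, ENNReal.ofReal (vdm b x) := by
  have hWc := continuous_sum_abs_rpow hp n
  have ha0 : 0 < a := by linarith
  set M := ∫⁻ x in {x : Fin n → ℝ | ∑ i, |x i| ^ p ≤ L}, ENNReal.ofReal (vdm b x) with hM
  have hvm : Measurable fun x : Fin n → ℝ => ENNReal.ofReal (vdm b x) :=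
    (continuous_vdm b n).measurable.ennreal_ofReal
  set J : Set ((Fin n → ℝ) × ℝ) := {z | (∑ i, |z.1 i| ^ p) / L < z.2} with hJ
  have hJm : MeasurableSet J :=
    measurableSet_lt ((hWc.measurable.comp measurable_fst).div_const L) measurable_snd
  set e : ℝ → ℝ≥0∞ := fun s => ENNReal.ofReal (a * Real.exp (-a * s)) with he
  have hem : Measurable e := by fun_prop
  have step1 : ∀ x : Fin n → ℝ, ENNReal.ofReal (Real.exp (-a * (∑ i, |x i| ^ p) / L)) =
      ∫⁻ s, J.indicator (fun z => e z.2) (x, s) := by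
    intro x
    rw [mul_div_assoc, ← lintegral_Ioi_exp a _ ha0, ← lintegral_indicator measurableSet_Ioi]
    rfl
  have hKm : Measurable (J.indicator fun z : (Fin n → ℝ) × ℝ => e z.2) :=
    (hem.comp measurable_snd).indicator hJm
  have step2 : ∫⁻ x : Fin n → ℝ, ENNReal.ofReal (Real.exp (-a * (∑ i, |x i| ^ p) / L)) *
        ENNReal.ofReal (vdm b x) =
      ∫⁻ s, ∫⁻ x : Fin n → ℝ, J.indicator (fun z => e z.2) (x, s) * ENNReal.ofReal (vdm b x) := by
    rw [← lintegral_lintegral_swap (f := fun (x : Fin n → ℝ) (s : ℝ) =>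
      J.indicator (fun z => e z.2) (x, s) * ENNReal.ofReal (vdm b x))
      (hKm.mul (hvm.comp measurable_fst)).aemeasurable]
    refine lintegral_congr fun x => ?_
    rw [step1 x, lintegral_mul_const (f := fun s => J.indicator (fun z => e z.2) (x, s)) _
      (hKm.comp measurable_prodMk_left)]
  rw [step2]
  have step3 : ∀ s : ℝ,
      ∫⁻ x : Fin n → ℝ, J.indicator (fun z => e z.2) (x, s) * ENNReal.ofReal (vdm b x) ≤
        (Set.Ioi (0 : ℝ)).indicator (fun s => ENNReal.ofReal (a * Real.exp (1 - a)) * M *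
          ENNReal.ofReal (s * Real.exp (-s))) s := by
    intro s
    by_cases hs : 0 < s
    · rw [Set.indicator_of_mem (Set.mem_Ioi.mpr hs)]
      have hr := Real.rpow_pos_of_pos hs (1 / p)
      rw [lintegral_smul_vdm (f := fun x => J.indicator (fun z => e z.2) (x, s)) b hr
        (hKm.comp measurable_prodMk_right)]
      have h1 : ∀ x : Fin n → ℝ, J.indicator (fun z => e z.2) (s ^ (1 / p) • x, s) *
          ENNReal.ofReal (vdm b x) ≤ e s * ({x : Fin n → ℝ | ∑ i, |x i| ^ p ≤ L}).indicator
            (fun x => ENNReal.ofReal (vdm b x)) x := by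
        intro x
        by_cases hx : (s ^ (1 / p) • x, s) ∈ J
        · have hx' : x ∈ {x : Fin n → ℝ | ∑ i, |x i| ^ p ≤ L} := by
            have : (∑ i, |(s ^ (1 / p) • x) i| ^ p) / L < s := hx
            rw [sum_abs_rpow_smul hp hs, div_lt_iff₀ hL] at this
            exact (lt_of_mul_lt_mul_left this hs.le).le
          rw [Set.indicator_of_mem hx, Set.indicator_of_mem hx']
        · rw [Set.indicator_of_notMem hx]
          simp
      have hrN : (s ^ (1 / p)) ^ (n + b * ∑ i : Fin n, (Finset.Ioi i).card) = s ^ a := by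
        rw [← Real.rpow_natCast, ← Real.rpow_mul hs.le, haN]
        congr 1
        ring
      rw [hrN]
      calc _ ≤ ENNReal.ofReal (s ^ a) * (e s * M) := by
            gcongr
            refine (lintegral_mono h1).trans_eq ?_
            rw [lintegral_const_mul _ (hvm.indicator (measurableSet_le hWc.measurable
              measurable_const)), lintegral_indicator (measurableSet_le hWc.measurable
              measurable_const)]
        _ = ENNReal.ofReal (a * Real.exp (-a * s) * s ^ a) * M := by
            rw [ENNReal.ofReal_mul (by positivity)]
            ring
        _ ≤ ENNReal.ofReal (a * Real.exp (1 - a) * (s * Real.exp (-s))) * M := by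
            exact mul_le_mul' (ENNReal.ofReal_le_ofReal (mul_exp_mul_rpow_le ha hs)) le_rfl
        _ = _ := by
            rw [ENNReal.ofReal_mul (by positivity)]
            ring
    · rw [Set.indicator_of_notMem (by simpa using hs), nonpos_iff_eq_zero]
      rw [← lintegral_zero (μ := (volume : Measure (Fin n → ℝ)))]
      refine lintegral_congr fun x => ?_
      rw [Set.indicator_of_notMem, zero_mul]
      intro hx
      have h : (∑ i, |x i| ^ p) / L < s := hx
      have : 0 ≤ (∑ i, |x i| ^ p) / L :=
        div_nonneg (Finset.sum_nonneg fun i _ => Real.rpow_nonneg (abs_nonneg _) _) hL.le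
      linarith
  refine (lintegral_mono step3).trans_eq ?_
  rw [lintegral_indicator measurableSet_Ioi, lintegral_const_mul _ (by fun_prop),
    lintegral_Ioi_mul_exp_neg, mul_one]

lemma integral_abs_cos_rpow {s : ℝ} (hs : 0 < s) :
    ∫ θ in Set.Ioo (-Real.pi) Real.pi, |Real.cos θ| ^ s =
      2 * Real.pi * (Real.Gamma ((s + 1) / 2) / (√Real.pi * Real.Gamma ((s + 2) / 2))) := by
  have hpi := Real.pi_pos
  have hG : 0 < Real.Gamma ((s + 2) / 2) := Real.Gamma_pos_of_pos (by linarith)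
  have h1 : ∫ x : ℝ, |x| ^ s * Real.exp (-x ^ 2) = Real.Gamma ((s + 1) / 2) := by
    have h := integral_comp_abs (f := fun x : ℝ => x ^ s * Real.exp (-x ^ (2 : ℝ)))
    rw [integral_rpow_mul_exp_neg_rpow two_pos (by linarith)] at h
    simp only [Real.rpow_two, sq_abs] at h
    rw [h]
    ring
  have h2 : ∫ y : ℝ, Real.exp (-y ^ 2) = √Real.pi := by
    simpa using integral_gaussian 1
  have h3 : ∫ r in Set.Ioi (0 : ℝ), r ^ (s + 1) * Real.exp (-r ^ 2) =
      1 / 2 * Real.Gamma ((s + 2) / 2) := by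
    have h := integral_rpow_mul_exp_neg_rpow (p := 2) (q := s + 1) two_pos (by linarith)
    simp only [Real.rpow_two] at h
    rw [h]
    congr 2
    ring
  have h4 := integral_comp_polarCoord_symm
    (fun z : ℝ × ℝ => (|z.1| ^ s * Real.exp (-z.1 ^ 2)) * Real.exp (-z.2 ^ 2))
  rw [Measure.volume_eq_prod, integral_prod_mul (fun x : ℝ => |x| ^ s * Real.exp (-x ^ 2))
    (fun y : ℝ => Real.exp (-y ^ 2)), h1, h2] at h4
  have h5 : ∫ z in polarCoord.target, z.1 • ((|(polarCoord.symm z).1| ^ s *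
      Real.exp (-(polarCoord.symm z).1 ^ 2)) * Real.exp (-(polarCoord.symm z).2 ^ 2))
        ∂((volume : Measure ℝ).prod volume) =
      ∫ z in polarCoord.target, (z.1 ^ (s + 1) * Real.exp (-z.1 ^ 2)) * |Real.cos z.2| ^ s
        ∂((volume : Measure ℝ).prod volume) := by
    refine setIntegral_congr_fun polarCoord.open_target.measurableSet fun z hz => ?_
    have hz1 : 0 < z.1 := hz.1
    simp only [polarCoord_symm_apply, smul_eq_mul]
    rw [mul_assoc (_ ^ s), ← Real.exp_add, abs_mul, abs_of_pos hz1,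
      Real.mul_rpow hz1.le (abs_nonneg _), Real.rpow_add hz1, Real.rpow_one,
      show -(z.1 * Real.cos z.2) ^ 2 + -(z.1 * Real.sin z.2) ^ 2 = -z.1 ^ 2 by
        linear_combination (-z.1 ^ 2) * Real.sin_sq_add_cos_sq z.2]
    ring
  rw [h5, polarCoord_target, setIntegral_prod_mul
    (fun r : ℝ => r ^ (s + 1) * Real.exp (-r ^ 2)) (fun θ : ℝ => |Real.cos θ| ^ s), h3] at h4
  have h6 : Real.pi = √Real.pi * √Real.pi := (Real.mul_self_sqrt hpi.le).symm
  have h7 : 0 < √Real.pi := Real.sqrt_pos.mpr hpi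
  rw [mul_div_assoc', _root_.eq_div_iff (by positivity)]
  linear_combination 2 * √Real.pi * h4 - 2 * Real.Gamma ((s + 1) / 2) * h6

lemma integral_arcLaw_abs_rpow {s : ℝ} (hs : 0 < s) :
    ∫ c, |c| ^ s ∂arcLaw =
      Real.Gamma ((s + 1) / 2) / (√Real.pi * Real.Gamma ((s + 2) / 2)) := by
  have hpi := Real.pi_pos
  unfold arcLaw
  rw [integral_map (by fun_prop) (continuous_abs_rpow hs).aestronglyMeasurable,
    integral_smul_measure, ENNReal.toReal_ofReal (by positivity),
    ← intervalIntegral.integral_of_le (by positivity)]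
  have hper : Function.Periodic (fun θ : ℝ => |Real.cos θ| ^ s) (2 * Real.pi) := fun θ => by
    simp only [Real.cos_add_two_pi]
  have h := hper.intervalIntegral_add_eq 0 (-Real.pi)
  rw [zero_add, show -Real.pi + 2 * Real.pi = Real.pi by ring] at h
  rw [h, intervalIntegral.integral_of_le (by linarith), integral_Ioc_eq_integral_Ioo,
    integral_abs_cos_rpow hs, smul_eq_mul, ← mul_assoc, inv_mul_cancel₀ (by positivity), one_mul]

lemma ullMom_eq {p s : ℝ} (hp : 0 < p) (hs : 0 < s) :
    ullMom p s = p / (p + s) * Real.Gamma ((s + 1) / 2) /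
      (√Real.pi * Real.Gamma ((s + 2) / 2)) := by
  unfold ullMom
  rw [integral_ull one_pos (by positivity) (continuous_abs_rpow hs)]
  have h1 : ∀ u ∈ Set.Ioc (0 : ℝ) 1, ∫ c, |1 * u ^ (1 / p) * c| ^ s ∂arcLaw =
      u ^ (s / p) * ∫ c, |c| ^ s ∂arcLaw := by
    intro u hu
    rw [← integral_const_mul]
    refine integral_congr_ae (ae_of_all _ fun c => ?_)
    have hu0 := Real.rpow_nonneg hu.1.le (1 / p)
    simp only [one_mul]
    rw [abs_mul, abs_of_nonneg hu0, Real.mul_rpow hu0 (abs_nonneg _), ← Real.rpow_mul hu.1.le]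
    congr 2
    ring
  have h0 : 0 < s / p := by positivity
  rw [setIntegral_congr_fun measurableSet_Ioc h1, integral_mul_const, integral_arcLaw_abs_rpow hs,
    ← intervalIntegral.integral_of_le zero_le_one, integral_rpow (Or.inl (by linarith)),
    Real.one_rpow, Real.zero_rpow (by linarith)]
  field_simp
  ring

lemma ullMom_pos {p s : ℝ} (hp : 0 < p) (hs : 0 < s) : 0 < ullMom p s := by
  rw [ullMom_eq hp hs]
  have := Real.Gamma_pos_of_pos (show 0 < (s + 1) / 2 by linarith)
  have := Real.Gamma_pos_of_pos (show 0 < (s + 2) / 2 by linarith)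
  have := Real.pi_pos
  positivity

lemma volume_sum_abs_rpow_le {p L : ℝ} (hp : 0 < p) (hL : 0 ≤ L) (n : ℕ) :
    volume {x : Fin n → ℝ | ∑ i, |x i| ^ p ≤ L} ≤ ENNReal.ofReal ((2 * L ^ (1 / p)) ^ n) := by
  have h : {x : Fin n → ℝ | ∑ i, |x i| ^ p ≤ L} ⊆
      Set.Icc (fun _ => -L ^ (1 / p)) (fun _ => L ^ (1 / p)) := by
    intro x hx
    have h1 : ∀ i, |x i| ≤ L ^ (1 / p) := by
      intro i
      have h2 : |x i| ^ p ≤ L := (Finset.single_le_sum (f := fun i => |x i| ^ p)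
        (fun i _ => Real.rpow_nonneg (abs_nonneg _) _) (Finset.mem_univ i)).trans hx
      have h3 := Real.rpow_le_rpow (Real.rpow_nonneg (abs_nonneg _) _) h2
        (one_div_pos.mpr hp).le
      rwa [← Real.rpow_mul (abs_nonneg _), mul_one_div_cancel hp.ne', Real.rpow_one] at h3
    exact ⟨fun i => (abs_le.mp (h1 i)).1, fun i => (abs_le.mp (h1 i)).2⟩
  refine (measure_mono h).trans_eq ?_
  rw [Real.volume_Icc_pi, Finset.prod_const, Finset.card_univ, Fintype.card_fin,
    ENNReal.ofReal_pow (by positivity)]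
  congr 2
  ring

/-- The set of points satisfying the moment constraint whose `q`-th empirical moment is far
from the one of the Ullman law. -/
def badSet (p q δ : ℝ) (n : ℕ) : Set (Fin n → ℝ) :=
  {x | ∑ i, |x i| ^ p ≤ n * ullMom p p ∧ δ < |(∑ i, |x i| ^ q) / n - ullMom p q|}

lemma setLIntegral_badSet_le {b : ℕ} (hb : b ≠ 0) {p q δ E : ℝ} (hp : 0 < p) {n : ℕ}
    (h : ∀ x : Fin n → ℝ, Function.Injective x → ∑ i, |x i| ^ p ≤ n * ullMom p p → E ≤ logE x →
      |(∑ i, |x i| ^ q) / n - ullMom p q| ≤ δ) :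
    ∫⁻ x in badSet p q δ n, ENNReal.ofReal (vdm b x) ≤
      ENNReal.ofReal (Real.exp (b / 2 * E) * (2 * (n * ullMom p p) ^ (1 / p)) ^ n) := by
  have hL : 0 ≤ n * ullMom p p := mul_nonneg n.cast_nonneg (ullMom_nonneg p p)
  have h1 : ∀ x ∈ badSet p q δ n,
      ENNReal.ofReal (vdm b x) ≤ ENNReal.ofReal (Real.exp (b / 2 * E)) := by
    rintro x ⟨hx1, hx2⟩
    refine ENNReal.ofReal_le_ofReal ?_
    by_cases hx : Function.Injective x
    · rw [vdm_eq_exp b hx, Real.exp_le_exp]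
      refine mul_le_mul_of_nonneg_left ?_ (by positivity)
      by_contra! hE
      exact absurd (h x hx hx1 hE.le) (not_le.mpr hx2)
    · rw [vdm_eq_zero hb hx]
      exact (Real.exp_pos _).le
  calc ∫⁻ x in badSet p q δ n, ENNReal.ofReal (vdm b x)
      ≤ ∫⁻ _ in badSet p q δ n, ENNReal.ofReal (Real.exp (b / 2 * E)) :=
        setLIntegral_mono measurable_const h1
    _ = ENNReal.ofReal (Real.exp (b / 2 * E)) * volume (badSet p q δ n) :=
        setLIntegral_const _ _
    _ ≤ ENNReal.ofReal (Real.exp (b / 2 * E)) *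
        ENNReal.ofReal ((2 * (n * ullMom p p) ^ (1 / p)) ^ n) := by
        gcongr
        exact (measure_mono fun x hx => hx.1).trans (volume_sum_abs_rpow_le hp hL n)
    _ = _ := (ENNReal.ofReal_mul (Real.exp_pos _).le).symm

lemma eventually_exp_bound {b : ℕ} (hb : b ≠ 0) {p m I k : ℝ} (hp : 0 < p) (hm : 0 < m) :
    ∃ C₀ : ℝ, 0 ≤ C₀ ∧ ∃ n₀ : ℕ, 0 < n₀ ∧ ∀ n : ℕ, n₀ ≤ n → ∀ a c : ℝ, 2 * c = n * ((n : ℝ) - 1) →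
      a = (n + b * c) / p → 1 ≤ a →
      (n : ℝ) ^ n * (Real.exp (b / 2 * ((n : ℝ) ^ 2 * I - C₀ * (n * Real.log n))) *
          (2 * (n * m) ^ (1 / p)) ^ n) * (a * Real.exp (1 - a)) ≤
        Real.exp (-n) * Real.exp (-a + b * c * I + n * k) := by
  have hb' : (0 : ℝ) < b := by positivity
  set C₀ : ℝ := 2 / b * (4 + 1 / p) with hC₀
  set K : ℝ := |Real.log 2 + Real.log m / p + b * I / 2 + 1 - k| + |Real.log ((1 + b) / p)| + 1
  obtain ⟨n₀, hn₀⟩ := exists_nat_gt (Real.exp K)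
  have hn₀0 : (0 : ℝ) < n₀ := (Real.exp_pos _).trans hn₀
  refine ⟨C₀, by positivity, n₀, by exact_mod_cast hn₀0, fun n hn a c hc ha ha1 => ?_⟩
  have hnn : (n₀ : ℝ) ≤ n := by exact_mod_cast hn
  have hn0 : (0 : ℝ) < n := hn₀0.trans_le hnn
  have hn1 : (1 : ℝ) ≤ n := by exact_mod_cast (by exact_mod_cast hn0 : 0 < n)
  have hK : K ≤ Real.log n := by
    rw [Real.le_log_iff_exp_le hn0]
    linarith
  have ha0 : 0 < a := by linarith
  have hla : Real.log a ≤ 2 * Real.log n + Real.log ((1 + b) / p) := by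
    rw [← Real.log_rpow hn0, ← Real.log_mul (by positivity) (by positivity)]
    refine Real.log_le_log ha0 ?_
    rw [ha, Real.rpow_two, mul_div_assoc']
    gcongr
    nlinarith
  have e1 : (n : ℝ) ^ n = Real.exp (n * Real.log n) := by
    rw [mul_comm, Real.exp_mul, Real.exp_log hn0, Real.rpow_natCast]
  have e2 : (2 * (n * m) ^ (1 / p)) ^ n =
      Real.exp (n * (Real.log 2 + (Real.log n + Real.log m) / p)) := by
    rw [mul_comm (n : ℝ) (_ + _), Real.exp_mul, Real.exp_add, Real.exp_log two_pos,
      ← Real.log_mul hn0.ne' hm.ne', div_eq_mul_one_div (Real.log _), Real.exp_mul,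
      Real.exp_log (by positivity), Real.rpow_natCast]
  have e3 : a = Real.exp (Real.log a) := (Real.exp_log ha0).symm
  rw [e1, e2]
  nth_rewrite 1 [e3]
  simp only [← Real.exp_add]
  rw [Real.exp_le_exp]
  have h1 := le_abs_self (Real.log 2 + Real.log m / p + b * I / 2 + 1 - k)
  have h2 := le_abs_self (Real.log ((1 + b) / p))
  have h3 := abs_nonneg (Real.log ((1 + b) / p))
  have hlog : 0 ≤ Real.log n := Real.log_nonneg hn1
  have e4 : b / 2 * ((n : ℝ) ^ 2 * I - C₀ * (n * Real.log n)) =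
      b * n ^ 2 * I / 2 - (4 + 1 / p) * (n * Real.log n) := by
    rw [hC₀]
    field_simp
  have e5 : b * c * I = b * I / 2 * (n * ((n : ℝ) - 1)) := by
    rw [← hc]
    ring
  rw [e4, e5]
  have h4 : n * K ≤ n * Real.log n := mul_le_mul_of_nonneg_left hK hn0.le
  have h5 : n * (Real.log 2 + Real.log m / p + b * I / 2 + 1 - k) +
      Real.log ((1 + b) / p) + 1 ≤ n * K := by
    have h6 := mul_le_mul_of_nonneg_left h1 hn0.le
    have h7 := mul_le_mul_of_nonneg_right hn1 h3
    simp only [K]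
    nlinarith
  have h8 : Real.log n ≤ n * Real.log n := by nlinarith
  have e6 : (n : ℝ) * (Real.log 2 + (Real.log n + Real.log m) / p) =
    n * Real.log 2 + n * (Real.log m / p) + 1 / p * (n * Real.log n) := by ring
  rw [e6]
  nlinarith

/-- Under the eigenvalue law on the `ℓᵖ`-ball, the set of points whose `q`-th moment is far from
the limit has exponentially small probability. -/
theorem eventually_badSet_le {b : ℕ} (hb : b ≠ 0) {p q δ : ℝ} (hp : 0 < p) (hq : 0 < q)
    (hδ : 0 < δ) :
    ∃ n₀ : ℕ, ∀ n : ℕ, n₀ ≤ n →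
      (n.factorial : ℝ≥0∞) * ∫⁻ x in badSet p q δ n, ENNReal.ofReal (vdm b x) ≤
        ENNReal.ofReal (Real.exp (-n)) *
          ∫⁻ x in {x : Fin n → ℝ | ∑ i, |x i| ^ p ≤ n * ullMom p p},
            ENNReal.ofReal (vdm b x) := by
  have hm := ullMom_pos hp hp
  obtain ⟨I, hI, hE⟩ := exists_energy_const hp hq
  obtain ⟨C₀, hC₀, n₁, hn₁, hexp⟩ := eventually_exp_bound hb (I := I)
    (k := -Real.log 2 - 1 / p - Real.log p) hp hm
  obtain ⟨n₂, hn₂⟩ := hE C₀ hC₀ δ hδ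
  obtain ⟨n₃, hn₃⟩ := exists_nat_gt p
  refine ⟨max n₁ (max n₂ n₃), fun n hn => ?_⟩
  have hn1 : n₁ ≤ n := (le_max_left _ _).trans hn
  have hn2 : n₂ ≤ n := ((le_max_left _ _).trans (le_max_right _ _)).trans hn
  have hn3 : (n₃ : ℝ) ≤ n := by
    exact_mod_cast ((le_max_right _ _).trans (le_max_right _ _)).trans hn
  have hn0 : (0 : ℝ) < n := by exact_mod_cast hn₁.trans_le hn1
  obtain ⟨c, hc⟩ : ∃ c : ℝ, c = ((∑ i : Fin n, (Finset.Ioi i).card : ℕ) : ℝ) := ⟨_, rfl⟩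
  have hc2 : 2 * c = n * ((n : ℝ) - 1) := hc ▸ sum_card_Ioi n
  obtain ⟨a, ha⟩ : ∃ a : ℝ, a = (n + b * c) / p := ⟨_, rfl⟩
  have hc0 : 0 ≤ c := hc ▸ Nat.cast_nonneg _
  have ha1 : 1 ≤ a := by
    rw [ha, one_le_div hp]
    have : 0 ≤ b * c := by positivity
    linarith
  have hlow := exp_le_lintegral_gibbs (n := n) (a := a) b hp (I := I) rfl (by positivity) hI
  have hupp := lintegral_gibbs_le (n := n) (a := a) (L := n * ullMom p p) b hp (by positivity)
    (by rw [ha, hc, Nat.cast_add, Nat.cast_mul]) ha1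
  have hbad := setLIntegral_badSet_le (q := q) (δ := δ) hb hp
    (fun x hx h1 h2 => hn₂ n hn2 x hx h1 h2)
  have hreal := hexp n hn1 a c hc2 ha ha1
  have hfact : (n.factorial : ℝ≥0∞) ≤ ENNReal.ofReal ((n : ℝ) ^ n) := by
    rw [ENNReal.ofReal_pow hn0.le, ENNReal.ofReal_natCast]
    exact_mod_cast Nat.factorial_le_pow n
  have hcc : ∑ i : Fin n, ((Finset.Ioi i).card : ℝ) = c := by rw [hc, Nat.cast_sum]
  rw [hcc] at hlow
  have hw : 0 < a * Real.exp (1 - a) := by positivity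
  have hw1 : ENNReal.ofReal (a * Real.exp (1 - a)) ≠ 0 := by simpa using hw
  refine (ENNReal.mul_le_mul_iff_left hw1 ENNReal.ofReal_ne_top).mp ?_
  calc _ ≤ ENNReal.ofReal ((n : ℝ) ^ n) * ENNReal.ofReal (Real.exp (b / 2 *
          ((n : ℝ) ^ 2 * I - C₀ * (n * Real.log n))) * (2 * (n * ullMom p p) ^ (1 / p)) ^ n) *
          ENNReal.ofReal (a * Real.exp (1 - a)) := by gcongr
    _ ≤ ENNReal.ofReal (Real.exp (-n) * Real.exp (-a + b * c * I +
          n * (-Real.log 2 - 1 / p - Real.log p))) := by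
        rw [← ENNReal.ofReal_mul (by positivity), ← ENNReal.ofReal_mul (by positivity)]
        exact ENNReal.ofReal_le_ofReal hreal
    _ = ENNReal.ofReal (Real.exp (-n)) * ENNReal.ofReal (Real.exp (-a + b * c * I +
          n * (-Real.log 2 - 1 / p - Real.log p))) := ENNReal.ofReal_mul (Real.exp_pos _).le
    _ ≤ ENNReal.ofReal (Real.exp (-n)) * (ENNReal.ofReal (a * Real.exp (1 - a)) * _) := by
        gcongr
        exact hlow.trans hupp
    _ = _ := by ring

section HermitianSpace

variable {𝕜 : Type} [RCLike 𝕜]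

instance finite_hMat (n : ℕ) : Module.Finite ℝ (HMat 𝕜 n) :=
  inferInstanceAs (Module.Finite ℝ (selfAdjoint.submodule ℝ (Matrix (Fin n) (Fin n) 𝕜)))

variable [MeasurableSpace 𝕜] [BorelSpace 𝕜]

instance borelSpace_matrix (n : ℕ) : BorelSpace (Matrix (Fin n) (Fin n) 𝕜) :=
  inferInstanceAs (BorelSpace (Fin n → Fin n → 𝕜))

instance secondCountable_matrix (n : ℕ) : SecondCountableTopology (Matrix (Fin n) (Fin n) 𝕜) :=
  inferInstanceAs (SecondCountableTopology (Fin n → Fin n → 𝕜))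

end HermitianSpace

section Eigenvalues

variable {𝕜 : Type} [RCLike 𝕜]

lemma map_ofReal_injective : Function.Injective (Multiset.map ((↑) : ℝ → 𝕜)) :=
  Multiset.map_injective RCLike.ofReal_injective

/-- Hermitian matrices whose spectrum is known through the characteristic polynomial. -/
lemma map_eigs_eq {n : ℕ} (A : HMat 𝕜 n) (x : Fin n → ℝ)
    (h : A.val.charpoly = ∏ i, (Polynomial.X - Polynomial.C ((x i : ℝ) : 𝕜))) :
    Finset.univ.val.map (eigs A) = Finset.univ.val.map x := by
  apply map_ofReal_injective (𝕜 := 𝕜)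
  have h1 : A.val.charpoly.roots = Multiset.map (RCLike.ofReal ∘ eigs A) Finset.univ.val :=
    Matrix.IsHermitian.roots_charpoly_eq_eigenvalues A.prop
  have h2 : A.val.charpoly.roots = Finset.univ.val.map fun i => ((x i : ℝ) : 𝕜) := by
    rw [h, ← Polynomial.roots_multiset_prod_X_sub_C (Finset.univ.val.map fun i => ((x i : ℝ) : 𝕜)),
      Multiset.map_map]
    rfl
  rw [Multiset.map_map, Multiset.map_map, ← h1, h2]
  rfl

lemma det_smul_one_sub {n : ℕ} (A : HMat 𝕜 n) (t : ℝ) :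
    (((t : 𝕜) • (1 : Matrix (Fin n) (Fin n) 𝕜)) - A.val).det = ((∏ i, (t - eigs A i) : ℝ) : 𝕜) := by
  have h := congrArg (Polynomial.eval (t : 𝕜)) (Matrix.IsHermitian.charpoly_eq A.prop)
  rw [Matrix.eval_charpoly, Polynomial.eval_prod] at h
  rw [Matrix.scalar_apply] at h
  rw [Matrix.smul_one_eq_diagonal, h, RCLike.ofReal_prod]
  refine Finset.prod_congr rfl fun i _ => ?_
  simp [eigs]

lemma eq_of_antitone_of_map_eq {n : ℕ} {x y : Fin n → ℝ} (hx : Antitone x) (hy : Antitone y)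
    (h : Finset.univ.val.map x = Finset.univ.val.map y) : x = y := by
  rw [Fin.univ_val_map, Fin.univ_val_map, Multiset.coe_eq_coe] at h
  exact List.ofFn_injective (h.eq_of_pairwise (fun a b _ _ hab hba => le_antisymm hba hab)
    hx.sortedGE_ofFn.pairwise hy.sortedGE_ofFn.pairwise)

lemma prod_sub_injective {n : ℕ} {x y : Fin n → ℝ} (hx : Antitone x) (hy : Antitone y)
    (h : ∀ k : ℕ, ∏ i, ((k : ℝ) - x i) = ∏ i, ((k : ℝ) - y i)) : x = y := by
  refine eq_of_antitone_of_map_eq hx hy ?_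
  have h1 : ∏ i, (Polynomial.X - Polynomial.C (x i)) = ∏ i, (Polynomial.X - Polynomial.C (y i)) := by
    refine Polynomial.eq_of_infinite_eval_eq _ _ ((Set.infinite_range_of_injective
      (Nat.cast_injective (R := ℝ))).mono ?_)
    rintro _ ⟨k, rfl⟩
    simpa [Polynomial.eval_prod] using h k
  have h2 : ∀ z : Fin n → ℝ, (∏ i, (Polynomial.X - Polynomial.C (z i))).roots =
      Finset.univ.val.map z := by
    intro z
    rw [← Polynomial.roots_multiset_prod_X_sub_C (Finset.univ.val.map z), Multiset.map_map]
    rfl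
  rw [← h2 x, ← h2 y, h1]

variable [MeasurableSpace 𝕜] [BorelSpace 𝕜]

lemma measurable_eigs (n : ℕ) : Measurable (eigs : HMat 𝕜 n → Fin n → ℝ) := by
  set m := Fintype.card (Fin n)
  have hclosed : IsClosed {x : Fin m → ℝ | Antitone x} := by
    simp only [Antitone, Set.ofPred_forall]
    exact isClosed_iInter fun i => isClosed_iInter fun j => isClosed_iInter fun _ =>
      isClosed_le (continuous_apply j) (continuous_apply i)
  have : PolishSpace {x : Fin m → ℝ // Antitone x} := hclosed.polishSpace
  let Φ : {x : Fin m → ℝ // Antitone x} → ℕ → ℝ := fun x k => ∏ i, ((k : ℝ) - x.val i)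
  have hΦ : MeasurableEmbedding Φ := by
    refine Continuous.measurableEmbedding ?_ ?_
    · refine continuous_pi fun k => continuous_finsetProd _ fun i _ => ?_
      exact continuous_const.sub ((continuous_apply i).comp continuous_subtype_val)
    · intro x y hxy
      exact Subtype.ext (prod_sub_injective x.2 y.2 fun k => congrFun hxy k)
  let ev : HMat 𝕜 n → {x : Fin m → ℝ // Antitone x} := fun A =>
    ⟨Matrix.IsHermitian.eigenvalues₀ A.prop, Matrix.IsHermitian.eigenvalues₀_antitone A.prop⟩
  have hev : Measurable ev := by
    rw [← hΦ.measurable_comp_iff]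
    refine measurable_pi_lambda _ fun k => ?_
    have h1 : (fun A : HMat 𝕜 n => (Φ ∘ ev) A k) = fun A : HMat 𝕜 n =>
        RCLike.re ((((k : ℝ) : 𝕜) • (1 : Matrix (Fin n) (Fin n) 𝕜)) - A.val).det := by
      funext A
      rw [det_smul_one_sub, RCLike.ofReal_re]
      exact (Fintype.prod_equiv (Fintype.equivOfCardEq (Fintype.card_fin _)).symm _ _
        fun i => rfl).symm
    rw [h1]
    refine Continuous.measurable ?_
    exact RCLike.continuous_re.comp
      ((continuous_const.sub continuous_subtype_val).matrix_det)
  refine measurable_pi_lambda _ fun i => ?_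
  exact (measurable_pi_apply ((Fintype.equivOfCardEq (Fintype.card_fin _)).symm i)).comp
    (measurable_subtype_coe.comp hev)

end Eigenvalues

section Bordering

variable {𝕜 : Type} [RCLike 𝕜]

lemma charpoly_eq_of_mul_eq {m : Type*} [Fintype m] [DecidableEq m] {A B P : Matrix m m 𝕜}
    (hP : IsUnit P) (h : A * P = P * B) : A.charpoly = B.charpoly := by
  obtain ⟨u, rfl⟩ := hP
  rw [← Matrix.charpoly_units_conj u B, ← h, mul_assoc, ← Matrix.coe_units_inv, Units.mul_inv,
    mul_one]

lemma exists_unitary_smul_one_sub {n : ℕ} (D : HMat 𝕜 n) : ∃ U : Matrix (Fin n) (Fin n) 𝕜,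
    U * Uᴴ = 1 ∧ ∀ t : ℝ, (t : 𝕜) • (1 : Matrix (Fin n) (Fin n) 𝕜) - D.val =
      U * Matrix.diagonal (fun i => ((t - eigs D i : ℝ) : 𝕜)) * Uᴴ := by
  have hD : D.val.IsHermitian := D.prop
  have h1 := hD.spectral_theorem
  rw [Unitary.conjStarAlgAut_apply] at h1
  set U : Matrix (Fin n) (Fin n) 𝕜 := (hD.eigenvectorUnitary : Matrix (Fin n) (Fin n) 𝕜) with hU
  have hUU : U * star U = 1 := Unitary.mul_star_self_of_mem hD.eigenvectorUnitary.2
  refine ⟨U, hUU, fun t => ?_⟩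
  have h3 : Matrix.diagonal (fun i => ((t - eigs D i : ℝ) : 𝕜)) =
      (t : 𝕜) • (1 : Matrix (Fin n) (Fin n) 𝕜) -
        Matrix.diagonal (RCLike.ofReal ∘ hD.eigenvalues) := by
    rw [Matrix.smul_one_eq_diagonal, Matrix.diagonal_sub]
    congr 1
    funext i
    simp [eigs]
  rw [h3, ← Matrix.star_eq_conjTranspose, mul_sub, sub_mul, mul_smul_comm, mul_one, smul_mul_assoc,
    hUU, ← h1]

open scoped ComplexOrder in
lemma posDef_smul_one_sub_iff {n : ℕ} (D : HMat 𝕜 n) (t : ℝ) :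
    ((t : 𝕜) • (1 : Matrix (Fin n) (Fin n) 𝕜) - D.val).PosDef ↔ ∀ i, eigs D i < t := by
  obtain ⟨U, hUU, hU⟩ := exists_unitary_smul_one_sub D
  have hUu : IsUnit U := IsUnit.of_mul_eq_one _ hUU
  rw [hU, ← Matrix.star_eq_conjTranspose, IsUnit.posDef_star_right_conjugate_iff hUu,
    Matrix.posDef_diagonal_iff]
  refine forall_congr' fun i => ?_
  rw [RCLike.ofReal_pos, sub_pos]

lemma charpoly_fromBlocks_border {n : ℕ} (D C : Matrix (Fin n) (Fin n) 𝕜)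
    (W : Matrix (Fin n) (Fin 1) 𝕜) (t : 𝕜) (hC : C = t • 1 - D) :
    (Matrix.fromBlocks D (C * W) (Wᴴ * C) (t • 1 - Wᴴ * C * W)).charpoly =
      (t • 1 - (1 + W * Wᴴ) * C).charpoly * (Polynomial.X - Polynomial.C t) := by
  have hP : IsUnit (Matrix.fromBlocks (1 : Matrix (Fin n) (Fin n) 𝕜) W 0
      (1 : Matrix (Fin 1) (Fin 1) 𝕜)) := by
    rw [Matrix.isUnit_iff_isUnit_det, Matrix.det_fromBlocks_zero₂₁]
    simp
  rw [charpoly_eq_of_mul_eq (B := Matrix.fromBlocks (t • 1 - (1 + W * Wᴴ) * C) 0 (Wᴴ * C)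
    (t • 1)) hP, Matrix.charpoly_fromBlocks_zero₁₂]
  · congr 1
    rw [Matrix.smul_one_eq_diagonal, Matrix.charpoly_diagonal, Fin.prod_univ_one]
  · rw [Matrix.fromBlocks_multiply, Matrix.fromBlocks_multiply]
    congr 1
    · rw [mul_one, Matrix.mul_zero, add_zero, one_mul, add_mul, one_mul, Matrix.mul_assoc W]
      rw [hC]
      abel
    · rw [Matrix.mul_one, Matrix.mul_zero, zero_add, hC, Matrix.sub_mul]
      simp
    · simp
    · simp

/-- The scalar `α` for which `1 + α w w*` is the positive square root of `1 + w w*`. -/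
def borderScalar (s : ℝ) : ℝ := 1 / (1 + √(1 + s))

/-- The positive square root of `1 + w w*`. -/
def borderSqrt {n : ℕ} (w : Fin n → 𝕜) : Matrix (Fin n) (Fin n) 𝕜 :=
  1 + ((borderScalar (∑ i, ‖w i‖ ^ 2) : ℝ) : 𝕜) • Matrix.vecMulVec w (star w)

lemma star_dotProduct_self {n : ℕ} (w : Fin n → 𝕜) :
    star w ⬝ᵥ w = ((∑ i, ‖w i‖ ^ 2 : ℝ) : 𝕜) := by
  simp only [dotProduct, Pi.star_apply, RCLike.star_def, RCLike.conj_mul]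
  push_cast
  rfl

lemma borderSqrt_mul_self {n : ℕ} (w : Fin n → 𝕜) :
    borderSqrt w * borderSqrt w = 1 + Matrix.vecMulVec w (star w) := by
  set s := ∑ i, ‖w i‖ ^ 2 with hs
  have hs0 : 0 ≤ s := Finset.sum_nonneg fun i _ => by positivity
  set α := borderScalar s with hα
  have h1 : 2 * α + α ^ 2 * s = 1 := by
    have h2 : √(1 + s) ^ 2 = 1 + s := Real.sq_sqrt (by linarith)
    have h3 : 0 ≤ √(1 + s) := Real.sqrt_nonneg _
    rw [hα, borderScalar]
    field_simp
    linear_combination -h2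
  have h2 : Matrix.vecMulVec w (star w) * Matrix.vecMulVec w (star w) =
      (s : 𝕜) • Matrix.vecMulVec w (star w) := by
    rw [Matrix.vecMulVec_mul_vecMulVec, star_dotProduct_self, ← hs]
    ext i j
    simp [Matrix.vecMulVec_apply, RCLike.real_smul_eq_coe_mul]
    ring
  have h3 : (2 * (α : 𝕜) + (α : 𝕜) ^ 2 * (s : 𝕜)) = 1 := by
    exact_mod_cast congrArg (fun r : ℝ => (r : 𝕜)) h1
  unfold borderSqrt
  rw [← hs, ← hα, add_mul, mul_add, mul_add, one_mul, mul_one, one_mul, smul_mul_smul_comm, h2,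
    smul_smul]
  rw [add_assoc, ← add_smul, ← add_smul, show (α : 𝕜) + (α + α * α * s) = 1 by
    linear_combination h3, one_smul]

lemma borderSqrt_isHermitian {n : ℕ} (w : Fin n → 𝕜) : (borderSqrt w).IsHermitian := by
  refine Matrix.isHermitian_one.add ?_
  rw [Matrix.IsHermitian, Matrix.conjTranspose_smul, Matrix.conjTranspose_vecMulVec]
  simp

lemma det_borderSqrt_sq {n : ℕ} (w : Fin n → 𝕜) :
    (borderSqrt w).det * (borderSqrt w).det = ((1 + ∑ i, ‖w i‖ ^ 2 : ℝ) : 𝕜) := by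
  rw [← Matrix.det_mul, borderSqrt_mul_self, Matrix.vecMulVec_eq (Fin 1),
    Matrix.det_one_add_mul_comm, Matrix.det_unique]
  have h := star_dotProduct_self w
  simp only [Matrix.add_apply, Matrix.one_apply_eq, Matrix.replicateRow_mul_replicateCol_apply, h]
  push_cast
  rfl

lemma isUnit_borderSqrt {n : ℕ} (w : Fin n → 𝕜) : IsUnit (borderSqrt w) := by
  rw [Matrix.isUnit_iff_isUnit_det, isUnit_iff_ne_zero]
  intro h
  have h1 := det_borderSqrt_sq w
  rw [h, mul_zero, eq_comm, RCLike.ofReal_eq_zero] at h1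
  have : 0 ≤ ∑ i, ‖w i‖ ^ 2 := Finset.sum_nonneg fun i _ => by positivity
  linarith

lemma isHermitian_smul_one_sub {n : ℕ} (t : ℝ) (D : HMat 𝕜 n) :
    ((t : 𝕜) • (1 : Matrix (Fin n) (Fin n) 𝕜) - D.val).IsHermitian := by
  refine Matrix.IsHermitian.sub ?_ D.prop
  rw [Matrix.IsHermitian, Matrix.conjTranspose_smul, Matrix.conjTranspose_one]
  simp

/-- The Hermitian matrix `[[D, b], [b*, a]]`. -/
def border {n : ℕ} (a : ℝ) (b : Fin n → 𝕜) (D : HMat 𝕜 n) : HMat 𝕜 (n + 1) :=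
  ⟨Matrix.reindex finSumFinEquiv finSumFinEquiv
    (Matrix.fromBlocks D.val (Matrix.replicateCol (Fin 1) b) (Matrix.replicateRow (Fin 1) (star b))
      ((a : 𝕜) • 1)), by
    have h : (Matrix.fromBlocks D.val (Matrix.replicateCol (Fin 1) b)
        (Matrix.replicateRow (Fin 1) (star b)) ((a : 𝕜) • 1)).IsHermitian := by
      refine Matrix.IsHermitian.fromBlocks D.prop ?_ ?_
      · rw [Matrix.conjTranspose_replicateCol]
      · rw [Matrix.IsHermitian, Matrix.conjTranspose_smul, Matrix.conjTranspose_one]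
        simp
    exact h.submatrix _⟩

/-- The matrix `B` such that `t` and the eigenvalues of `B` are the eigenvalues of the bordered
matrix with eigenvector `(w, 1)` for the eigenvalue `t`. -/
def compress {n : ℕ} (t : ℝ) (w : Fin n → 𝕜) (D : HMat 𝕜 n) : HMat 𝕜 n :=
  ⟨(t : 𝕜) • 1 - borderSqrt w * ((t : 𝕜) • 1 - D.val) * borderSqrt w, by
    have h1 : (borderSqrt w * ((t : 𝕜) • 1 - D.val) * borderSqrt w).IsHermitian := by
      have h := Matrix.isHermitian_mul_mul_conjTranspose (borderSqrt w)
        (isHermitian_smul_one_sub t D)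
      rwa [(borderSqrt_isHermitian w).eq] at h
    refine Matrix.IsHermitian.sub ?_ h1
    rw [Matrix.IsHermitian, Matrix.conjTranspose_smul, Matrix.conjTranspose_one]
    simp⟩

lemma smul_one_sub_compress {n : ℕ} (t : ℝ) (w : Fin n → 𝕜) (D : HMat 𝕜 n) :
    (t : 𝕜) • (1 : Matrix (Fin n) (Fin n) 𝕜) - (compress t w D).val =
      borderSqrt w * ((t : 𝕜) • 1 - D.val) * borderSqrt w :=
  sub_sub_cancel _ _

lemma map_eigs_border {n : ℕ} (t : ℝ) (w : Fin n → 𝕜) (D : HMat 𝕜 n) :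
    Finset.univ.val.map (eigs (border
      (t - RCLike.re (star w ⬝ᵥ (((t : 𝕜) • (1 : Matrix (Fin n) (Fin n) 𝕜) - D.val) *ᵥ w)))
      (((t : 𝕜) • (1 : Matrix (Fin n) (Fin n) 𝕜) - D.val) *ᵥ w) D)) =
    Finset.univ.val.map (Fin.cons t (eigs (compress t w D)) : Fin (n + 1) → ℝ) := by
  apply map_eigs_eq
  set C : Matrix (Fin n) (Fin n) 𝕜 := (t : 𝕜) • 1 - D.val with hC
  have hCh : C.IsHermitian := isHermitian_smul_one_sub t D
  set W := Matrix.replicateCol (Fin 1) w with hW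
  have hre : ((RCLike.re (star w ⬝ᵥ (C *ᵥ w)) : ℝ) : 𝕜) = star w ⬝ᵥ (C *ᵥ w) :=
    RCLike.conj_eq_iff_re.1 (RCLike.conj_eq_iff_im.2 (hCh.im_star_dotProduct_mulVec_self w))
  have h1 : Matrix.fromBlocks D.val (Matrix.replicateCol (Fin 1) (C *ᵥ w))
      (Matrix.replicateRow (Fin 1) (star (C *ᵥ w)))
      (((t - RCLike.re (star w ⬝ᵥ (C *ᵥ w)) : ℝ) : 𝕜) • (1 : Matrix (Fin 1) (Fin 1) 𝕜)) =
      Matrix.fromBlocks D.val (C * W) (Wᴴ * C) ((t : 𝕜) • 1 - Wᴴ * C * W) := by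
    congr 1
    · rw [Matrix.star_mulVec, hCh.eq, Matrix.replicateRow_vecMul, Matrix.conjTranspose_replicateCol]
    · ext i j
      rw [Subsingleton.elim i j, Matrix.mul_assoc]
      have h6 : ((t - RCLike.re (star w ⬝ᵥ (C *ᵥ w)) : ℝ) : 𝕜) = t - star w ⬝ᵥ (C *ᵥ w) := by
        rw [RCLike.ofReal_sub, hre]
      have h7 : (Wᴴ * (C * W)) j j = star w ⬝ᵥ (C *ᵥ w) := by
        simp [hW, Matrix.mul_apply, dotProduct, Matrix.mulVec]
      rw [Matrix.smul_apply, Matrix.sub_apply, Matrix.smul_apply, h6, h7, Matrix.one_apply_eq]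
      simp
  have h2 : (compress t w D).val.charpoly =
      ((t : 𝕜) • 1 - (1 + W * Wᴴ) * C).charpoly := by
    symm
    refine charpoly_eq_of_mul_eq (isUnit_borderSqrt w) ?_
    have h3 : 1 + W * Wᴴ = borderSqrt w * borderSqrt w := by
      rw [borderSqrt_mul_self, Matrix.vecMulVec_eq (Fin 1), hW, Matrix.conjTranspose_replicateCol]
      rfl
    have h5 : ∀ S M : Matrix (Fin n) (Fin n) 𝕜,
        ((t : 𝕜) • 1 - S * S * M) * S = S * ((t : 𝕜) • 1 - S * M * S) := by
      intro S M
      simp only [sub_mul, mul_sub, smul_mul_assoc, mul_smul_comm, one_mul, mul_one, mul_assoc]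
    rw [h3]
    exact h5 _ _
  have h4 : (compress t w D).val.charpoly =
      ∏ i, (Polynomial.X - Polynomial.C ((eigs (compress t w D) i : ℝ) : 𝕜)) :=
    Matrix.IsHermitian.charpoly_eq (compress t w D).prop
  simp only [border]
  rw [Matrix.charpoly_reindex, h1, charpoly_fromBlocks_border D.val C W t hC, ← h2, h4,
    Fin.prod_univ_succ]
  simp only [Fin.cons_zero, Fin.cons_succ]
  ring

lemma prod_sub_eigs_compress {n : ℕ} (t : ℝ) (w : Fin n → 𝕜) (D : HMat 𝕜 n) :
    ∏ i, (t - eigs (compress t w D) i) = (1 + ∑ i, ‖w i‖ ^ 2) * ∏ i, (t - eigs D i) := by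
  have h1 := det_smul_one_sub (compress t w D) t
  rw [smul_one_sub_compress, Matrix.det_mul, Matrix.det_mul, det_smul_one_sub] at h1
  have h2 := det_borderSqrt_sq w
  apply RCLike.ofReal_injective (K := 𝕜)
  rw [RCLike.ofReal_mul, ← h2]
  refine Eq.trans h1.symm ?_
  ring

open scoped ComplexOrder in
lemma eigs_compress_lt_iff {n : ℕ} (t : ℝ) (w : Fin n → 𝕜) (D : HMat 𝕜 n) :
    (∀ i, eigs (compress t w D) i < t) ↔ ∀ i, eigs D i < t := by
  rw [← posDef_smul_one_sub_iff, ← posDef_smul_one_sub_iff, smul_one_sub_compress]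
  have h := IsUnit.posDef_star_right_conjugate_iff (x := (t : 𝕜) • 1 - D.val) (isUnit_borderSqrt w)
  rwa [Matrix.star_eq_conjTranspose, (borderSqrt_isHermitian w).eq] at h

end Bordering

section Secular

/-- The secular function of a bordered diagonal matrix. -/
def secular {n : ℕ} (μ c : Fin n → ℝ) (t : ℝ) : ℝ := t - ∑ i, c i / (t - μ i)

lemma hasDerivAt_secular {n : ℕ} {μ c : Fin n → ℝ} {t : ℝ} (ht : ∀ i, μ i < t) :
    HasDerivAt (secular μ c) (1 + ∑ i, c i / (t - μ i) ^ 2) t := by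
  have h1 : ∀ i ∈ Finset.univ, HasDerivAt (fun s => c i / (s - μ i)) (-(c i / (t - μ i) ^ 2)) t := by
    intro i _
    have h2 : t - μ i ≠ 0 := (sub_pos.2 (ht i)).ne'
    have h3 := (hasDerivAt_const t (c i)).div ((hasDerivAt_id t).sub_const (μ i)) h2
    refine h3.congr_deriv ?_
    simp only [id]
    ring
  have h4 := (hasDerivAt_id t).sub (HasDerivAt.fun_sum h1)
  refine h4.congr_deriv ?_
  rw [Finset.sum_neg_distrib, sub_neg_eq_add]

lemma strictMonoOn_secular {n : ℕ} {μ c : Fin n → ℝ} (hc : ∀ i, 0 < c i) :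
    StrictMonoOn (secular μ c) {t | ∀ i, μ i < t} := by
  intro s hs t _ hst
  have h : ∑ i, c i / (t - μ i) ≤ ∑ i, c i / (s - μ i) := Finset.sum_le_sum fun i _ => by
    have := sub_pos.2 (hs i)
    exact div_le_div_of_nonneg_left (hc i).le this (by linarith)
  unfold secular
  linarith

lemma image_secular {n : ℕ} {μ c : Fin n → ℝ} (hc : ∀ i, 0 < c i) :
    secular μ c '' {t | ∀ i, μ i < t} = Set.univ := by
  refine Set.eq_univ_of_forall fun a => ?_
  rcases n with _ | n
  · exact ⟨a, fun i => i.elim0, by simp [secular]⟩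
  obtain ⟨k, hk⟩ := Finite.exists_max μ
  have hpos : ∀ {t : ℝ}, μ k < t → ∀ i, 0 < t - μ i := fun ht i => by
    have := hk i
    linarith
  set u := min 1 (c k / (|μ k + 1 - a| + 1)) with hu
  have hd : 0 < |μ k + 1 - a| + 1 := by positivity
  have hu0 : 0 < u := lt_min one_pos (div_pos (hc k) hd)
  have hlow : secular μ c (μ k + u) ≤ a := by
    have h1 : c k / (μ k + u - μ k) ≤ ∑ i, c i / (μ k + u - μ i) :=
      Finset.single_le_sum (f := fun i => c i / (μ k + u - μ i))
        (fun i _ => (div_pos (hc i) (hpos (by linarith) i)).le) (Finset.mem_univ k)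
    have h2 : |μ k + 1 - a| + 1 ≤ c k / (μ k + u - μ k) := by
      rw [add_sub_cancel_left, le_div_iff₀ hu0]
      calc _ ≤ (|μ k + 1 - a| + 1) * (c k / (|μ k + 1 - a| + 1)) := by
            gcongr
            exact min_le_right _ _
        _ = c k := by field_simp
    have h3 : u ≤ 1 := min_le_left _ _
    have h4 := le_abs_self (μ k + 1 - a)
    unfold secular
    linarith
  set v := max (a + ∑ i, c i) (μ k + 1) with hv
  have hv1 : μ k + 1 ≤ v := le_max_right _ _
  have hhigh : a ≤ secular μ c v := by
    have h1 : ∑ i, c i / (v - μ i) ≤ ∑ i, c i := Finset.sum_le_sum fun i _ => by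
      have := hk i
      exact div_le_self (hc i).le (by linarith)
    have h2 : a + ∑ i, c i ≤ v := le_max_left _ _
    unfold secular
    linarith
  have huv : μ k + u ≤ v := by
    have h3 : u ≤ 1 := min_le_left _ _
    linarith
  have hcont : ContinuousOn (secular μ c) (Set.Icc (μ k + u) v) := fun t ht =>
    (hasDerivAt_secular fun i => by
      have := hpos (t := t) (by linarith [ht.1]) i
      linarith).continuousAt.continuousWithinAt
  obtain ⟨t, ht, hta⟩ := intermediate_value_Icc huv hcont ⟨hlow, hhigh⟩
  refine ⟨t, fun i => ?_, hta⟩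
  have := hpos (t := t) (by linarith [ht.1]) i
  linarith

lemma measurableSet_forall_lt {n : ℕ} (μ : Fin n → ℝ) : MeasurableSet {t : ℝ | ∀ i, μ i < t} := by
  rw [Set.ofPred_forall]
  exact MeasurableSet.iInter fun i => measurableSet_Ioi

lemma lintegral_secular {n : ℕ} {μ c : Fin n → ℝ} (hc : ∀ i, 0 < c i) (f : ℝ → ℝ≥0∞) :
    ∫⁻ a, f a = ∫⁻ t in {t : ℝ | ∀ i, μ i < t},
      ENNReal.ofReal (1 + ∑ i, c i / (t - μ i) ^ 2) * f (t - ∑ i, c i / (t - μ i)) := by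
  have h := lintegral_image_eq_lintegral_abs_deriv_mul (measurableSet_forall_lt μ)
    (fun t ht => (hasDerivAt_secular (c := c) ht).hasDerivWithinAt)
    (strictMonoOn_secular hc).injOn f
  rw [image_secular hc, Measure.restrict_univ] at h
  rw [h]
  refine setLIntegral_congr_fun (measurableSet_forall_lt μ) fun t ht => ?_
  rw [abs_of_nonneg]
  · rfl
  · have : 0 ≤ ∑ i, c i / (t - μ i) ^ 2 := Finset.sum_nonneg fun i _ => by
      have := hc i
      positivity
    linarith

end Secular

section HaarSubstitution

lemma lintegral_eq_abs_det_mul {E : Type*} [NormedAddCommGroup E] [NormedSpace ℝ E]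
    [MeasurableSpace E] [BorelSpace E] [FiniteDimensional ℝ E] (τ : Measure E) [τ.IsAddHaarMeasure]
    (L : E →ₗ[ℝ] E) (hL : LinearMap.det L ≠ 0) {g : E → ℝ≥0∞} (hg : Measurable g) :
    ∫⁻ x, g x ∂τ = ENNReal.ofReal |LinearMap.det L| * ∫⁻ x, g (L x) ∂τ := by
  have h := Measure.map_linearMap_addHaar_eq_smul_addHaar τ hL
  have hm : Measurable L := L.continuous_of_finiteDimensional.measurable
  rw [← lintegral_map hg hm, h, lintegral_smul_measure, smul_eq_mul, ← mul_assoc,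
    ← ENNReal.ofReal_mul (abs_nonneg _), ← abs_mul, mul_inv_cancel₀ hL]
  simp

variable {𝕜 : Type} [RCLike 𝕜] [MeasurableSpace 𝕜] [BorelSpace 𝕜]

lemma lintegral_mul_real {n β : ℕ} (hβ : Module.finrank ℝ 𝕜 = β) (τ : Measure (Fin n → 𝕜))
    [τ.IsAddHaarMeasure] {d : Fin n → ℝ} (hd : ∀ i, d i ≠ 0) {g : (Fin n → 𝕜) → ℝ≥0∞}
    (hg : Measurable g) :
    ∫⁻ x, g x ∂τ = ENNReal.ofReal (|∏ i, d i| ^ β) * ∫⁻ x, g (fun i => (d i : 𝕜) * x i) ∂τ := by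
  have h1 : LinearMap.det ((Matrix.toLin' (Matrix.diagonal fun i => (d i : 𝕜))).restrictScalars ℝ) =
      (∏ i, d i) ^ β := by
    rw [LinearMap.det_restrictScalars, LinearMap.det_toLin', Matrix.det_diagonal, ← hβ,
      ← Algebra.norm_algebraMap]
    congr 1
    simp
  have h2 := lintegral_eq_abs_det_mul τ
    ((Matrix.toLin' (Matrix.diagonal fun i => (d i : 𝕜))).restrictScalars ℝ)
    (by rw [h1]; exact pow_ne_zero _ (Finset.prod_ne_zero_iff.2 fun i _ => hd i)) hg
  rw [h2, h1, abs_pow]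
  congr 2
  funext x
  congr 1
  funext i
  simp [Matrix.mulVec_diagonal]

lemma ae_forall_ne_zero {n : ℕ} (τ : Measure (Fin n → 𝕜)) [τ.IsAddHaarMeasure] :
    ∀ᵐ y ∂τ, ∀ i, y i ≠ 0 := by
  rw [ae_all_iff]
  intro i
  have h := Measure.addHaar_submodule τ
    (LinearMap.ker (LinearMap.proj i : (Fin n → 𝕜) →ₗ[ℝ] 𝕜)) (by
      intro h
      have h1 : (Pi.single i 1 : Fin n → 𝕜) ∈
        LinearMap.ker (LinearMap.proj i : (Fin n → 𝕜) →ₗ[ℝ] 𝕜) := h ▸ Submodule.mem_top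
      simp at h1)
  rw [ae_iff]
  convert h using 2
  ext y
  simp

lemma lintegral_border_diagonal {n β : ℕ} (hβ : Module.finrank ℝ 𝕜 = β)
    (τ : Measure (Fin n → 𝕜)) [τ.IsAddHaarMeasure] (μ : Fin n → ℝ)
    {f : ℝ → (Fin n → 𝕜) → ℝ≥0∞} (hf : Measurable (Function.uncurry f)) :
    ∫⁻ y, (∫⁻ a, f a y) ∂τ = ∫⁻ t in {t : ℝ | ∀ i, μ i < t},
      ENNReal.ofReal (|∏ i, (t - μ i)| ^ β) * ∫⁻ w, ENNReal.ofReal (1 + ∑ i, ‖w i‖ ^ 2) *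
        f (t - ∑ i, (t - μ i) * ‖w i‖ ^ 2) (fun i => ((t - μ i : ℝ) : 𝕜) * w i) ∂τ := by
  obtain ⟨G, hG⟩ : ∃ G : (Fin n → 𝕜) → ℝ → ℝ≥0∞, ∀ y t, G y t =
      ENNReal.ofReal (1 + ∑ i, ‖y i‖ ^ 2 / (t - μ i) ^ 2) *
        f (t - ∑ i, ‖y i‖ ^ 2 / (t - μ i)) y := ⟨_, fun _ _ => rfl⟩
  have h1 : ∫⁻ y, (∫⁻ a, f a y) ∂τ = ∫⁻ y, (∫⁻ t in {t : ℝ | ∀ i, μ i < t}, G y t) ∂τ := by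
    refine lintegral_congr_ae ?_
    filter_upwards [ae_forall_ne_zero τ] with y hy
    simp only [hG]
    exact lintegral_secular (c := fun i => ‖y i‖ ^ 2)
      (fun i => pow_pos (norm_pos_iff.2 (hy i)) 2) (fun a => f a y)
  have hm : Measurable (Function.uncurry G) := by
    simp only [Function.uncurry_def, hG]
    refine Measurable.mul (by fun_prop) ?_
    exact hf.comp (Measurable.prodMk (by fun_prop) measurable_fst)
  rw [h1, lintegral_lintegral_swap hm.aemeasurable]
  refine setLIntegral_congr_fun (measurableSet_forall_lt μ) fun t ht => ?_
  have hd : ∀ i, t - μ i ≠ 0 := fun i => (sub_pos.2 (ht i)).ne'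
  have hm2 : Measurable fun y => G y t := hm.of_uncurry_right
  refine (lintegral_mul_real hβ τ hd hm2).trans ?_
  congr 1
  refine lintegral_congr fun w => ?_
  rw [hG]
  have h2 : ∀ i, ‖((t - μ i : ℝ) : 𝕜) * w i‖ ^ 2 = (t - μ i) ^ 2 * ‖w i‖ ^ 2 := fun i => by
    rw [norm_mul, RCLike.norm_ofReal, mul_pow, sq_abs]
  have h3 : ∀ i, (t - μ i) ^ 2 * ‖w i‖ ^ 2 / (t - μ i) ^ 2 = ‖w i‖ ^ 2 := fun i =>
    mul_div_cancel_left₀ _ (pow_ne_zero 2 (hd i))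
  have h4 : ∀ i, (t - μ i) ^ 2 * ‖w i‖ ^ 2 / (t - μ i) = (t - μ i) * ‖w i‖ ^ 2 := fun i => by
    rw [pow_two, mul_assoc]
    exact mul_div_cancel_left₀ _ (hd i)
  simp only [h2, h3, h4]

end HaarSubstitution

section BorderSubstitution

variable {𝕜 : Type} [RCLike 𝕜]

lemma star_mulVec_dotProduct_mulVec {n : ℕ} {U : Matrix (Fin n) (Fin n) 𝕜} (hU : Uᴴ * U = 1)
    (x y : Fin n → 𝕜) : star (U *ᵥ x) ⬝ᵥ (U *ᵥ y) = star x ⬝ᵥ y := by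
  rw [Matrix.star_mulVec, ← Matrix.dotProduct_mulVec, Matrix.mulVec_mulVec, hU, Matrix.one_mulVec]

lemma sum_norm_sq_mulVec {n : ℕ} {U : Matrix (Fin n) (Fin n) 𝕜} (hU : Uᴴ * U = 1)
    (x : Fin n → 𝕜) : ∑ i, ‖(U *ᵥ x) i‖ ^ 2 = ∑ i, ‖x i‖ ^ 2 := by
  have h := star_mulVec_dotProduct_mulVec hU x x
  rw [star_dotProduct_self, star_dotProduct_self] at h
  exact RCLike.ofReal_injective h

variable [MeasurableSpace 𝕜] [BorelSpace 𝕜]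

lemma lintegral_border {n β : ℕ} (hβ : Module.finrank ℝ 𝕜 = β)
    (τ : Measure (Fin n → 𝕜)) [τ.IsAddHaarMeasure] (D : HMat 𝕜 n)
    {f : ℝ → (Fin n → 𝕜) → ℝ≥0∞} (hf : Measurable (Function.uncurry f)) :
    ∫⁻ y, (∫⁻ a, f a y) ∂τ = ∫⁻ t in {t : ℝ | ∀ i, eigs D i < t},
      ENNReal.ofReal (|∏ i, (t - eigs D i)| ^ β) *
        ∫⁻ w, ENNReal.ofReal (1 + ∑ i, ‖w i‖ ^ 2) *
          f (t - RCLike.re (star w ⬝ᵥ (((t : 𝕜) • (1 : Matrix (Fin n) (Fin n) 𝕜) - D.val) *ᵥ w)))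
            (((t : 𝕜) • (1 : Matrix (Fin n) (Fin n) 𝕜) - D.val) *ᵥ w) ∂τ := by
  obtain ⟨U, hUU, hU⟩ := exists_unitary_smul_one_sub D
  have hUU' : Uᴴ * U = 1 := mul_eq_one_comm.1 hUU
  obtain ⟨L, hLd⟩ : ∃ L : (Fin n → 𝕜) →ₗ[ℝ] (Fin n → 𝕜), ∀ x, L x = U *ᵥ x :=
    ⟨(Matrix.toLin' U).restrictScalars ℝ, fun x => rfl⟩
  have hdet : LinearMap.det L ≠ 0 := by
    obtain ⟨L', hL'⟩ : ∃ L : (Fin n → 𝕜) →ₗ[ℝ] (Fin n → 𝕜), ∀ x, L x = Uᴴ *ᵥ x :=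
      ⟨(Matrix.toLin' Uᴴ).restrictScalars ℝ, fun x => rfl⟩
    have h1 : L ∘ₗ L' = LinearMap.id := by
      refine LinearMap.ext fun x => ?_
      rw [LinearMap.comp_apply, hLd, hL', Matrix.mulVec_mulVec, hUU, Matrix.one_mulVec]
      rfl
    have h2 := congrArg LinearMap.det h1
    rw [LinearMap.det_comp, LinearMap.det_id] at h2
    exact left_ne_zero_of_mul_eq_one h2
  have hLm : Measurable L := L.continuous_of_finiteDimensional.measurable
  have hg : Measurable fun y => ∫⁻ a, f a y := hf.lintegral_prod_left'
  have hfL : Measurable (Function.uncurry fun a y => f a (L y)) :=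
    hf.comp (measurable_fst.prodMk (hLm.comp measurable_snd))
  rw [lintegral_eq_abs_det_mul τ L hdet hg, lintegral_border_diagonal hβ τ (eigs D) hfL,
    ← lintegral_const_mul' _ _ ENNReal.ofReal_ne_top]
  refine lintegral_congr fun t => ?_
  rw [mul_left_comm]
  congr 1
  have hC : Continuous fun w : Fin n → 𝕜 =>
      ((t : 𝕜) • (1 : Matrix (Fin n) (Fin n) 𝕜) - D.val) *ᵥ w :=
    Continuous.matrix_mulVec continuous_const continuous_id
  have hm : Measurable fun w : Fin n → 𝕜 => ENNReal.ofReal (1 + ∑ i, ‖w i‖ ^ 2) *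
      f (t - RCLike.re (star w ⬝ᵥ (((t : 𝕜) • (1 : Matrix (Fin n) (Fin n) 𝕜) - D.val) *ᵥ w)))
        (((t : 𝕜) • (1 : Matrix (Fin n) (Fin n) 𝕜) - D.val) *ᵥ w) := by
    refine Measurable.mul (by fun_prop) ?_
    have h2 : Continuous fun w : Fin n → 𝕜 => t - RCLike.re (star w ⬝ᵥ
        (((t : 𝕜) • (1 : Matrix (Fin n) (Fin n) 𝕜) - D.val) *ᵥ w)) :=
      continuous_const.sub (RCLike.continuous_re.comp (Continuous.dotProduct continuous_star hC))
    exact hf.comp (h2.measurable.prodMk hC.measurable)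
  rw [lintegral_eq_abs_det_mul τ L hdet hm]
  congr 1
  refine lintegral_congr fun w => ?_
  have h3 : ((t : 𝕜) • (1 : Matrix (Fin n) (Fin n) 𝕜) - D.val) *ᵥ L w =
      L fun i => ((t - eigs D i : ℝ) : 𝕜) * w i := by
    rw [hLd, hLd, Matrix.mulVec_mulVec, hU, mul_assoc, hUU', mul_one, ← Matrix.mulVec_mulVec]
    congr 1
    funext i
    rw [Matrix.mulVec_diagonal]
  have h4 : RCLike.re (star (L w) ⬝ᵥ L fun i => ((t - eigs D i : ℝ) : 𝕜) * w i) =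
      ∑ i, (t - eigs D i) * ‖w i‖ ^ 2 := by
    rw [hLd, hLd, star_mulVec_dotProduct_mulVec hUU']
    apply RCLike.ofReal_injective (K := 𝕜)
    have h5 : star w ⬝ᵥ (fun i => ((t - eigs D i : ℝ) : 𝕜) * w i) =
        ((∑ i, (t - eigs D i) * ‖w i‖ ^ 2 : ℝ) : 𝕜) := by
      simp only [dotProduct, Pi.star_apply, RCLike.star_def]
      rw [RCLike.ofReal_sum]
      refine Finset.sum_congr rfl fun i _ => ?_
      rw [mul_left_comm, RCLike.conj_mul]
      push_cast
      rfl
    rw [h5, RCLike.ofReal_re]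
  rw [h3, h4, hLd w, sum_norm_sq_mulVec hUU']

end BorderSubstitution

section CompressSubstitution

variable {E : Type*} [AddCommGroup E] [TopologicalSpace E] [IsTopologicalAddGroup E] [T2Space E]
  [Module ℝ E] [ContinuousSMul ℝ E] [FiniteDimensional ℝ E]

lemma continuous_det_family {W : Type*} [TopologicalSpace W] {L : W → E →ₗ[ℝ] E}
    (hL : ∀ x, Continuous fun w => L w x) : Continuous fun w => LinearMap.det (L w) := by
  have h : (fun w => LinearMap.det (L w)) = fun w =>
      (LinearMap.toMatrix (Module.finBasis ℝ E) (Module.finBasis ℝ E) (L w)).det := by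
    funext w
    rw [LinearMap.det_toMatrix]
  rw [h]
  refine Continuous.matrix_det (continuous_matrix fun i j => ?_)
  simp only [LinearMap.toMatrix_apply]
  exact ((Module.finBasis ℝ E).coord i).continuous_of_finiteDimensional.comp (hL _)

lemma lintegral_eq_abs_det_mul_of_tvs [MeasurableSpace E] [BorelSpace E] (τ : Measure E)
    [τ.IsAddHaarMeasure] (L : E →ₗ[ℝ] E) (hL : LinearMap.det L ≠ 0) {g : E → ℝ≥0∞}
    (hg : Measurable g) :
    ∫⁻ x, g x ∂τ = ENNReal.ofReal |LinearMap.det L| * ∫⁻ x, g (L x) ∂τ := by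
  obtain ⟨e, he⟩ : ∃ e : E ≃L[ℝ] EuclideanSpace ℝ (Fin (Module.finrank ℝ E)), e = toEuclidean :=
    ⟨_, rfl⟩
  have hem : Measurable e := e.continuous.measurable
  have hes : Measurable e.symm := e.symm.continuous.measurable
  have hH : (Measure.map e τ).IsAddHaarMeasure := e.isAddHaarMeasure_map τ
  have hdet := LinearMap.det_conj L e.toLinearEquiv
  have hLm : Measurable L := L.continuous_of_finiteDimensional.measurable
  have h := lintegral_eq_abs_det_mul (Measure.map e τ)
    (e.toLinearEquiv.toLinearMap ∘ₗ L ∘ₗ e.toLinearEquiv.symm.toLinearMap) (by rwa [hdet])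
    (hg.comp hes)
  rw [hdet, lintegral_map (hg.comp hes) hem, lintegral_map _ hem] at h
  · simpa using h
  · exact (hg.comp hes).comp (hem.comp (hLm.comp hes))

variable {𝕜 : Type} [RCLike 𝕜]

instance continuousSMul_hMat (n : ℕ) : ContinuousSMul ℝ (HMat 𝕜 n) where
  continuous_smul := Continuous.subtype_mk
    (continuous_fst.smul (continuous_subtype_val.comp continuous_snd)) _

instance secondCountable_hMat (n : ℕ) : SecondCountableTopology (HMat 𝕜 n) :=
  inferInstanceAs (SecondCountableTopology
    {A : Fin n → Fin n → 𝕜 // A ∈ (HMat 𝕜 n : Set (Matrix (Fin n) (Fin n) 𝕜))})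

instance locallyCompact_hMat (n : ℕ) : LocallyCompactSpace (HMat 𝕜 n) :=
  (toEuclidean : HMat 𝕜 n ≃L[ℝ] _).toHomeomorph.isClosedEmbedding.locallyCompactSpace

lemma continuous_borderSqrt (n : ℕ) : Continuous (borderSqrt : (Fin n → 𝕜) → _) := by
  unfold borderSqrt borderScalar
  refine continuous_const.add (Continuous.fun_smul ?_ ?_)
  · refine RCLike.continuous_ofReal.comp (continuous_const.div (by fun_prop) fun w => ?_)
    positivity
  · exact Continuous.matrix_vecMulVec continuous_id continuous_star

lemma continuous_compress (n : ℕ) : Continuous fun z : (ℝ × (Fin n → 𝕜)) × HMat 𝕜 n =>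
    compress z.1.1 z.1.2 z.2 := by
  refine Continuous.subtype_mk ?_ _
  have h1 : Continuous fun z : (ℝ × (Fin n → 𝕜)) × HMat 𝕜 n =>
      ((z.1.1 : ℝ) : 𝕜) • (1 : Matrix (Fin n) (Fin n) 𝕜) :=
    (RCLike.continuous_ofReal.comp (continuous_fst.comp continuous_fst)).fun_smul continuous_const
  have h2 : Continuous fun z : (ℝ × (Fin n → 𝕜)) × HMat 𝕜 n => borderSqrt z.1.2 :=
    (continuous_borderSqrt n).comp (continuous_snd.comp continuous_fst)
  exact h1.sub ((h2.matrix_mul (h1.sub (continuous_subtype_val.comp continuous_snd))).matrix_mul h2)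

/-- The map `D ↦ S D S`, where `S` is the square root of `1 + w w*`. -/
def borderConj {n : ℕ} (w : Fin n → 𝕜) : HMat 𝕜 n →ₗ[ℝ] HMat 𝕜 n where
  toFun D := ⟨borderSqrt w * D.val * borderSqrt w, by
    have h := Matrix.isHermitian_mul_mul_conjTranspose (borderSqrt w)
      (show D.val.IsHermitian from D.prop)
    rwa [(borderSqrt_isHermitian w).eq] at h⟩
  map_add' D D' := Subtype.ext (by simp [mul_add, add_mul])
  map_smul' r D := Subtype.ext (by simp)

lemma compress_eq {n : ℕ} (t : ℝ) (w : Fin n → 𝕜) (D : HMat 𝕜 n) :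
    compress t w D = borderConj w D + compress t w 0 := by
  refine Subtype.ext ?_
  simp only [compress, borderConj, LinearMap.coe_mk, AddHom.coe_mk, AddSubgroup.coe_add]
  simp only [mul_sub, sub_mul, ZeroMemClass.coe_zero, sub_zero]
  abel

lemma det_borderConj_ne_zero {n : ℕ} (w : Fin n → 𝕜) : LinearMap.det (borderConj w) ≠ 0 := by
  have hi : Function.Injective (borderConj w) := by
    intro D D' h
    have h1 : borderSqrt w * D.val * borderSqrt w = borderSqrt w * D'.val * borderSqrt w :=
      congrArg Subtype.val h
    exact Subtype.ext ((isUnit_borderSqrt w).mul_left_cancel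
      ((isUnit_borderSqrt w).mul_right_cancel h1))
  have h2 := LinearEquiv.isUnit_det' (LinearEquiv.ofInjectiveEndo _ hi)
  exact h2.ne_zero

lemma continuous_det_borderConj (n : ℕ) :
    Continuous fun w : Fin n → 𝕜 => LinearMap.det (borderConj w) := by
  refine continuous_det_family fun D => ?_
  refine Continuous.subtype_mk ?_ _
  exact ((continuous_borderSqrt n).matrix_mul continuous_const).matrix_mul (continuous_borderSqrt n)

variable [MeasurableSpace 𝕜] [BorelSpace 𝕜]

lemma lintegral_compress {n : ℕ} (ν : Measure (HMat 𝕜 n)) [ν.IsAddHaarMeasure] (t : ℝ)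
    (w : Fin n → 𝕜) {g : HMat 𝕜 n → ℝ≥0∞} (hg : Measurable g) :
    ∫⁻ D, g (compress t w D) ∂ν =
      ENNReal.ofReal |(LinearMap.det (borderConj w))⁻¹| * ∫⁻ B, g B ∂ν := by
  have h1 := lintegral_eq_abs_det_mul_of_tvs ν (borderConj w) (det_borderConj_ne_zero w)
    (g := fun B => g (B + compress t w 0)) (hg.comp (measurable_id.add_const _))
  rw [lintegral_add_right_eq_self (fun B => g B)] at h1
  rw [h1, ← mul_assoc, ← ENNReal.ofReal_mul (abs_nonneg _), ← abs_mul,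
    inv_mul_cancel₀ (det_borderConj_ne_zero w)]
  simp [← compress_eq]

end CompressSubstitution

section BorderEquiv

variable {𝕜 : Type} [RCLike 𝕜]

lemma border_apply {n : ℕ} (a : ℝ) (b : Fin n → 𝕜) (D : HMat 𝕜 n) (x y : Fin n ⊕ Fin 1) :
    (border a b D).val (finSumFinEquiv x) (finSumFinEquiv y) =
      Matrix.fromBlocks D.val (Matrix.replicateCol (Fin 1) b)
        (Matrix.replicateRow (Fin 1) (star b)) ((a : 𝕜) • 1) x y := by
  simp only [border, Matrix.reindex_apply, Matrix.submatrix_apply, Equiv.symm_apply_apply]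

lemma hMat_ext_sum {n : ℕ} {A B : HMat 𝕜 (n + 1)} (h : ∀ x y : Fin n ⊕ Fin 1,
    A.val (finSumFinEquiv x) (finSumFinEquiv y) = B.val (finSumFinEquiv x) (finSumFinEquiv y)) :
    A = B := by
  refine Subtype.ext (Matrix.ext fun i j => ?_)
  obtain ⟨x, rfl⟩ := finSumFinEquiv.surjective i
  obtain ⟨y, rfl⟩ := finSumFinEquiv.surjective j
  exact h x y

/-- Bordering as a linear map. -/
def borderLinear (n : ℕ) :
    (HMat 𝕜 n × (Fin n → 𝕜) × ℝ) →ₗ[ℝ] HMat 𝕜 (n + 1) where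
  toFun z := border z.2.2 z.2.1 z.1
  map_add' z z' := by
    refine hMat_ext_sum fun x y => ?_
    rw [AddSubgroup.coe_add, Matrix.add_apply, border_apply, border_apply, border_apply]
    rcases x with x | x <;> rcases y with y | y <;> simp [RCLike.real_smul_eq_coe_mul, add_mul]
  map_smul' r z := by
    refine hMat_ext_sum fun x y => ?_
    rw [RingHom.id_apply, selfAdjoint.val_smul, Matrix.smul_apply, border_apply, border_apply]
    rcases x with x | x <;> rcases y with y | y <;> simp [RCLike.real_smul_eq_coe_mul, mul_assoc]

lemma injective_borderLinear (n : ℕ) : Function.Injective (borderLinear (𝕜 := 𝕜) n) := by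
  intro z z' h
  have h1 : ∀ x y, (border z.2.2 z.2.1 z.1).val (finSumFinEquiv x) (finSumFinEquiv y) =
      (border z'.2.2 z'.2.1 z'.1).val (finSumFinEquiv x) (finSumFinEquiv y) := fun x y =>
    congrArg (fun A : HMat 𝕜 (n + 1) => A.val (finSumFinEquiv x) (finSumFinEquiv y)) h
  simp only [border_apply] at h1
  refine Prod.ext ?_ (Prod.ext ?_ ?_)
  · refine Subtype.ext (Matrix.ext fun i j => ?_)
    simpa using h1 (Sum.inl i) (Sum.inl j)
  · funext i
    simpa using h1 (Sum.inl i) (Sum.inr 0)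
  · simpa using h1 (Sum.inr 0) (Sum.inr 0)

lemma surjective_borderLinear (n : ℕ) : Function.Surjective (borderLinear (𝕜 := 𝕜) n) := by
  intro A
  have hA : ∀ i j, star (A.val j i) = A.val i j := fun i j => congrFun (congrFun A.prop i) j
  refine ⟨(⟨A.val.submatrix (fun i => finSumFinEquiv (Sum.inl i))
    (fun i => finSumFinEquiv (Sum.inl i)), ?_⟩,
    fun i => A.val (finSumFinEquiv (Sum.inl i)) (finSumFinEquiv (Sum.inr 0)),
    RCLike.re (A.val (finSumFinEquiv (Sum.inr 0)) (finSumFinEquiv (Sum.inr 0)))), ?_⟩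
  · exact Matrix.IsHermitian.submatrix A.prop _
  · refine hMat_ext_sum fun x y => ?_
    refine (border_apply _ _ _ x y).trans ?_
    rcases x with x | x <;> rcases y with y | y
    · simp
    · rw [Subsingleton.elim y 0]
      simp
    · rw [Subsingleton.elim x 0]
      simp only [Matrix.fromBlocks_apply₂₁, Matrix.replicateRow_apply, Pi.star_apply, hA]
    · rw [Subsingleton.elim x 0, Subsingleton.elim y 0]
      simp only [Matrix.fromBlocks_apply₂₂, Matrix.smul_apply, Matrix.one_apply_eq, smul_eq_mul,
        mul_one]
      exact RCLike.conj_eq_iff_re.1 (hA _ _)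

lemma continuous_borderLinear (n : ℕ) : Continuous (borderLinear (𝕜 := 𝕜) n) :=
  LinearMap.continuous_of_finiteDimensional _

variable [MeasurableSpace 𝕜] [BorelSpace 𝕜]

lemma exists_lintegral_eq_border (n : ℕ) (ν : Measure (HMat 𝕜 n)) [ν.IsAddHaarMeasure]
    (τ : Measure (Fin n → 𝕜)) [τ.IsAddHaarMeasure] (μ : Measure (HMat 𝕜 (n + 1)))
    [μ.IsAddHaarMeasure] : ∃ c : ℝ≥0∞, ∀ G : HMat 𝕜 (n + 1) → ℝ≥0∞, Measurable G →
      ∫⁻ A, G A ∂μ = c * ∫⁻ D, (∫⁻ b, (∫⁻ a, G (border a b D)) ∂τ) ∂ν := by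
  obtain ⟨e, he⟩ : ∃ e : (HMat 𝕜 n × (Fin n → 𝕜) × ℝ) ≃L[ℝ] HMat 𝕜 (n + 1),
      ∀ z, e z = borderLinear (𝕜 := 𝕜) n z :=
    ⟨(LinearEquiv.ofBijective (borderLinear (𝕜 := 𝕜) n)
      ⟨injective_borderLinear n, surjective_borderLinear n⟩).toContinuousLinearEquiv, fun z => rfl⟩
  have hτ : (τ.prod (volume : Measure ℝ)).IsAddHaarMeasure :=
    Measure.prod.instIsAddHaarMeasure τ volume
  have hP : (ν.prod (τ.prod (volume : Measure ℝ))).IsAddHaarMeasure :=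
    Measure.prod.instIsAddHaarMeasure ν (τ.prod volume)
  have hH : (Measure.map e (ν.prod (τ.prod volume))).IsAddHaarMeasure :=
    e.isAddHaarMeasure_map (ν.prod (τ.prod volume))
  refine ⟨μ.addHaarScalarFactor (Measure.map e (ν.prod (τ.prod volume))), fun G hG => ?_⟩
  have hem : Measurable e := e.continuous.measurable
  have hGe : Measurable fun z => G (e z) := hG.comp hem
  conv_lhs => rw [Measure.isAddLeftInvariant_eq_smul μ (Measure.map e (ν.prod (τ.prod volume)))]
  rw [lintegral_smul_measure, lintegral_map hG hem, lintegral_prod _ hGe.aemeasurable]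
  rw [ENNReal.smul_def, smul_eq_mul]
  congr 1
  refine lintegral_congr fun D => ?_
  have hGD : Measurable fun y => G (e (D, y)) := hGe.comp measurable_prodMk_left
  rw [lintegral_prod _ hGD.aemeasurable]
  simp only [he]
  rfl

end BorderEquiv

section WeylStep

variable {𝕜 : Type} [RCLike 𝕜]

/-- A function of `x` that only depends on the multiset of the coordinates of `x`. -/
def SymmFun {n : ℕ} {α : Type*} (F : (Fin n → ℝ) → α) : Prop :=
  ∀ x y : Fin n → ℝ, Finset.univ.val.map x = Finset.univ.val.map y → F x = F y

/-- The weight of `y` given that `t` is the largest eigenvalue. -/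
def topWeight {n : ℕ} (β : ℕ) (F : (Fin (n + 1) → ℝ) → ℝ≥0∞) (t : ℝ) (y : Fin n → ℝ) : ℝ≥0∞ :=
  open scoped Classical in
  if ∀ i, y i < t then ENNReal.ofReal (|∏ i, (t - y i)| ^ β) * F (Fin.cons t y) else 0

lemma measurable_topWeight {n : ℕ} (β : ℕ) {F : (Fin (n + 1) → ℝ) → ℝ≥0∞} (hF : Measurable F) :
    Measurable fun z : ℝ × (Fin n → ℝ) => topWeight β F z.1 z.2 := by
  unfold topWeight
  refine Measurable.ite ?_ (Measurable.mul (by fun_prop) (hF.comp (measurable_finCons n)))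
    measurable_const
  rw [Set.ofPred_forall]
  refine MeasurableSet.iInter fun i => measurableSet_lt (by fun_prop) (by fun_prop)

lemma map_cons_univ {n : ℕ} (t : ℝ) (y : Fin n → ℝ) :
    Finset.univ.val.map (Fin.cons t y : Fin (n + 1) → ℝ) = t ::ₘ Finset.univ.val.map y := by
  rw [Fin.univ_val_map, Fin.univ_val_map, List.ofFn_cons]
  rfl

lemma symmFun_topWeight {n : ℕ} (β : ℕ) {F : (Fin (n + 1) → ℝ) → ℝ≥0∞} (hF : SymmFun F) (t : ℝ) :
    SymmFun (topWeight β F t) := by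
  intro x y h
  have h1 : (∀ i, x i < t) ↔ ∀ i, y i < t := by
    have h2 : ∀ z : Fin n → ℝ, (∀ i, z i < t) ↔ ∀ s ∈ Finset.univ.val.map z, s < t := by
      intro z
      simp
    rw [h2, h2, h]
  have h3 : ∏ i, (t - x i) = ∏ i, (t - y i) := by
    have h4 : ∀ z : Fin n → ℝ, ∏ i, (t - z i) = ((Finset.univ.val.map z).map fun s => t - s).prod := by
      intro z
      rw [Multiset.map_map]
      rfl
    rw [h4, h4, h]
  have h5 : F (Fin.cons t x) = F (Fin.cons t y) := hF _ _ (by rw [map_cons_univ, map_cons_univ, h])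
  unfold topWeight
  simp only [h1, h3, h5]

/-- The density of `w` in the bordering change of variables. -/
def borderDensity {n : ℕ} (β : ℕ) (w : Fin n → 𝕜) : ℝ≥0∞ :=
  ENNReal.ofReal ((1 + ∑ i, ‖w i‖ ^ 2) * (1 / (1 + ∑ i, ‖w i‖ ^ 2)) ^ β)

lemma mul_eq_borderDensity_mul {n : ℕ} (β : ℕ) {F : (Fin (n + 1) → ℝ) → ℝ≥0∞} (hF : SymmFun F)
    (t : ℝ) (w : Fin n → 𝕜) (D : HMat 𝕜 n) (h : ∀ i, eigs D i < t) :
    ENNReal.ofReal (|∏ i, (t - eigs D i)| ^ β) * (ENNReal.ofReal (1 + ∑ i, ‖w i‖ ^ 2) *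
      F (eigs (border
        (t - RCLike.re (star w ⬝ᵥ (((t : 𝕜) • (1 : Matrix (Fin n) (Fin n) 𝕜) - D.val) *ᵥ w)))
        (((t : 𝕜) • (1 : Matrix (Fin n) (Fin n) 𝕜) - D.val) *ᵥ w) D))) =
      borderDensity β w * topWeight β F t (eigs (compress t w D)) := by
  rw [topWeight, if_pos ((eigs_compress_lt_iff t w D).2 h), hF _ _ (map_eigs_border t w D),
    prod_sub_eigs_compress, borderDensity, ← mul_assoc, ← mul_assoc]
  have hs : 0 ≤ ∑ i, ‖w i‖ ^ 2 := Finset.sum_nonneg fun i _ => by positivity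
  obtain ⟨s, hs'⟩ : ∃ s, s = ∑ i, ‖w i‖ ^ 2 := ⟨_, rfl⟩
  rw [← hs'] at hs ⊢
  rw [← ENNReal.ofReal_mul (by positivity), ← ENNReal.ofReal_mul (by positivity)]
  congr 2
  rw [abs_mul, abs_of_pos (by linarith : 0 < 1 + s), mul_pow, mul_assoc, ← mul_assoc ((1 / _) ^ β),
    ← mul_pow, one_div_mul_cancel (by linarith), one_pow, one_mul, mul_comm]

variable [MeasurableSpace 𝕜] [BorelSpace 𝕜]

lemma lintegral_border_eigs {n β : ℕ} (hβ : Module.finrank ℝ 𝕜 = β)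
    (τ : Measure (Fin n → 𝕜)) [τ.IsAddHaarMeasure] {F : (Fin (n + 1) → ℝ) → ℝ≥0∞}
    (hF : Measurable F) (hFs : SymmFun F) (D : HMat 𝕜 n) :
    ∫⁻ b, (∫⁻ a, F (eigs (border a b D))) ∂τ =
      ∫⁻ t, (∫⁻ w, borderDensity β w * topWeight β F t (eigs (compress t w D)) ∂τ) := by
  have hm : Measurable (Function.uncurry fun (a : ℝ) (b : Fin n → 𝕜) => F (eigs (border a b D))) :=
    hF.comp ((measurable_eigs (n + 1)).comp ((continuous_borderLinear n).measurable.comp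
      (measurable_const.prodMk measurable_swap)))
  rw [lintegral_border hβ τ D hm, ← lintegral_indicator (measurableSet_forall_lt _)]
  refine lintegral_congr fun t => ?_
  by_cases h : ∀ i, eigs D i < t
  · rw [Set.indicator_of_mem (show t ∈ {t : ℝ | ∀ i, eigs D i < t} from h),
      ← lintegral_const_mul' _ _ ENNReal.ofReal_ne_top]
    exact lintegral_congr fun w => mul_eq_borderDensity_mul β hFs t w D h
  · rw [Set.indicator_of_notMem (show t ∉ {t : ℝ | ∀ i, eigs D i < t} from h)]
    symm
    refine (lintegral_congr fun w => ?_).trans lintegral_zero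
    rw [topWeight, if_neg (fun h' => h ((eigs_compress_lt_iff t w D).1 h')), mul_zero]

lemma measurable_borderDensity (n β : ℕ) : Measurable (borderDensity β : (Fin n → 𝕜) → ℝ≥0∞) := by
  unfold borderDensity
  fun_prop

lemma exists_lintegral_border_eigs {n β : ℕ} (hβ : Module.finrank ℝ 𝕜 = β)
    (τ : Measure (Fin n → 𝕜)) [τ.IsAddHaarMeasure] (ν : Measure (HMat 𝕜 n))
    [ν.IsAddHaarMeasure] : ∃ c : ℝ≥0∞, ∀ F : (Fin (n + 1) → ℝ) → ℝ≥0∞, Measurable F → SymmFun F →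
      ∫⁻ D, (∫⁻ b, (∫⁻ a, F (eigs (border a b D))) ∂τ) ∂ν =
        c * ∫⁻ t, (∫⁻ B, topWeight β F t (eigs B) ∂ν) := by
  refine ⟨∫⁻ w, borderDensity β w *
    ENNReal.ofReal |(LinearMap.det (borderConj (𝕜 := 𝕜) (n := n) w))⁻¹| ∂τ, fun F hF hFs => ?_⟩
  obtain ⟨W, hW⟩ : ∃ W : HMat 𝕜 n → ℝ → (Fin n → 𝕜) → ℝ≥0∞, ∀ D t w,
      W D t w = borderDensity β w * topWeight β F t (eigs (compress t w D)) :=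
    ⟨_, fun _ _ _ => rfl⟩
  have hWm : Measurable fun z : (HMat 𝕜 n × ℝ) × (Fin n → 𝕜) => W z.1.1 z.1.2 z.2 := by
    simp only [hW]
    refine ((measurable_borderDensity n β).comp measurable_snd).mul ?_
    have h1 : Measurable fun z : (HMat 𝕜 n × ℝ) × (Fin n → 𝕜) => compress z.1.2 z.2 z.1.1 :=
      (continuous_compress n).measurable.comp
        (g := fun z : (ℝ × (Fin n → 𝕜)) × HMat 𝕜 n => compress z.1.1 z.1.2 z.2)
        (((measurable_snd.comp measurable_fst).prodMk measurable_snd).prodMk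
          (measurable_fst.comp measurable_fst))
    exact (measurable_topWeight β hF).comp ((measurable_snd.comp measurable_fst).prodMk
      ((measurable_eigs n).comp h1))
  have hH : Measurable fun t => ∫⁻ B, topWeight β F t (eigs B) ∂ν := by
    have h2 : Measurable fun z : ℝ × HMat 𝕜 n => topWeight β F z.1 (eigs z.2) :=
      (measurable_topWeight β hF).comp (measurable_fst.prodMk
        ((measurable_eigs n).comp measurable_snd))
    exact h2.lintegral_prod_right'
  have hκ : Measurable fun w : Fin n → 𝕜 => borderDensity β w *
      ENNReal.ofReal |(LinearMap.det (borderConj w))⁻¹| :=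
    (measurable_borderDensity n β).mul
      (continuous_det_borderConj n).measurable.inv.abs.ennreal_ofReal
  have h3 : ∀ t, ∫⁻ D, (∫⁻ w, W D t w ∂τ) ∂ν = (∫⁻ w, borderDensity β w *
      ENNReal.ofReal |(LinearMap.det (borderConj (𝕜 := 𝕜) (n := n) w))⁻¹| ∂τ) *
        ∫⁻ B, topWeight β F t (eigs B) ∂ν := by
    intro t
    have hWt : Measurable (Function.uncurry fun (D : HMat 𝕜 n) (w : Fin n → 𝕜) => W D t w) :=
      hWm.comp (g := fun z : (HMat 𝕜 n × ℝ) × (Fin n → 𝕜) => W z.1.1 z.1.2 z.2)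
        ((measurable_fst.prodMk measurable_const).prodMk measurable_snd)
    rw [lintegral_lintegral_swap hWt.aemeasurable, ← lintegral_mul_const _ hκ]
    refine lintegral_congr fun w => ?_
    simp only [hW]
    have hg : Measurable fun B : HMat 𝕜 n => topWeight β F t (eigs B) :=
      (measurable_topWeight β hF).comp (measurable_const.prodMk (measurable_eigs n))
    have hb : borderDensity β w ≠ ⊤ := ENNReal.ofReal_ne_top
    rw [lintegral_const_mul' _ _ hb, mul_assoc]
    congr 1
    exact lintegral_compress ν t w hg
  have hWD : Measurable (Function.uncurry fun (D : HMat 𝕜 n) (t : ℝ) => ∫⁻ w, W D t w ∂τ) :=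
    hWm.lintegral_prod_right'
  rw [← lintegral_const_mul _ hH]
  simp only [← h3]
  rw [← lintegral_lintegral_swap hWD.aemeasurable]
  refine lintegral_congr fun D => ?_
  rw [lintegral_border_eigs hβ τ hF hFs D]
  simp only [hW]

end WeylStep

section Weyl

lemma strictAnti_cons_iff {n : ℕ} (t : ℝ) (y : Fin n → ℝ) :
    StrictAnti (Fin.cons t y : Fin (n + 1) → ℝ) ↔ (∀ i, y i < t) ∧ StrictAnti y := by
  constructor
  · intro h
    refine ⟨fun i => ?_, fun i j hij => ?_⟩
    · simpa using h (Fin.succ_pos i)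
    · simpa using h (Fin.succ_lt_succ_iff.2 hij)
  · rintro ⟨h1, h2⟩ i j hij
    induction j using Fin.cases with
    | zero => exact absurd hij (Fin.not_lt_zero i)
    | succ j =>
      induction i using Fin.cases with
      | zero => simpa using h1 j
      | succ i => simpa using h2 (Fin.succ_lt_succ_iff.1 hij)

lemma vdm_cons {n : ℕ} (β : ℕ) (t : ℝ) (y : Fin n → ℝ) :
    vdm β (Fin.cons t y : Fin (n + 1) → ℝ) = |∏ i, (t - y i)| ^ β * vdm β y := by
  unfold vdm
  rw [Fin.prod_univ_succ, Fin.prod_Ioi_zero, Finset.abs_prod, ← Finset.prod_pow]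
  simp only [Fin.prod_Ioi_succ, Fin.cons_zero, Fin.cons_succ]

lemma measurableSet_strictAnti (n : ℕ) : MeasurableSet {x : Fin n → ℝ | StrictAnti x} := by
  have h : {x : Fin n → ℝ | StrictAnti x} = ⋂ i, ⋂ j, {x | i < j → x j < x i} := by
    ext x
    simp [StrictAnti]
  rw [h]
  refine MeasurableSet.iInter fun i => MeasurableSet.iInter fun j => ?_
  by_cases hij : i < j
  · simp only [hij, true_imp_iff]
    exact measurableSet_lt (measurable_pi_apply j) (measurable_pi_apply i)
  · simp [hij]

lemma lintegral_topWeight {n : ℕ} (β : ℕ) {F : (Fin (n + 1) → ℝ) → ℝ≥0∞} (hF : Measurable F) :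
    ∫⁻ t, (∫⁻ y in {y : Fin n → ℝ | StrictAnti y},
      topWeight β F t y * ENNReal.ofReal (vdm β y)) =
    ∫⁻ x in {x : Fin (n + 1) → ℝ | StrictAnti x}, F x * ENNReal.ofReal (vdm β x) := by
  have hm : Measurable ({x : Fin (n + 1) → ℝ | StrictAnti x}.indicator fun x =>
      F x * ENNReal.ofReal (vdm β x)) :=
    (hF.mul (continuous_vdm β _).measurable.ennreal_ofReal).indicator (measurableSet_strictAnti _)
  have h0 := lintegral_pi_succ (volume : Measure ℝ) hm
  simp only [← volume_pi] at h0
  rw [← lintegral_indicator (measurableSet_strictAnti _), h0]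
  refine lintegral_congr fun t => ?_
  rw [← lintegral_indicator (measurableSet_strictAnti _)]
  refine lintegral_congr fun y => ?_
  simp only [Set.indicator_apply, Set.mem_ofPred_eq, strictAnti_cons_iff]
  by_cases h2 : StrictAnti y
  · by_cases h1 : ∀ i, y i < t
    · rw [if_pos h2, if_pos ⟨h1, h2⟩, topWeight, if_pos h1, vdm_cons,
        ENNReal.ofReal_mul (by positivity)]
      ring
    · rw [if_pos h2, if_neg fun h => h1 h.1, topWeight, if_neg h1, zero_mul]
  · rw [if_neg h2, if_neg fun h => h2 h.2]

variable {𝕜 : Type} [RCLike 𝕜] [MeasurableSpace 𝕜] [BorelSpace 𝕜]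

/-- Weyl integration formula, up to the value of the normalizing constant. -/
lemma exists_lintegral_eigs {β : ℕ} (hβ : Module.finrank ℝ 𝕜 = β) (n : ℕ) :
    ∀ (μ : Measure (HMat 𝕜 n)) [μ.IsAddHaarMeasure], ∃ c : ℝ≥0∞,
      ∀ F : (Fin n → ℝ) → ℝ≥0∞, Measurable F → SymmFun F →
        ∫⁻ A, F (eigs A) ∂μ =
          c * ∫⁻ x in {x : Fin n → ℝ | StrictAnti x}, F x * ENNReal.ofReal (vdm β x) := by
  induction n with
  | zero =>
    intro μ _
    refine ⟨μ Set.univ, fun F _ _ => ?_⟩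
    have h1 : ∀ x : Fin 0 → ℝ, F x = F 0 := fun x => by rw [Subsingleton.elim x 0]
    have h2 : {x : Fin 0 → ℝ | StrictAnti x} = Set.univ :=
      Set.eq_univ_of_forall fun x i => i.elim0
    have h3 : ∀ x : Fin 0 → ℝ, vdm β x = 1 := fun x => by simp [vdm]
    simp only [h1, h2, h3, ENNReal.ofReal_one, mul_one, lintegral_const, Measure.restrict_univ]
    have h4 : (volume : Measure (Fin 0 → ℝ)) Set.univ = 1 := by
      rw [volume_pi, Measure.pi_of_empty]
      simp
    rw [h4, mul_one, mul_comm]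
  | succ n ih =>
    intro μ _
    obtain ⟨ν, hν⟩ : ∃ ν : Measure (HMat 𝕜 n), ν.IsAddHaarMeasure :=
      ⟨Measure.addHaar, inferInstance⟩
    obtain ⟨τ, hτ⟩ : ∃ τ : Measure (Fin n → 𝕜), τ.IsAddHaarMeasure :=
      ⟨Measure.addHaar, inferInstance⟩
    obtain ⟨c₁, h1⟩ := exists_lintegral_eq_border n ν τ μ
    obtain ⟨c₂, h2⟩ := exists_lintegral_border_eigs hβ τ ν
    obtain ⟨c₃, h3⟩ := ih ν
    refine ⟨c₁ * c₂ * c₃, fun F hF hFs => ?_⟩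
    have h1' := h1 (fun A => F (eigs A)) (hF.comp (measurable_eigs _))
    rw [h1', h2 F hF hFs, mul_assoc, mul_assoc]
    congr 2
    have h4 : ∀ t, ∫⁻ B, topWeight β F t (eigs B) ∂ν = c₃ *
        ∫⁻ y in {y : Fin n → ℝ | StrictAnti y}, topWeight β F t y * ENNReal.ofReal (vdm β y) :=
      fun t => h3 _ ((measurable_topWeight β hF).comp (measurable_const.prodMk measurable_id))
        (symmFun_topWeight β hFs t)
    have h5 : Measurable fun t => ∫⁻ y in {y : Fin n → ℝ | StrictAnti y},
        topWeight β F t y * ENNReal.ofReal (vdm β y) := by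
      have h6 : Measurable fun z : ℝ × (Fin n → ℝ) =>
          topWeight β F z.1 z.2 * ENNReal.ofReal (vdm β z.2) :=
        (measurable_topWeight β hF).mul
          ((continuous_vdm β n).measurable.comp measurable_snd).ennreal_ofReal
      exact h6.lintegral_prod_right'
    simp only [h4]
    rw [lintegral_const_mul _ h5, lintegral_topWeight β hF]

end Weyl

section Symmetrization

lemma vdm_eq_abs_det_pow (b : ℕ) {n : ℕ} (x : Fin n → ℝ) :
    vdm b x = |(vandermonde x).det| ^ b := by
  rw [det_vandermonde, vdm, Finset.abs_prod, ← Finset.prod_pow]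
  refine Finset.prod_congr rfl fun i _ => ?_
  rw [Finset.abs_prod, ← Finset.prod_pow]
  exact Finset.prod_congr rfl fun j _ => by rw [abs_sub_comm]

lemma vdm_comp_perm (b : ℕ) {n : ℕ} (x : Fin n → ℝ) (σ : Equiv.Perm (Fin n)) :
    vdm b (x ∘ σ) = vdm b x := by
  have h : vandermonde (x ∘ σ) = (vandermonde x).submatrix σ id := by
    ext i j
    simp [vandermonde_apply]
  rw [vdm_eq_abs_det_pow, vdm_eq_abs_det_pow, h, det_permute, abs_mul]
  rcases Int.units_eq_one_or (Equiv.Perm.sign σ) with h | h <;> simp [h]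

lemma SymmFun.comp_perm {n : ℕ} {α : Type*} {F : (Fin n → ℝ) → α} (hF : SymmFun F)
    (x : Fin n → ℝ) (σ : Equiv.Perm (Fin n)) : F (x ∘ σ) = F x := by
  refine hF _ _ ?_
  rw [← Multiset.map_map]
  congr 1
  simp

lemma measurePreserving_comp_perm {n : ℕ} (σ : Equiv.Perm (Fin n)) :
    MeasurePreserving (fun x : Fin n → ℝ => x ∘ σ) volume volume := by
  have h := volume_measurePreserving_piCongrLeft (fun _ : Fin n => ℝ) σ.symm
  convert h using 1
  ext x i
  obtain ⟨j, rfl⟩ := σ.symm.surjective i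
  exact (Equiv.piCongrLeft_apply_apply (fun _ : Fin n => ℝ) σ.symm x j).symm ▸ by simp

lemma exists_strictAnti_comp_perm {n : ℕ} {x : Fin n → ℝ} (hx : Function.Injective x) :
    ∃ σ : Equiv.Perm (Fin n), StrictAnti (x ∘ σ) := by
  refine ⟨Tuple.sort (fun i => -x i), ?_⟩
  have h := Tuple.monotone_sort (fun i => -x i)
  have h' : Antitone (x ∘ Tuple.sort (fun i => -x i)) := fun i j hij => neg_le_neg_iff.1 (h hij)
  exact h'.strictAnti_of_injective (hx.comp (Equiv.injective _))

lemma lintegral_vdm_le_factorial_mul {b : ℕ} (hb : b ≠ 0) {n : ℕ} {F : (Fin n → ℝ) → ℝ≥0∞}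
    (hF : Measurable F) (hFs : SymmFun F) :
    ∫⁻ x, F x * ENNReal.ofReal (vdm b x) ≤
      (n.factorial : ℝ≥0∞) *
        ∫⁻ x in {x : Fin n → ℝ | StrictAnti x}, F x * ENNReal.ofReal (vdm b x) := by
  obtain ⟨g, hg⟩ : ∃ g, g = {x : Fin n → ℝ | StrictAnti x}.indicator
      fun x => F x * ENNReal.ofReal (vdm b x) := ⟨_, rfl⟩
  have hgm : Measurable g := hg ▸
    (hF.mul (continuous_vdm b n).measurable.ennreal_ofReal).indicator (measurableSet_strictAnti n)
  have hle : ∀ x, F x * ENNReal.ofReal (vdm b x) ≤ ∑ σ : Equiv.Perm (Fin n), g (x ∘ σ) := by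
    intro x
    by_cases hx : Function.Injective x
    · obtain ⟨σ, hσ⟩ := exists_strictAnti_comp_perm hx
      refine le_trans (le_of_eq ?_)
        (Finset.single_le_sum (f := fun σ : Equiv.Perm (Fin n) => g (x ∘ σ))
          (fun _ _ => zero_le) (Finset.mem_univ σ))
      have hσ' : x ∘ σ ∈ {x : Fin n → ℝ | StrictAnti x} := hσ
      simp only [hg]
      rw [Set.indicator_of_mem hσ', hFs.comp_perm, vdm_comp_perm]
    · rw [vdm_eq_zero hb hx]
      simp
  calc ∫⁻ x, F x * ENNReal.ofReal (vdm b x)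
      ≤ ∫⁻ x, ∑ σ : Equiv.Perm (Fin n), g (x ∘ σ) := lintegral_mono hle
    _ = ∑ σ : Equiv.Perm (Fin n), ∫⁻ x, g (x ∘ σ) :=
        lintegral_finsetSum _ fun σ _ => hgm.comp (measurePreserving_comp_perm σ).measurable
    _ = ∑ _σ : Equiv.Perm (Fin n), ∫⁻ x, g x :=
        Finset.sum_congr rfl fun σ _ => (measurePreserving_comp_perm σ).lintegral_comp hgm
    _ = _ := by
        rw [Finset.sum_const, Finset.card_univ, Fintype.card_perm, Fintype.card_fin,
          nsmul_eq_mul, hg, lintegral_indicator (measurableSet_strictAnti n)]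

end Symmetrization

section Assembly

variable {𝕜 : Type} [RCLike 𝕜] [MeasurableSpace 𝕜] [BorelSpace 𝕜]

lemma measure_eigs_le {β : ℕ} (hβ : Module.finrank ℝ 𝕜 = β) (hβ0 : β ≠ 0) {n : ℕ}
    (μ : Measure (HMat 𝕜 n)) [μ.IsAddHaarMeasure] {S K : Set (Fin n → ℝ)}
    (hS : MeasurableSet S) (hK : MeasurableSet K) (hSs : SymmFun (· ∈ S)) (hKs : SymmFun (· ∈ K))
    {E : ℝ≥0∞}
    (h : (n.factorial : ℝ≥0∞) * ∫⁻ x in S, ENNReal.ofReal (vdm β x) ≤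
      E * ∫⁻ x in K, ENNReal.ofReal (vdm β x)) :
    μ {A | eigs A ∈ S} ≤ E * μ {A | eigs A ∈ K} := by
  obtain ⟨c, hc⟩ := exists_lintegral_eigs hβ n μ
  have hind : ∀ {U : Set (Fin n → ℝ)}, SymmFun (· ∈ U) →
      SymmFun (U.indicator (1 : (Fin n → ℝ) → ℝ≥0∞)) := fun {U} hU x y hxy => by
    classical
    have h1 : (x ∈ U) = (y ∈ U) := hU x y hxy
    simp only [Set.indicator_apply, h1]
    rfl
  have hmul : ∀ {U : Set (Fin n → ℝ)} (x : Fin n → ℝ),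
      U.indicator (1 : (Fin n → ℝ) → ℝ≥0∞) x * ENNReal.ofReal (vdm β x) =
        U.indicator (fun x => ENNReal.ofReal (vdm β x)) x := fun {U} x => by
    by_cases hx : x ∈ U <;> simp [hx]
  have hμ : ∀ {U : Set (Fin n → ℝ)}, MeasurableSet U → SymmFun (· ∈ U) →
      μ {A | eigs A ∈ U} = c * ∫⁻ x in {x : Fin n → ℝ | StrictAnti x},
        U.indicator (fun x => ENNReal.ofReal (vdm β x)) x := fun {U} hU hUs => by
    have h1 := hc (U.indicator 1) (measurable_one.indicator hU) (hind hUs)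
    simp only [hmul] at h1
    rw [← h1]
    exact (lintegral_indicator_one (hU.preimage (measurable_eigs n))).symm
  rw [hμ hS hSs, hμ hK hKs, mul_left_comm]
  refine mul_le_mul' le_rfl ?_
  have hn0 : (n.factorial : ℝ≥0∞) ≠ 0 := by exact_mod_cast n.factorial_ne_zero
  rw [← ENNReal.mul_le_mul_iff_right hn0 (ENNReal.natCast_ne_top _)]
  refine (mul_le_mul' le_rfl (setLIntegral_le_lintegral _ _)).trans ?_
  rw [lintegral_indicator hS, mul_left_comm]
  refine h.trans (mul_le_mul' le_rfl ?_)
  have h2 := lintegral_vdm_le_factorial_mul hβ0 (measurable_one.indicator hK) (hind hKs)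
  simp only [hmul] at h2
  rwa [lintegral_indicator hK] at h2

lemma setLIntegral_vdm_eq_smul (b : ℕ) {n : ℕ} {r : ℝ} (hr : 0 < r) {U : Set (Fin n → ℝ)}
    (hU : MeasurableSet U) :
    ∫⁻ x in U, ENNReal.ofReal (vdm b x) =
      ENNReal.ofReal (r ^ (n + b * ∑ i : Fin n, (Finset.Ioi i).card)) *
        ∫⁻ x in {x | r • x ∈ U}, ENNReal.ofReal (vdm b x) := by
  have h := lintegral_smul_vdm b hr (measurable_one.indicator hU)
  have hU' : MeasurableSet {x : Fin n → ℝ | r • x ∈ U} := hU.preimage (measurable_const_smul r)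
  rw [← lintegral_indicator hU, ← lintegral_indicator hU']
  refine Eq.trans (lintegral_congr fun x => ?_) (h.trans (congrArg _ (lintegral_congr fun x => ?_)))
  · by_cases hx : x ∈ U <;> simp [hx]
  · by_cases hx : r • x ∈ U <;> simp [hx]

lemma measurableSet_badSet {p q : ℝ} (hp : 0 < p) (hq : 0 < q) (δ : ℝ) (n : ℕ) :
    MeasurableSet (badSet p q δ n) :=
  (measurableSet_le (continuous_sum_abs_rpow hp n).measurable measurable_const).inter
    (measurableSet_lt measurable_const
      (((continuous_sum_abs_rpow hq n).div_const _).sub continuous_const).abs.measurable)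

lemma Cpq_eq {p q : ℝ} (hp : 0 < p) (hq : 0 < q) :
    Cpq p q = ullMom p q ^ (1 / q) / ullMom p p ^ (1 / p) := by
  rw [Cpq, ullMom_eq hp hq, ullMom_eq hp hp, show p / (p + p) = 1 / 2 by field_simp; norm_num]

/-- Eigenvalue vectors in the unit ball whose normalized `ℓ_q`-norm is `ε`-far from `Cpq`. -/
def ballBadSet (p q ε : ℝ) (n : ℕ) : Set (Fin n → ℝ) :=
  {x | ∑ i, |x i| ^ p ≤ 1 ∧
    ε < |(n : ℝ) ^ (1 / p - 1 / q) * (∑ i, |x i| ^ q) ^ (1 / q) - Cpq p q|}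

lemma rescaled_norm_eq {p q : ℝ} (hp : 0 < p) (hq : 0 < q) {n : ℕ} (hn : 0 < n)
    (x : Fin n → ℝ) :
    (n : ℝ) ^ (1 / p - 1 / q) * (∑ i, |x i| ^ q) ^ (1 / q) =
      ((∑ i, |(((n : ℝ) * ullMom p p) ^ (1 / p) • x) i| ^ q) / n) ^ (1 / q) /
        ullMom p p ^ (1 / p) := by
  have hm := ullMom_pos hp hp
  have hn' : (0 : ℝ) < n := by exact_mod_cast hn
  have hQ : 0 ≤ ∑ i, |x i| ^ q := Finset.sum_nonneg fun i _ => by positivity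
  obtain ⟨r, hr⟩ : ∃ r, r = ((n : ℝ) * ullMom p p) ^ (1 / p) := ⟨_, rfl⟩
  have hr0 : 0 < r := by rw [hr]; positivity
  have h1 : ∑ i, |(r • x) i| ^ q = r ^ q * ∑ i, |x i| ^ q := by
    rw [Finset.mul_sum]
    refine Finset.sum_congr rfl fun i _ => ?_
    rw [Pi.smul_apply, smul_eq_mul, abs_mul, abs_of_pos hr0,
      Real.mul_rpow hr0.le (abs_nonneg _)]
  rw [← hr, h1, Real.div_rpow (by positivity) hn'.le, Real.mul_rpow (by positivity) hQ,
    ← Real.rpow_mul hr0.le, mul_one_div_cancel hq.ne', Real.rpow_one, hr,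
    Real.mul_rpow hn'.le hm.le, Real.rpow_sub hn']
  have : 0 < ullMom p p ^ (1 / p) := by positivity
  field_simp

lemma exists_ballBadSet_subset {p q ε : ℝ} (hp : 0 < p) (hq : 0 < q) (hε : 0 < ε) :
    ∃ δ > 0, ∀ n : ℕ, 0 < n → ballBadSet p q ε n ⊆
      {x | ((n : ℝ) * ullMom p p) ^ (1 / p) • x ∈ badSet p q δ n} := by
  have hm := ullMom_pos hp hp
  have hc : ContinuousAt (fun t : ℝ => t ^ (1 / q) / ullMom p p ^ (1 / p)) (ullMom p q) :=
    (Real.continuousAt_rpow_const _ _ (Or.inr (by positivity))).div_const _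
  obtain ⟨δ, hδ, h⟩ := Metric.continuousAt_iff.1 hc ε hε
  refine ⟨δ / 2, by positivity, fun n hn x hx => ?_⟩
  have hn' : (0 : ℝ) < n := by exact_mod_cast hn
  refine ⟨?_, ?_⟩
  · rw [sum_abs_rpow_smul hp (by positivity)]
    exact mul_le_of_le_one_right (by positivity) hx.1
  · by_contra hcon
    have h1 := h (lt_of_le_of_lt (Real.dist_eq _ _ ▸ not_lt.1 hcon) (half_lt_self hδ))
    rw [Real.dist_eq, ← rescaled_norm_eq hp hq hn, ← Cpq_eq hp hq] at h1
    exact lt_asymm hx.2 h1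

lemma eventually_ballBadSet_le {b : ℕ} (hb : b ≠ 0) {p q ε : ℝ} (hp : 0 < p) (hq : 0 < q)
    (hε : 0 < ε) :
    ∃ n₀ : ℕ, ∀ n ≥ n₀,
      (n.factorial : ℝ≥0∞) * ∫⁻ x in ballBadSet p q ε n, ENNReal.ofReal (vdm b x) ≤
        ENNReal.ofReal (Real.exp (-n)) *
          ∫⁻ x in {x : Fin n → ℝ | ∑ i, |x i| ^ p ≤ 1}, ENNReal.ofReal (vdm b x) := by
  obtain ⟨δ, hδ, hsub⟩ := exists_ballBadSet_subset hp hq hε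
  obtain ⟨n₀, h⟩ := eventually_badSet_le hb hp hq hδ
  refine ⟨max n₀ 1, fun n hn => ?_⟩
  have hn1 : 0 < n := lt_of_lt_of_le one_pos ((le_max_right _ _).trans hn)
  have hs : 0 < (n : ℝ) * ullMom p p := mul_pos (by exact_mod_cast hn1) (ullMom_pos hp hp)
  have hr : 0 < ((n : ℝ) * ullMom p p) ^ (1 / p) := Real.rpow_pos_of_pos hs _
  have hball : {x : Fin n → ℝ | ((n : ℝ) * ullMom p p) ^ (1 / p) • x ∈
      {x : Fin n → ℝ | ∑ i, |x i| ^ p ≤ n * ullMom p p}} = {x | ∑ i, |x i| ^ p ≤ 1} := by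
    ext x
    change ∑ i, |(((n : ℝ) * ullMom p p) ^ (1 / p) • x) i| ^ p ≤ _ ↔ ∑ i, |x i| ^ p ≤ 1
    rw [sum_abs_rpow_smul hp hs, mul_le_iff_le_one_right hs]
  have h1 := h n ((le_max_left _ _).trans hn)
  rw [setLIntegral_vdm_eq_smul b hr (measurableSet_badSet hp hq δ n),
    setLIntegral_vdm_eq_smul b hr
      (measurableSet_le (continuous_sum_abs_rpow hp n).measurable measurable_const), hball,
    mul_left_comm, mul_left_comm (ENNReal.ofReal (Real.exp (-n))),
    ENNReal.mul_le_mul_iff_right (by simpa using pow_pos hr _) ENNReal.ofReal_ne_top] at h1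
  exact (mul_le_mul' le_rfl (lintegral_mono_set (hsub n hn1))).trans h1

lemma symmFun_sum {n : ℕ} (g : ℝ → ℝ) : SymmFun fun x : Fin n → ℝ => ∑ i, g (x i) :=
  fun x y h => by
    have := congrArg (fun s => (s.map g).sum) h
    rw [Multiset.map_map, Multiset.map_map] at this
    exact this

lemma isAddHaarMeasure_map_equiv {E : Type*} [NormedAddCommGroup E] [InnerProductSpace ℝ E]
    [FiniteDimensional ℝ E] [MeasurableSpace E] [BorelSpace E] {n : ℕ}
    (T : E ≃ₗ[ℝ] HMat 𝕜 n) : (Measure.map T (volume : Measure E)).IsAddHaarMeasure := by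
  have := finite_hMat (𝕜 := 𝕜) n
  exact T.toContinuousLinearEquiv.isAddHaarMeasure_map volume

end Assembly

theorem stmt15 (𝕜 : Type) [RCLike 𝕜] [MeasurableSpace 𝕜] [BorelSpace 𝕜]
    (β : ℕ) (hβ : Module.finrank ℝ 𝕜 = β)
    (p q : ℝ) (hp : 0 < p) (hq : 0 < q)
    -- `vol n` is the Lebesgue volume on `H_n(F_β)` induced by the inner product
    -- `⟨A,B⟩ = Re Tr (A Bᴴ)`.
    (vol : ∀ n : ℕ, Measure (HMat 𝕜 n))
    (T : ∀ n : ℕ, EuclideanSpace ℝ (Fin (β * (n * (n - 1) / 2) + n)) ≃ₗ[ℝ] HMat 𝕜 n)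
    (hT : ∀ n x y, ⟪x, y⟫ = RCLike.re (Matrix.trace ((T n x).val * ((T n y).val)ᴴ)))
    (hvol : ∀ n, vol n = Measure.map (T n) volume)
    -- `μZ n` is the uniform distribution on the matrix ball `B^n_{p,β}`
    (μZ : ∀ n : ℕ, Measure (HMat 𝕜 n))
    (hμZ : ∀ n, μZ n = ((vol n) (matBall 𝕜 n p))⁻¹ • (vol n).restrict (matBall 𝕜 n p)) :
    ∀ ε : ℝ, 0 < ε →
      Tendsto
        (fun n : ℕ =>
          (μZ n) {A : HMat 𝕜 n |
            ε < |(n : ℝ) ^ (1 / p - 1 / q) * (∑ i, |eigs A i| ^ q) ^ (1 / q) - Cpq p q|})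
        atTop (nhds 0) := by
  intro ε hε
  have hβ0 : β ≠ 0 := hβ ▸ (Module.finrank_pos (R := ℝ) (M := 𝕜)).ne'
  obtain ⟨n₀, hn₀⟩ := eventually_ballBadSet_le hβ0 hp hq hε
  have hlim : Tendsto (fun n : ℕ => ENNReal.ofReal (Real.exp (-n))) atTop (nhds 0) := by
    rw [← ENNReal.ofReal_zero]
    exact ENNReal.tendsto_ofReal
      (Real.tendsto_exp_neg_atTop_nhds_zero.comp tendsto_natCast_atTop_atTop)
  refine tendsto_of_tendsto_of_tendsto_of_le_of_le' tendsto_const_nhds hlim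
    (Eventually.of_forall fun _ => zero_le) ?_
  filter_upwards [eventually_ge_atTop n₀] with n hn
  have hfar : MeasurableSet {x : Fin n → ℝ |
      ε < |(n : ℝ) ^ (1 / p - 1 / q) * (∑ i, |x i| ^ q) ^ (1 / q) - Cpq p q|} :=
    measurableSet_lt measurable_const
      (((((continuous_sum_abs_rpow hq n).measurable.pow_const (1 / q)).const_mul _).sub_const
        _).norm)
  have hK : MeasurableSet {x : Fin n → ℝ | ∑ i, |x i| ^ p ≤ 1} :=
    measurableSet_le (continuous_sum_abs_rpow hp n).measurable measurable_const
  have hP := symmFun_sum (n := n) fun t => |t| ^ p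
  have hQ := symmFun_sum (n := n) fun t => |t| ^ q
  have hvolH : (vol n).IsAddHaarMeasure := hvol n ▸ isAddHaarMeasure_map_equiv (T n)
  have hle := measure_eigs_le hβ hβ0 (vol n) (hK.inter hfar) hK
    (fun x y h => by
      have h1 := hP x y h
      have h2 := hQ x y h
      simp only at h1 h2
      simp only [Set.mem_inter_iff, Set.mem_ofPred_eq, h1, h2])
    (fun x y h => by
      have h1 := hP x y h
      simp only at h1
      simp only [Set.mem_ofPred_eq, h1]) (hn₀ n hn)
  have hrestrict := Measure.restrict_apply (μ := vol n) (s := matBall 𝕜 n p)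
    (hfar.preimage (measurable_eigs n))
  rw [Set.inter_comm] at hrestrict
  rw [hμZ n, Measure.smul_apply, smul_eq_mul]
  calc _ ≤ (vol n (matBall 𝕜 n p))⁻¹ *
        (ENNReal.ofReal (Real.exp (-n)) * vol n (matBall 𝕜 n p)) := mul_le_mul' le_rfl (hrestrict.trans_le hle)
    _ = ENNReal.ofReal (Real.exp (-n)) *
        ((vol n (matBall 𝕜 n p))⁻¹ * vol n (matBall 𝕜 n p)) := mul_left_comm _ _ _
    _ ≤ ENNReal.ofReal (Real.exp (-n)) := mul_le_of_le_one_right' (ENNReal.inv_mul_le_one _)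

end
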